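/- arXiv:2001.08627 — 2 statements merged into one kernel-verified Lean document; each statement's English description precedes it below -/
import Mathlib

section
/- Let φ be a semiflow on E satisfying (H1), (H2) with j = 2, (H3), (COM) and (S). Let v : ℝ → E be a complete trajectory that is bounded in the past (i.e., {v(t) : t ≤ 0} is bounded in E). Then its α-limit set α := ⋂_{s≤0} closure(⋃_{t≤s}{v(t)}) is one of: (T1) a single stationary point; (T2) a periodic orbit; (T3) a union of a nonempty set N of stationary points and a set of orbits of complete trajectories whose α-limit sets and ω-limit sets are contained in N. -/
open Set Filter Topology MeasureTheory Bornology

/-- A semiflow on a Banach space `E`. -/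
structure Semiflow (E : Type*) [NormedAddCommGroup E] [NormedSpace ℝ E] where
  toFun : ℝ → E → E
  map_zero' : ∀ v : E, toFun 0 v = v
  map_add' : ∀ t s : ℝ, 0 ≤ t → 0 ≤ s → ∀ v : E, toFun (t + s) v = toFun t (toFun s v)
  continuousOn' : ContinuousOn (fun p : ℝ × E => toFun p.1 p.2) (Set.Ici (0 : ℝ) ×ˢ Set.univ)

/-- The open `r`-neighborhood `O_r(γ)` of a set `γ` in a normed space. -/
def setNbhd {E : Type*} [NormedAddCommGroup E] (γ : Set E) (r : ℝ) : Set E :=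
  {v | ∃ w ∈ γ, ‖v - w‖ < r}

/-- `S` is an `ε`-section at `x₀` of the (partial) flow `ξ` on the set `M`. -/
def IsSectionOn {X : Type*} [TopologicalSpace X] (M : Set X) (ξ : ℝ → X → X)
    (ε : ℝ) (x₀ : X) (S : Set X) : Prop :=
  x₀ ∈ S ∧ S ⊆ M ∧
    (∃ W : Set X, IsOpen W ∧ x₀ ∈ W ∧
      W ∩ M ⊆ ⋃ t ∈ Set.Icc (-ε) ε, ξ t '' S) ∧
    ∀ y ∈ ⋃ t ∈ Set.Icc (-ε) ε, ξ t '' S,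
      ∃! p : ℝ × X, p.1 ∈ Set.Icc (-ε) ε ∧ p.2 ∈ S ∧ ξ p.1 p.2 = y

/-- `T` is an `ε`-transversal at `x₀` of the (partial) flow `ξ` on the set `M`:
an `ε`-section which is the image of a topological embedding of `[-1,1]`,
with `x₀` corresponding to an interior point. -/
def IsTransversalOn {X : Type*} [TopologicalSpace X] (M : Set X) (ξ : ℝ → X → X)
    (ε : ℝ) (x₀ : X) (T : Set X) : Prop :=
  IsSectionOn M ξ ε x₀ T ∧
    ∃ h : ℝ → X, ContinuousOn h (Set.Icc (-1 : ℝ) 1) ∧ Set.InjOn h (Set.Icc (-1 : ℝ) 1) ∧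
      h '' Set.Icc (-1 : ℝ) 1 = T ∧ ∃ s₀ ∈ Set.Ioo (-1 : ℝ) 1, h s₀ = x₀

namespace Semiflow

variable {E : Type*} [NormedAddCommGroup E] [NormedSpace ℝ E]
variable {H : Type*} [NormedAddCommGroup H] [InnerProductSpace ℝ H]

/-- A stationary point of the semiflow. -/
def IsStationary (φ : Semiflow E) (v₀ : E) : Prop :=
  ∀ t : ℝ, 0 ≤ t → φ.toFun t v₀ = v₀

/-- A periodic (non-stationary) point of the semiflow. -/
def IsPeriodicPt (φ : Semiflow E) (v₀ : E) : Prop :=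
  ¬ φ.IsStationary v₀ ∧ ∃ σ : ℝ, 0 < σ ∧ φ.toFun σ v₀ = v₀

/-- The positive semi-orbit `γ⁺(v₀)` (which equals the full orbit for periodic points). -/
def orbit (φ : Semiflow E) (v₀ : E) : Set E :=
  {w | ∃ t : ℝ, 0 ≤ t ∧ φ.toFun t v₀ = w}

/-- `γ` is a periodic orbit of the semiflow. -/
def IsPeriodicOrbit (φ : Semiflow E) (γ : Set E) : Prop :=
  ∃ v₀ : E, φ.IsPeriodicPt v₀ ∧ γ = φ.orbit v₀

/-- The ω-limit set of a point. -/
def omegaLimit (φ : Semiflow E) (v₀ : E) : Set E :=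
  ⋂ s ∈ Set.Ici (0 : ℝ), closure {w | ∃ t : ℝ, s ≤ t ∧ φ.toFun t v₀ = w}

/-- A complete trajectory of the semiflow. -/
def IsCompleteTrajectory (φ : Semiflow E) (v : ℝ → E) : Prop :=
  Continuous v ∧ ∀ t : ℝ, 0 ≤ t → ∀ s : ℝ, v (t + s) = φ.toFun t (v s)

/-- The α-limit set of a complete trajectory. -/
def alphaLimitOf (φ : Semiflow E) (v : ℝ → E) : Set E :=
  ⋂ s ∈ Set.Iic (0 : ℝ), closure {w | ∃ t : ℝ, t ≤ s ∧ v t = w}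

/-- Hypothesis (H1): `P` is symmetric and positive on `Eplus`, negative on `Eminus`,
with `E = Eplus ⊕ Eminus`. -/
def IsH1 (P : E →L[ℝ] E →L[ℝ] ℝ) (Eplus Eminus : Submodule ℝ E) : Prop :=
  (∀ v w : E, P v w = P w v) ∧ IsClosed (Eplus : Set E) ∧ IsClosed (Eminus : Set E) ∧
    IsCompl Eplus Eminus ∧
    (∀ v ∈ Eplus, v ≠ 0 → 0 < P v v) ∧ (∀ v ∈ Eminus, v ≠ 0 → P v v < 0)

/-- Hypothesis (H3): squeezing with respect to `V(v) = ⟨v, Pv⟩`, with parameters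
`δ > 0`, `τV ≥ 0`, `ν > 0`; the embedding `E ↪ H` is `ι`. -/
def IsH3 (φ : Semiflow E) (ι : E →L[ℝ] H) (P : E →L[ℝ] E →L[ℝ] ℝ) (δ τV ν : ℝ) : Prop :=
  0 < δ ∧ 0 ≤ τV ∧ 0 < ν ∧
    ∀ v₁ v₂ : E, ∀ l r : ℝ, 0 ≤ l → l ≤ r → τV ≤ r - l →
      Real.exp (2 * ν * r) *
          P (φ.toFun r v₁ - φ.toFun r v₂) (φ.toFun r v₁ - φ.toFun r v₂) -
        Real.exp (2 * ν * l) *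
          P (φ.toFun l v₁ - φ.toFun l v₂) (φ.toFun l v₁ - φ.toFun l v₂) ≤
      -δ * ∫ s in l..r, Real.exp (2 * ν * s) * ‖ι (φ.toFun s v₁) - ι (φ.toFun s v₂)‖ ^ 2

/-- Hypothesis (COM): some time-`τ` map takes bounded sets to precompact sets. -/
def IsCOM (φ : Semiflow E) : Prop :=
  ∃ τ : ℝ, 0 < τ ∧ ∀ B : Set E, IsBounded B → IsCompact (closure (φ.toFun τ '' B))

/-- Hypothesis (S): a smoothing estimate from `H` to `E`. -/
def IsSmoothing (φ : Semiflow E) (ι : E →L[ℝ] H) : Prop :=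
  ∃ τ C : ℝ, 0 ≤ τ ∧ 0 < C ∧
    ∀ v₁ v₂ : E, ‖φ.toFun τ v₁ - φ.toFun τ v₂‖ ≤ C * ‖ι v₁ - ι v₂‖

/-- An amenable trajectory: a complete trajectory with
`∫_{-∞}^0 e^{2νs} |v(s)|²_H ds < ∞`. -/
def IsAmenableTrajectory (φ : Semiflow E) (ι : E →L[ℝ] H) (ν : ℝ) (v : ℝ → E) : Prop :=
  φ.IsCompleteTrajectory v ∧
    IntegrableOn (fun s : ℝ => Real.exp (2 * ν * s) * ‖ι (v s)‖ ^ 2) (Set.Iic (0 : ℝ))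

/-- The amenable set `𝔄`: points through which an amenable trajectory passes. -/
def amenableSet (φ : Semiflow E) (ι : E →L[ℝ] H) (ν : ℝ) : Set E :=
  {v₀ | ∃ v : ℝ → E, φ.IsAmenableTrajectory ι ν v ∧ v 0 = v₀}

/-- Orbital stability of a set `γ`. -/
def IsOrbitallyStable (φ : Semiflow E) (γ : Set E) : Prop :=
  ∀ ε : ℝ, 0 < ε → ∃ δ : ℝ, 0 < δ ∧
    ∀ v ∈ setNbhd γ δ, ∀ t : ℝ, 0 ≤ t → φ.toFun t v ∈ setNbhd γ ε

/-- Amenable stability: orbital stability with respect to initial data in `𝔄`. -/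
def IsAmenableStable (φ : Semiflow E) (ι : E →L[ℝ] H) (ν : ℝ) (γ : Set E) : Prop :=
  ∀ ε : ℝ, 0 < ε → ∃ δ : ℝ, 0 < δ ∧
    ∀ v ∈ setNbhd γ δ ∩ φ.amenableSet ι ν, ∀ t : ℝ, 0 ≤ t → φ.toFun t v ∈ setNbhd γ ε

/-- Lyapunov stability of a stationary point. -/
def IsLyapunovStable (φ : Semiflow E) (v₀ : E) : Prop :=
  ∀ ε : ℝ, 0 < ε → ∃ δ : ℝ, 0 < δ ∧
    ∀ v : E, ‖v - v₀‖ < δ → ∀ t : ℝ, 0 ≤ t → ‖φ.toFun t v - v₀‖ < ε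

/-- `D` is a `k`-dimensional local unstable set for the stationary point `v₀`:
(U1) `D` is a homeomorphic image of an open `k`-cube; (U2) through every point of `D`
there is a unique complete trajectory, converging to `v₀` as `t → -∞`;
(U3) trajectories through points of `D` near `v₀` stay near `v₀` for `t ≤ 0`. -/
def IsLocalUnstableSet (φ : Semiflow E) (k : ℕ) (v₀ : E) (D : Set E) : Prop :=
  v₀ ∈ D ∧
    Nonempty (↥(Set.pi Set.univ fun _ : Fin k => Set.Ioo (0 : ℝ) 1) ≃ₜ ↥D) ∧
    (∀ w₀ ∈ D, ∃! w : ℝ → E, φ.IsCompleteTrajectory w ∧ w 0 = w₀) ∧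
    (∀ w₀ ∈ D, ∀ w : ℝ → E, φ.IsCompleteTrajectory w → w 0 = w₀ →
      Filter.Tendsto w Filter.atBot (nhds v₀)) ∧
    (∀ ε : ℝ, 0 < ε → ∃ δ : ℝ, 0 < δ ∧ ∀ w₀ ∈ D, ‖w₀ - v₀‖ < δ →
      ∀ w : ℝ → E, φ.IsCompleteTrajectory w → w 0 = w₀ → ∀ t : ℝ, t ≤ 0 → ‖w t - v₀‖ < ε)

/-- An unstable terminal point: a stationary point with a 2-dimensional local unstable set. -/
def IsUnstableTerminal (φ : Semiflow E) (v₀ : E) : Prop :=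
  φ.IsStationary v₀ ∧ ∃ D : Set E, φ.IsLocalUnstableSet 2 v₀ D

/-- A terminal point: a stationary point that is Lyapunov stable or has a
2-dimensional local unstable set. -/
def IsTerminal (φ : Semiflow E) (v₀ : E) : Prop :=
  φ.IsStationary v₀ ∧
    (φ.IsLyapunovStable v₀ ∨ ∃ D : Set E, φ.IsLocalUnstableSet 2 v₀ D)

/-- An attractor: a bounded closed set with an open neighborhood all of whose points have
precompact positive semi-orbits with ω-limit sets inside the set. -/
def IsAttractor (φ : Semiflow E) (A : Set E) : Prop :=
  IsBounded A ∧ IsClosed A ∧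
    ∃ U : Set E, IsOpen U ∧ A ⊆ U ∧
      ∀ v₀ ∈ U, IsCompact (closure (φ.orbit v₀)) ∧ φ.omegaLimit v₀ ⊆ A

/-- `Pi` is the `V`-orthogonal projector onto `Eminus`. -/
def IsVProjector (P : E →L[ℝ] E →L[ℝ] ℝ) (Eminus : Submodule ℝ E) (Pi : E → E) : Prop :=
  ∀ v : E, Pi v ∈ Eminus ∧ ∀ w ∈ Eminus, P w v = P w (Pi v)

/-- The interior region `𝒢_γ ⊆ 𝔄` of a periodic orbit `γ`: the preimage under `Π`
of the bounded connected component of `E⁻ \ Πγ`. -/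
def interiorRegion (φ : Semiflow E) (ι : E →L[ℝ] H) (ν : ℝ) (Eminus : Submodule ℝ E)
    (Pi : E → E) (γ : Set E) : Set E :=
  {a | a ∈ φ.amenableSet ι ν ∧ Pi a ∈ (Eminus : Set E) \ (Pi '' γ) ∧
    IsBounded (connectedComponentIn ((Eminus : Set E) \ (Pi '' γ)) (Pi a))}

/-- The partial order `γ₁ ⩽ γ₂` on periodic orbits: `𝒢_{γ₁} ⊆ 𝒢_{γ₂}`. -/
def orbitLE (φ : Semiflow E) (ι : E →L[ℝ] H) (ν : ℝ) (Eminus : Submodule ℝ E)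
    (Pi : E → E) (γ₁ γ₂ : Set E) : Prop :=
  φ.interiorRegion ι ν Eminus Pi γ₁ ⊆ φ.interiorRegion ι ν Eminus Pi γ₂

/-- External stability of a periodic orbit `γ`. -/
def IsExternallyStable (φ : Semiflow E) (ι : E →L[ℝ] H) (ν : ℝ) (Eminus : Submodule ℝ E)
    (Pi : E → E) (γ : Set E) : Prop :=
  (∃ g : ℕ → Set E, (∀ k, φ.IsPeriodicOrbit (g k)) ∧ (∀ k, g k ≠ γ) ∧
      (∀ k, φ.orbitLE ι ν Eminus Pi γ (g k)) ∧
      Filter.Tendsto (fun k => Metric.hausdorffDist (g k) γ) Filter.atTop (nhds 0)) ∨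
    (∃ v₀ ∈ φ.amenableSet ι ν \ closure (φ.interiorRegion ι ν Eminus Pi γ),
      φ.omegaLimit v₀ = γ)

/-- Internal stability of a periodic orbit `γ`. -/
def IsInternallyStable (φ : Semiflow E) (ι : E →L[ℝ] H) (ν : ℝ) (Eminus : Submodule ℝ E)
    (Pi : E → E) (γ : Set E) : Prop :=
  (∃ g : ℕ → Set E, (∀ k, φ.IsPeriodicOrbit (g k)) ∧ (∀ k, g k ≠ γ) ∧
      (∀ k, φ.orbitLE ι ν Eminus Pi (g k) γ) ∧
      Filter.Tendsto (fun k => Metric.hausdorffDist (g k) γ) Filter.atTop (nhds 0)) ∨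
    (∃ v₀ ∈ φ.interiorRegion ι ν Eminus Pi γ, φ.omegaLimit v₀ = γ)

end Semiflow

open Set Filter Topology MeasureTheory Bornology

namespace PBAux

/-- A continuous nowhere vanishing function on `[a,b]`. -/
def NZ (f : ℝ → ℂ) (a b : ℝ) : Prop :=
  ContinuousOn f (Icc a b) ∧ ∀ t ∈ Icc a b, f t ≠ 0

/-- `L` is a continuous logarithm of `f` on `[a,b]`. -/
def IsLg (L f : ℝ → ℂ) (a b : ℝ) : Prop :=
  ContinuousOn L (Icc a b) ∧ ∀ t ∈ Icc a b, Complex.exp (L t) = f t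

open Classical in
/-- The variation of the argument of `f` along `[a,b]`. -/
noncomputable def avar (f : ℝ → ℂ) (a b : ℝ) : ℝ :=
  if h : ∃ L, IsLg L f a b then (h.choose b - h.choose a).im else 0

theorem isLg_unique {L M f : ℝ → ℂ} {a b : ℝ} (hab : a ≤ b) (hL : IsLg L f a b)
    (hM : IsLg M f a b) : L b - L a = M b - M a := by
  have key : ∀ t ∈ Icc a b, ∃ n : ℤ, (L t - M t) / (2 * Real.pi * Complex.I) = n := by
    intro t ht
    have := (hL.2 t ht).trans (hM.2 t ht).symm
    obtain ⟨n, hn⟩ := Complex.exp_eq_exp_iff_exists_int.1 this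
    refine ⟨n, ?_⟩
    rw [hn]
    have : (2 * Real.pi * Complex.I) ≠ 0 := Complex.two_pi_I_ne_zero
    field_simp
    ring
  have hc : ContinuousOn (fun t => (((L t - M t) / (2 * Real.pi * Complex.I)).re)) (Icc a b) := by
    refine Complex.continuous_re.comp_continuousOn ?_
    exact (hL.1.sub hM.1).div_const _
  have hd : IsDiscrete (range (Int.cast : ℤ → ℝ)) := by
    have := Int.isClosedEmbedding_coe_real.isInducing
    exact ⟨(Int.isClosedEmbedding_coe_real.isEmbedding.toHomeomorph.symm.isEmbedding).discreteTopology⟩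
  have := isPreconnected_Icc.constant_of_mapsTo hd hc (by
    intro t ht
    obtain ⟨n, hn⟩ := key t ht
    exact ⟨n, by simp [hn]⟩) (left_mem_Icc.2 hab) (right_mem_Icc.2 hab)
  obtain ⟨n, hn⟩ := key a (left_mem_Icc.2 hab)
  obtain ⟨m, hm⟩ := key b (right_mem_Icc.2 hab)
  simp only [hn, hm, Complex.intCast_re] at this
  have e : (L a - M a) / (2 * Real.pi * Complex.I) = (L b - M b) / (2 * Real.pi * Complex.I) := by
    rw [hn, hm]; exact_mod_cast this
  have h0 : (2 * Real.pi * Complex.I) ≠ 0 := Complex.two_pi_I_ne_zero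
  rw [div_left_inj' h0] at e
  linear_combination -e

theorem avar_eq {L f : ℝ → ℂ} {a b : ℝ} (hab : a ≤ b) (hL : IsLg L f a b) :
    avar f a b = (L b - L a).im := by
  have h : ∃ L, IsLg L f a b := ⟨L, hL⟩
  rw [avar, dif_pos h, isLg_unique hab h.choose_spec hL]

theorem exists_lg_of_continuous {A : Type*} [TopologicalSpace A] [SimplyConnectedSpace A]
    [LocallyPathConnectedSpace A] (f : A → ℂ) (hf : Continuous f) (h0 : ∀ a, f a ≠ 0) (a₀ : A) :
    ∃ L : A → ℂ, Continuous L ∧ ∀ a, Complex.exp (L a) = f a := by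
  obtain ⟨F, ⟨-, hF⟩, -⟩ := Complex.isCoveringMapOn_exp.existsUnique_continuousMap_lifts
    ⟨f, hf⟩ (a₀ := a₀) (e₀ := Complex.log (f a₀)) (Complex.exp_log (h0 a₀)) (fun a => h0 a)
  exact ⟨F, F.continuous, fun a => congrFun hF a⟩

theorem exists_lg {f : ℝ → ℂ} {a b : ℝ} (hab : a ≤ b) (hf : NZ f a b) : ∃ L, IsLg L f a b := by
  have hc : Continuous (fun t => f (projIcc a b hab t)) := by
    have := continuousOn_iff_continuous_domRestrict.1 hf.1
    exact this.comp continuous_projIcc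
  obtain ⟨L, hL, hL2⟩ := exists_lg_of_continuous _ hc (fun t => hf.2 _ (projIcc a b hab t).2) 0
  refine ⟨L, hL.continuousOn, fun t ht => ?_⟩
  rw [hL2, projIcc_of_mem hab ht]

theorem avar_self (f : ℝ → ℂ) (a : ℝ) : avar f a a = 0 := by
  unfold avar
  split_ifs <;> simp

theorem NZ.mono {f : ℝ → ℂ} {a b c d : ℝ} (h : NZ f a b) (hac : a ≤ c) (hdb : d ≤ b) : NZ f c d :=
  ⟨h.1.mono (Icc_subset_Icc hac hdb), fun t ht => h.2 t (Icc_subset_Icc hac hdb ht)⟩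

theorem IsLg.mono {L f : ℝ → ℂ} {a b c d : ℝ} (h : IsLg L f a b) (hac : a ≤ c) (hdb : d ≤ b) :
    IsLg L f c d :=
  ⟨h.1.mono (Icc_subset_Icc hac hdb), fun t ht => h.2 t (Icc_subset_Icc hac hdb ht)⟩

theorem avar_add {f : ℝ → ℂ} {a b c : ℝ} (hab : a ≤ b) (hbc : b ≤ c) (hf : NZ f a c) :
    avar f a c = avar f a b + avar f b c := by
  obtain ⟨L, hL⟩ := exists_lg (hab.trans hbc) hf
  rw [avar_eq (hab.trans hbc) hL, avar_eq hab (hL.mono le_rfl hbc), avar_eq hbc (hL.mono hab le_rfl)]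
  simp

theorem avar_congr {f g : ℝ → ℂ} {a b : ℝ} (hab : a ≤ b) (hf : NZ f a b)
    (h : ∀ t ∈ Icc a b, f t = g t) : avar f a b = avar g a b := by
  obtain ⟨L, hL⟩ := exists_lg hab hf
  rw [avar_eq hab hL, avar_eq hab ⟨hL.1, fun t ht => by rw [hL.2 t ht, h t ht]⟩]

theorem avar_mul {f g : ℝ → ℂ} {a b : ℝ} (hab : a ≤ b) (hf : NZ f a b) (hg : NZ g a b) :
    avar (fun t => f t * g t) a b = avar f a b + avar g a b := by
  obtain ⟨L, hL⟩ := exists_lg hab hf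
  obtain ⟨M, hM⟩ := exists_lg hab hg
  rw [avar_eq hab hL, avar_eq hab hM, avar_eq (L := fun t => L t + M t) hab
    ⟨hL.1.add hM.1, fun t ht => by rw [Complex.exp_add, hL.2 t ht, hM.2 t ht]⟩]
  simp; ring

theorem avar_div {f g : ℝ → ℂ} {a b : ℝ} (hab : a ≤ b) (hf : NZ f a b) (hg : NZ g a b) :
    avar (fun t => f t / g t) a b = avar f a b - avar g a b := by
  obtain ⟨L, hL⟩ := exists_lg hab hf
  obtain ⟨M, hM⟩ := exists_lg hab hg
  rw [avar_eq hab hL, avar_eq hab hM, avar_eq (L := fun t => L t - M t) hab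
    ⟨hL.1.sub hM.1, fun t ht => by rw [Complex.exp_sub, hL.2 t ht, hM.2 t ht]⟩]
  simp; ring

theorem avar_slit {f : ℝ → ℂ} {a b : ℝ} (hab : a ≤ b) (hf : ContinuousOn f (Icc a b))
    (h : ∀ t ∈ Icc a b, f t ∈ Complex.slitPlane) : avar f a b = (f b).arg - (f a).arg := by
  rw [avar_eq (L := fun t => Complex.log (f t)) hab
    ⟨hf.clog h, fun t ht => Complex.exp_log (Complex.slitPlane_ne_zero (h t ht))⟩]
  simp [Complex.log_im]

theorem avar_const {z : ℂ} (hz : z ≠ 0) {a b : ℝ} (hab : a ≤ b) : avar (fun _ => z) a b = 0 := by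
  rw [avar_eq (L := fun t => Complex.log z) hab
    ⟨continuousOn_const, fun t ht => Complex.exp_log hz⟩]
  simp

theorem avar_neg {f : ℝ → ℂ} {a b : ℝ} (hab : a ≤ b) (hf : NZ f a b) :
    avar (fun t => - f t) a b = avar f a b := by
  have := avar_mul hab (f := fun _ => (-1 : ℂ)) ⟨continuousOn_const, by simp⟩ hf
  rw [avar_const (by simp) hab] at this
  simpa using this

theorem avar_shift {f : ℝ → ℂ} {a b : ℝ} (hab : a ≤ b) (c : ℝ) (hf : NZ f (c + a) (c + b)) :
    avar (fun t => f (c + t)) a b = avar f (c + a) (c + b) := by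
  obtain ⟨L, hL⟩ := exists_lg (by linarith) hf
  rw [avar_eq (by linarith) hL, avar_eq (L := fun t => L (c + t)) hab ⟨?_, fun t ht => ?_⟩]
  · exact hL.1.comp (by fun_prop) (fun t ht => ⟨by linarith [ht.1], by linarith [ht.2]⟩)
  · exact hL.2 _ ⟨by linarith [ht.1], by linarith [ht.2]⟩

theorem abs_arg_le_of_close {z w : ℂ} {θ : ℝ} (hθ : θ ≤ 1 / 2) (hw : w ≠ 0)
    (h : ‖z - w‖ ≤ θ * ‖w‖) : z / w ∈ Complex.slitPlane ∧ |(z / w).arg| ≤ 2 * θ := by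
  have e : z / w = 1 + (z - w) / w := by field_simp; ring
  have hn : ‖(z - w) / w‖ ≤ θ := by
    rw [norm_div, div_le_iff₀ (norm_pos_iff.2 hw)]; exact h
  have h0 : 0 ≤ θ := (norm_nonneg _).trans hn
  constructor
  · rw [e]; exact Complex.mem_slitPlane_of_norm_lt_one (by linarith)
  · rw [← Complex.log_im, e]
    refine (Complex.abs_im_le_norm _).trans ?_
    have := Complex.norm_log_one_add_half_le_self (hn.trans hθ)
    linarith

theorem NZ_of_close {f g : ℝ → ℂ} {a b θ : ℝ} (hθ : θ ≤ 1 / 2)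
    (hf : ContinuousOn f (Icc a b)) (hg : NZ g a b)
    (h : ∀ t ∈ Icc a b, ‖f t - g t‖ ≤ θ * ‖g t‖) : NZ f a b := by
  refine ⟨hf, fun t ht h0 => ?_⟩
  have := h t ht
  rw [h0, zero_sub, norm_neg] at this
  have := norm_pos_iff.2 (hg.2 t ht)
  nlinarith

theorem avar_close {f g : ℝ → ℂ} {a b θ : ℝ} (hab : a ≤ b) (hθ : θ ≤ 1 / 2)
    (hf : ContinuousOn f (Icc a b)) (hg : NZ g a b)
    (h : ∀ t ∈ Icc a b, ‖f t - g t‖ ≤ θ * ‖g t‖) : |avar f a b - avar g a b| ≤ 4 * θ := by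
  have hf' := NZ_of_close hθ hf hg h
  rw [← avar_div hab hf' hg, avar_slit (f := fun t => f t / g t) hab (hf.div hg.1 hg.2)
    (fun t ht => (abs_arg_le_of_close hθ (hg.2 t ht) (h t ht)).1)]
  have h1 := (abs_arg_le_of_close hθ (hg.2 a (left_mem_Icc.2 hab)) (h a (left_mem_Icc.2 hab))).2
  have h2 := (abs_arg_le_of_close hθ (hg.2 b (right_mem_Icc.2 hab)) (h b (right_mem_Icc.2 hab))).2
  rw [abs_le] at *
  constructor <;> linarith

/-- If the values stay relatively close to a constant, the variation is small. -/
theorem avar_close_const {f : ℝ → ℂ} {a b θ : ℝ} (hab : a ≤ b) (hθ : θ ≤ 1 / 2)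
    (hf : ContinuousOn f (Icc a b)) {z : ℂ} (hz : z ≠ 0)
    (h : ∀ t ∈ Icc a b, ‖f t - z‖ ≤ θ * ‖z‖) : |avar f a b| ≤ 4 * θ := by
  have := avar_close hab hθ hf (g := fun _ => z) ⟨continuousOn_const, fun _ _ => hz⟩ h
  rwa [avar_const hz hab, sub_zero] at this

theorem exp_avar {f : ℝ → ℂ} {a b : ℝ} (hab : a ≤ b) (hf : NZ f a b) :
    ∃ r : ℝ, 0 < r ∧ f b / f a = r * Complex.exp (avar f a b * Complex.I) := by
  obtain ⟨L, hL⟩ := exists_lg hab hf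
  refine ⟨Real.exp (L b - L a).re, Real.exp_pos _, ?_⟩
  rw [← hL.2 a (left_mem_Icc.2 hab), ← hL.2 b (right_mem_Icc.2 hab), ← Complex.exp_sub,
    avar_eq hab hL, Complex.ofReal_exp, ← Complex.exp_add, Complex.re_add_im]

theorem avar_mod {f : ℝ → ℂ} {a b : ℝ} (hab : a ≤ b) (hf : NZ f a b) :
    ∃ n : ℤ, avar f a b - (f b / f a).arg = n * (2 * Real.pi) := by
  obtain ⟨r, hr, h⟩ := exp_avar hab hf
  have h1 : Complex.exp (((f b / f a).arg : ℝ) * Complex.I) = Complex.exp (avar f a b * Complex.I) := by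
    have h3 := Complex.norm_mul_exp_arg_mul_I (f b / f a)
    have h2 : ‖f b / f a‖ = r := by
      rw [h, norm_mul, Complex.norm_exp_ofReal_mul_I]; simp [abs_of_pos hr]
    rw [h2] at h3
    have hr' : (r : ℂ) ≠ 0 := by exact_mod_cast hr.ne'
    exact mul_left_cancel₀ hr' (h3.trans h)
  obtain ⟨n, hn⟩ := Complex.exp_eq_exp_iff_exists_int.1 h1.symm
  refine ⟨n, ?_⟩
  have := congrArg Complex.im hn
  simp at this
  linarith

/-- Rectangle lemma. -/
theorem avar_rect {f : ℝ → ℝ → ℂ} {a b c d : ℝ} (hab : a ≤ b) (hcd : c ≤ d)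
    (hf : ContinuousOn (fun p : ℝ × ℝ => f p.1 p.2) (Icc a b ×ˢ Icc c d))
    (h0 : ∀ t ∈ Icc a b, ∀ s ∈ Icc c d, f t s ≠ 0) :
    avar (fun t => f t c) a b + avar (fun s => f b s) c d
      = avar (fun s => f a s) c d + avar (fun t => f t d) a b := by
  have hc : Continuous (fun p : ℝ × ℝ => f (projIcc a b hab p.1) (projIcc c d hcd p.2)) := by
    have := hf.comp_continuous (f := fun p : ℝ × ℝ => ((projIcc a b hab p.1 : ℝ), (projIcc c d hcd p.2 : ℝ)))
      (by fun_prop) (fun p => ⟨Subtype.coe_prop _, Subtype.coe_prop _⟩)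
    exact this
  obtain ⟨L, hL, hL2⟩ := exists_lg_of_continuous _ hc
    (fun p => h0 _ (projIcc a b hab p.1).2 _ (projIcc c d hcd p.2).2) (0, 0)
  have key : ∀ t ∈ Icc a b, ∀ s ∈ Icc c d, Complex.exp (L (t, s)) = f t s := by
    intro t ht s hs
    rw [hL2]
    simp only
    rw [projIcc_of_mem hab ht, projIcc_of_mem hcd hs]
  have h1 : ∀ s ∈ Icc c d, avar (fun t => f t s) a b = (L (b, s) - L (a, s)).im := fun s hs =>
    avar_eq (L := fun t => L (t, s)) hab ⟨by fun_prop, fun t ht => key t ht s hs⟩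
  have h2 : ∀ t ∈ Icc a b, avar (fun s => f t s) c d = (L (t, d) - L (t, c)).im := fun t ht =>
    avar_eq (L := fun s => L (t, s)) hcd ⟨by fun_prop, fun s hs => key t ht s hs⟩
  rw [h1 c (left_mem_Icc.2 hcd), h1 d (right_mem_Icc.2 hcd), h2 a (left_mem_Icc.2 hab),
    h2 b (right_mem_Icc.2 hab)]
  simp

end PBAux

open Set Filter Topology MeasureTheory Bornology

namespace PBAux

/-- Geometry of a short arc `Q` on `[-ε,ε]` together with an auxiliary point `c` close to `Q 0`. -/
structure Geo (Q : ℝ → ℂ) (ε κ R η : ℝ) (c : ℂ) : Prop where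
  cont : Continuous Q
  κpos : 0 < κ
  κle : κ ≤ ε
  ηpos : 0 < η
  farR : R ≤ ‖Q ε - Q 0‖
  farL : R ≤ ‖Q (-ε) - Q 0‖
  near : ∀ t, |t| ≤ κ → ‖Q t - Q 0‖ ≤ R / 200
  sep : ∀ t, κ ≤ |t| → |t| ≤ ε → 3 * ‖c - Q 0‖ ≤ ‖Q t - Q 0‖
  hc : ∀ t, |t| ≤ ε → 200 * η ≤ ‖Q t - c‖
  cnear : ‖c - Q 0‖ ≤ R / 200
  corner1 : ∀ s ∈ Icc 0 ε, 200 * η ≤ ‖Q (-ε) - Q s‖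
  corner2 : ∀ t ∈ Icc (-ε) 0, 200 * η ≤ ‖Q t - Q ε‖

/-- A curve which is uniformly close to `Q` on `[-ε,ε]`. -/
def IsArc (Q : ℝ → ℂ) (ε η : ℝ) (x : ℝ → ℂ) : Prop :=
  Continuous x ∧ ∀ t, |t| ≤ ε → ‖x t - Q t‖ ≤ η

/-- Disjointness of two arcs. -/
def Disj (ε : ℝ) (x y : ℝ → ℂ) : Prop := ∀ t s, |t| ≤ ε → |s| ≤ ε → x t ≠ y s

/-- The variation of the argument of the arc `y` seen from the midpoint of the arc `x`. -/
noncomputable def sig (ε : ℝ) (x y : ℝ → ℂ) : ℝ := avar (fun s => y s - x 0) (-ε) ε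

/-- distance from `c` to an arc. -/
noncomputable def dd (ε : ℝ) (c : ℂ) (x : ℝ → ℂ) : ℝ := Metric.infDist c (x '' Icc (-ε) ε)

noncomputable def cC (Q : ℝ → ℂ) (ε : ℝ) (c : ℂ) : ℝ := avar (fun s => Q s - c) (-ε) ε

noncomputable def cG (Q : ℝ → ℂ) (ε : ℝ) : ℝ :=
  avar (fun s => Q (-ε) - Q s) 0 ε + avar (fun t => Q t - Q ε) (-ε) 0

noncomputable def cD (Q : ℝ → ℂ) (ε : ℝ) (c : ℂ) : ℝ := 2 * cG Q ε - 2 * cC Q ε c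

variable {Q : ℝ → ℂ} {ε κ R η : ℝ} {c : ℂ}

theorem Geo.εpos (g : Geo Q ε κ R η c) : 0 < ε := g.κpos.trans_le g.κle

theorem Geo.η_le_K (g : Geo Q ε κ R η c) : 200 * η ≤ ‖c - Q 0‖ := by
  have := g.hc 0 (by simpa using g.εpos.le)
  rwa [norm_sub_rev] at this

theorem Geo.η_le (g : Geo Q ε κ R η c) : 40000 * η ≤ R := by
  have := g.η_le_K
  have := g.cnear
  linarith

theorem Geo.Rpos (g : Geo Q ε κ R η c) : 0 < R := by
  have := g.η_le
  have := g.ηpos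
  linarith

theorem Geo.selfArc (g : Geo Q ε κ R η c) : IsArc Q ε η Q :=
  ⟨g.cont, fun t _ => by simpa using g.ηpos.le⟩

theorem Geo.near_imp (g : Geo Q ε κ R η c) {t : ℝ} (ht : |t| ≤ ε)
    (h : ‖Q t - Q 0‖ < 3 * ‖c - Q 0‖) : |t| < κ := by
  by_contra hh
  push Not at hh
  have := g.sep t hh ht
  linarith

theorem Geo.end_bound (g : Geo Q ε κ R η c) {y : ℝ → ℂ} (hy : IsArc Q ε η y) {z : ℂ}
    (hz : ‖z - Q 0‖ ≤ R / 50) {t : ℝ} (ht : t = ε ∨ t = -ε) :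
    ‖(y t - z) - (Q t - Q 0)‖ ≤ 1 / 40 * ‖Q t - Q 0‖ := by
  have h1 : |t| ≤ ε := by
    have := g.εpos
    rcases ht with rfl | rfl
    · rw [abs_of_pos this]
    · rw [abs_neg, abs_of_pos this]
  have h2 : R ≤ ‖Q t - Q 0‖ := by
    rcases ht with rfl | rfl
    · exact g.farR
    · exact g.farL
  have h3 := hy.2 t h1
  have h4 : (y t - z) - (Q t - Q 0) = (y t - Q t) - (z - Q 0) := by ring
  rw [h4]
  have := norm_sub_le (y t - Q t) (z - Q 0)
  have := g.η_le
  have := g.Rpos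
  linarith

theorem Geo.move (g : Geo Q ε κ R η c) {y : ℝ → ℂ} (hy : IsArc Q ε η y) {ζ : ℝ → ℂ}
    (hζ : ContinuousOn ζ (Icc 0 1)) (hz : ∀ l ∈ Icc (0 : ℝ) 1, ‖ζ l - Q 0‖ ≤ R / 50)
    (hd : ∀ s, |s| ≤ ε → ∀ l ∈ Icc (0 : ℝ) 1, y s ≠ ζ l) :
    |avar (fun s => y s - ζ 0) (-ε) ε - avar (fun s => y s - ζ 1) (-ε) ε| ≤ 1 / 5 := by
  have hε := g.εpos
  have hR := g.Rpos
  have hr := avar_rect (f := fun s l => y s - ζ l) (a := -ε) (b := ε) (c := 0) (d := 1)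
    (by linarith) (by norm_num)
    (by
      refine ContinuousOn.sub (hy.1.comp continuous_fst).continuousOn ?_
      exact hζ.comp continuous_snd.continuousOn (fun p hp => hp.2))
    (fun t ht s hs => sub_ne_zero.2 (hd t (abs_le.2 ht) s hs))
  have h1 : |avar (fun l => y ε - ζ l) 0 1| ≤ 4 * (1 / 40) :=
    avar_close_const (by norm_num) (by norm_num) (by fun_prop)
      (z := Q ε - Q 0) (norm_pos_iff.1 (hR.trans_le g.farR))
      (fun t ht => g.end_bound hy (hz t ht) (Or.inl rfl))
  have h2 : |avar (fun l => y (-ε) - ζ l) 0 1| ≤ 4 * (1 / 40) :=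
    avar_close_const (by norm_num) (by norm_num) (by fun_prop)
      (z := Q (-ε) - Q 0) (norm_pos_iff.1 (hR.trans_le g.farL))
      (fun t ht => g.end_bound hy (hz t ht) (Or.inr rfl))
  rw [abs_le] at *
  constructor <;> linarith

theorem Geo.NZc (g : Geo Q ε κ R η c) : NZ (fun s => Q s - c) (-ε) ε := by
  refine ⟨(g.cont.sub continuous_const).continuousOn, fun t ht => ?_⟩
  have := g.hc t (abs_le.2 ht)
  have := g.ηpos
  exact norm_pos_iff.1 (by linarith)

theorem Geo.avar_c (g : Geo Q ε κ R η c) {y : ℝ → ℂ} (hy : IsArc Q ε η y) :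
    |avar (fun s => y s - c) (-ε) ε - cC Q ε c| ≤ 1 / 50 := by
  have := avar_close (f := fun s => y s - c) (g := fun s => Q s - c) (a := -ε) (b := ε)
    (θ := 1 / 200) (by linarith [g.εpos]) (by norm_num)
    (hy.1.sub continuous_const).continuousOn g.NZc
    (fun t ht => by
      have h1 := hy.2 t (abs_le.2 ht)
      have h2 := g.hc t (abs_le.2 ht)
      have : (y t - c) - (Q t - c) = y t - Q t := by ring
      rw [this]
      linarith)
  unfold cC
  linarith

theorem dd_attained {x : ℝ → ℂ} (hε : 0 ≤ ε) (hx : Continuous x) :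
    ∃ t, |t| ≤ ε ∧ dd ε c x = ‖x t - c‖ := by
  obtain ⟨z, ⟨t, ht, rfl⟩, h⟩ := (isCompact_Icc.image hx : IsCompact (x '' Icc (-ε) ε)).exists_infDist_eq_dist
    ((nonempty_Icc.2 (by linarith)).image x) c
  exact ⟨t, abs_le.2 ht, by rw [dd, h, dist_comm, dist_eq_norm]⟩

theorem dd_le {x : ℝ → ℂ} {t : ℝ} (ht : |t| ≤ ε) : dd ε c x ≤ ‖x t - c‖ := by
  rw [← dist_eq_norm, dist_comm]
  exact Metric.infDist_le_dist_of_mem ⟨t, abs_le.1 ht, rfl⟩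

theorem dd_close {x y : ℝ → ℂ} {θ : ℝ} (hε : 0 ≤ ε) (hx : Continuous x) (hy : Continuous y)
    (h : ∀ t, |t| ≤ ε → ‖x t - y t‖ ≤ θ) : |dd ε c x - dd ε c y| ≤ θ := by
  obtain ⟨t, ht, h1⟩ := dd_attained (c := c) hε hx
  obtain ⟨s, hs, h2⟩ := dd_attained (c := c) hε hy
  have h3 := dd_le (c := c) (x := x) hs
  have h4 := dd_le (c := c) (x := y) ht
  have h5 := h t ht
  have h6 := h s hs
  have h7 : ‖x s - c‖ ≤ ‖x s - y s‖ + ‖y s - c‖ := by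
    have := norm_add_le (x s - y s) (y s - c)
    rwa [sub_add_sub_cancel] at this
  have h8 : ‖y t - c‖ ≤ ‖x t - y t‖ + ‖x t - c‖ := by
    have := norm_add_le (y t - x t) (x t - c)
    rw [sub_add_sub_cancel, norm_sub_rev (y t) (x t)] at this
    exact this
  rw [abs_le]
  constructor <;> linarith

/-- If `x` is at least as close to `c` as `y`, then the side number is `cC`. -/
theorem Geo.sig_near (g : Geo Q ε κ R η c) {x y : ℝ → ℂ} (hx : IsArc Q ε η x)
    (hy : IsArc Q ε η y) (hxy : Disj ε x y) (hd : dd ε c x ≤ dd ε c y) :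
    |sig ε x y - cC Q ε c| ≤ 1 / 2 := by
  have hε := g.εpos
  have hη := g.ηpos
  have hR := g.Rpos
  have hηR := g.η_le
  have hηK := g.η_le_K
  have hK := g.cnear
  have habs0 : |(0 : ℝ)| ≤ ε := by simpa using hε.le
  obtain ⟨t0, ht0, h0⟩ := dd_attained (c := c) hε.le hx.1
  have hdx : dd ε c x ≤ ‖x 0 - c‖ := dd_le habs0
  have hx0 := hx.2 0 habs0
  have hxc : ‖x 0 - c‖ ≤ ‖x 0 - Q 0‖ + ‖c - Q 0‖ := by
    have := norm_sub_le (x 0 - Q 0) (c - Q 0)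
    rwa [sub_sub_sub_cancel_right] at this
  have hxt := hx.2 t0 ht0
  have hdpos : 0 < dd ε c x := by
    have h1 := g.hc t0 ht0
    have h2 : ‖Q t0 - c‖ ≤ ‖x t0 - Q t0‖ + ‖x t0 - c‖ := by
      have := norm_sub_le (x t0 - c) (x t0 - Q t0)
      rw [sub_sub_sub_cancel_left] at this
      linarith
    linarith
  have hQt : ‖Q t0 - Q 0‖ ≤ ‖x t0 - Q t0‖ + ‖x t0 - c‖ + ‖c - Q 0‖ := by
    have e : Q t0 - Q 0 = -(x t0 - Q t0) + (x t0 - c) + (c - Q 0) := by ring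
    rw [e]
    refine (norm_add₃_le).trans ?_
    rw [norm_neg]
  have ht0κ : |t0| < κ := g.near_imp ht0 (by linarith)
  -- first move
  have m1 := g.move hy (ζ := fun l => c + l • (x t0 - c)) (by fun_prop)
    (fun l hl => by
      have e : c + l • (x t0 - c) - Q 0 = (c - Q 0) + l • (x t0 - c) := by ring
      have h1 : ‖l • (x t0 - c)‖ ≤ ‖x t0 - c‖ := by
        rw [norm_smul, Real.norm_eq_abs, abs_of_nonneg hl.1]
        exact mul_le_of_le_one_left (norm_nonneg _) hl.2
      have h2 := norm_add_le (c - Q 0) (l • (x t0 - c))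
      simp only [e]
      linarith)
    (fun s hs l hl he => by
      rcases hl.2.lt_or_eq with h1 | h1
      · have h2 : ‖y s - c‖ = l * dd ε c x := by
          rw [he, add_sub_cancel_left, norm_smul, Real.norm_eq_abs, abs_of_nonneg hl.1, h0]
        have h3 := dd_le (c := c) (x := y) hs
        nlinarith
      · subst h1
        simp only [one_smul, add_sub_cancel] at he
        exact hxy t0 s ht0 hs he.symm)
  -- second move
  have hl0 : ∀ l ∈ Icc (0 : ℝ) 1, |(1 - l) * t0| < κ := fun l hl => by
    rw [abs_mul, abs_of_nonneg (by linarith [hl.2])]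
    refine lt_of_le_of_lt ?_ ht0κ
    exact mul_le_of_le_one_left (abs_nonneg _) (by linarith [hl.1])
  have hxcont := hx.1
  have m2 := g.move hy (ζ := fun l => x ((1 - l) * t0)) (by fun_prop)
    (fun l hl => by
      have h1 := (hl0 l hl).le
      have h2 := g.near _ h1
      have h3 := hx.2 _ (h1.trans g.κle)
      have h4 := norm_add_le (x ((1 - l) * t0) - Q ((1 - l) * t0)) (Q ((1 - l) * t0) - Q 0)
      rw [sub_add_sub_cancel] at h4
      linarith)
    (fun s hs l hl => (hxy _ s ((hl0 l hl).le.trans g.κle) hs).symm)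
  have m3 := g.avar_c hy
  simp only [zero_smul, add_zero, one_smul, add_sub_cancel, sub_zero, one_mul, sub_self,
    zero_mul] at m1 m2
  unfold sig
  rw [abs_le] at *
  constructor <;> linarith

theorem Geo.corner (g : Geo Q ε κ R η c) {x y : ℝ → ℂ} (hx : IsArc Q ε η x)
    (hy : IsArc Q ε η y) {t s : ℝ} (ht : |t| ≤ ε) (hs : |s| ≤ ε) (h : 200 * η ≤ ‖Q t - Q s‖) :
    ‖(x t - y s) - (Q t - Q s)‖ ≤ 1 / 100 * ‖Q t - Q s‖ := by
  have h1 := hx.2 t ht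
  have h2 := hy.2 s hs
  have e : (x t - y s) - (Q t - Q s) = (x t - Q t) - (y s - Q s) := by ring
  rw [e]
  have := norm_sub_le (x t - Q t) (y s - Q s)
  linarith

theorem Geo.sig_add (g : Geo Q ε κ R η c) {x y : ℝ → ℂ} (hx : IsArc Q ε η x)
    (hy : IsArc Q ε η y) (hxy : Disj ε x y) :
    |sig ε x y + sig ε y x - 2 * cG Q ε| ≤ 1 / 5 := by
  have hε := g.εpos
  have hη := g.ηpos
  have hQ := g.cont
  have hxc := hx.1
  have hyc := hy.1
  have hab : ∀ {t}, t ∈ Icc (0 : ℝ) ε → |t| ≤ ε := fun {t} ht => abs_le.2 ⟨by linarith [ht.1], ht.2⟩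
  have hab' : ∀ {t}, t ∈ Icc (-ε) 0 → |t| ≤ ε := fun {t} ht => abs_le.2 ⟨ht.1, by linarith [ht.2]⟩
  have he : |ε| ≤ ε := (abs_of_pos hε).le
  have he' : |-ε| ≤ ε := by rw [abs_neg]; exact he
  have hne : ∀ t s, |t| ≤ ε → |s| ≤ ε → x t - y s ≠ 0 := fun t s ht hs => sub_ne_zero.2 (hxy t s ht hs)
  have habs0 : |(0 : ℝ)| ≤ ε := by simpa using hε.le
  have r1 := avar_rect (f := fun t s => x t - y s) (a := -ε) (b := 0) (c := 0) (d := ε)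
    (by linarith) hε.le (by fun_prop) (fun t ht s hs => hne t s (hab' ht) (hab hs))
  have r2 := avar_rect (f := fun t s => x t - y s) (a := 0) (b := ε) (c := -ε) (d := 0)
    hε.le (by linarith) (by fun_prop) (fun t ht s hs => hne t s (hab ht) (hab' hs))
  have s1 : sig ε y x = avar (fun t => x t - y 0) (-ε) 0 + avar (fun t => x t - y 0) 0 ε :=
    avar_add (by linarith) hε.le ⟨by fun_prop, fun t ht => hne t 0 (abs_le.2 ht) habs0⟩
  have s2 : sig ε x y = avar (fun s => x 0 - y s) (-ε) 0 + avar (fun s => x 0 - y s) 0 ε := by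
    have h1 : NZ (fun s => x 0 - y s) (-ε) ε := ⟨by fun_prop, fun t ht => hne 0 t habs0 (abs_le.2 ht)⟩
    rw [← avar_add (by linarith) hε.le h1, ← avar_neg (by linarith) h1]
    simp only [neg_sub]
    rfl
  have n1 : NZ (fun s => Q (-ε) - Q s) 0 ε :=
    ⟨by fun_prop, fun s hs => norm_pos_iff.1 (by linarith [g.corner1 s hs])⟩
  have n2 : NZ (fun t => Q t - Q ε) (-ε) 0 :=
    ⟨by fun_prop, fun s hs => norm_pos_iff.1 (by linarith [g.corner2 s hs])⟩
  have c1 := avar_close (f := fun s => x (-ε) - y s) (θ := 1 / 100) hε.le (by norm_num) (by fun_prop) n1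
    (fun s hs => g.corner hx hy he' (hab hs) (g.corner1 s hs))
  have c2 := avar_close (f := fun t => x t - y ε) (θ := 1 / 100) (by linarith) (by norm_num) (by fun_prop) n2
    (fun s hs => g.corner hx hy (hab' hs) he (g.corner2 s hs))
  have n3 : NZ (fun t => Q t - Q (-ε)) 0 ε := by
    refine ⟨by fun_prop, fun s hs => ?_⟩
    exact sub_ne_zero.2 (sub_ne_zero.1 (n1.2 s hs)).symm
  have n4 : NZ (fun s => Q ε - Q s) (-ε) 0 := by
    refine ⟨by fun_prop, fun s hs => ?_⟩
    exact sub_ne_zero.2 (sub_ne_zero.1 (n2.2 s hs)).symm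
  have c3 := avar_close (f := fun t => x t - y (-ε)) (θ := 1 / 100) hε.le (by norm_num) (by fun_prop) n3
    (fun s hs => g.corner hx hy (hab hs) he' (by rw [norm_sub_rev]; exact g.corner1 s hs))
  have c4 := avar_close (f := fun s => x ε - y s) (θ := 1 / 100) (by linarith) (by norm_num) (by fun_prop) n4
    (fun s hs => g.corner hx hy he (hab' hs) (by rw [norm_sub_rev]; exact g.corner2 s hs))
  have e3 := avar_neg hε.le n1
  have e4 := avar_neg (by linarith) n2
  simp only [neg_sub] at e3 e4
  unfold cG
  rw [s1, s2]
  rw [abs_le] at *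
  constructor <;> linarith

theorem Geo.sig_far (g : Geo Q ε κ R η c) {x y : ℝ → ℂ} (hx : IsArc Q ε η x)
    (hy : IsArc Q ε η y) (hxy : Disj ε x y) (hd : dd ε c y ≤ dd ε c x) :
    |sig ε x y - (cC Q ε c + cD Q ε c)| ≤ 7 / 10 := by
  have h1 := g.sig_near hy hx (fun t s ht hs => (hxy s t hs ht).symm) hd
  have h2 := g.sig_add hx hy hxy
  unfold cD
  rw [abs_le] at *
  constructor <;> linarith

theorem Geo.cD_large (g : Geo Q ε κ R η c) : Real.pi ≤ |cD Q ε c| := by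
  have hε := g.εpos
  have hη := g.ηpos
  have hQ := g.cont
  have hR := g.Rpos
  have hab0 : (0 : ℝ) ∈ Icc 0 ε := ⟨le_rfl, hε.le⟩
  have n1 : NZ (fun s => Q (-ε) - Q s) 0 ε :=
    ⟨by fun_prop, fun s hs => norm_pos_iff.1 (by linarith [g.corner1 s hs])⟩
  have n2 : NZ (fun t => Q t - Q ε) (-ε) 0 :=
    ⟨by fun_prop, fun s hs => norm_pos_iff.1 (by linarith [g.corner2 s hs])⟩
  obtain ⟨r1, hr1, e1⟩ := exp_avar hε.le n1
  obtain ⟨r2, hr2, e2⟩ := exp_avar (by linarith) n2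
  obtain ⟨r3, hr3, e3⟩ := exp_avar (by linarith) g.NZc
  have hA : Q (-ε) - Q ε ≠ 0 := n1.2 ε ⟨hε.le, le_rfl⟩
  have hB : Q (-ε) - Q 0 ≠ 0 := n1.2 0 hab0
  have hC : Q 0 - Q ε ≠ 0 := n2.2 0 ⟨by linarith, le_rfl⟩
  have hD : Q (-ε) - c ≠ 0 := g.NZc.2 (-ε) ⟨le_rfl, by linarith⟩
  have hE : Q ε - c ≠ 0 := g.NZc.2 ε ⟨by linarith, le_rfl⟩
  by_contra hlt
  push Not at hlt
  have hlt2 : |cC Q ε c - cG Q ε| < Real.pi / 2 := by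
    unfold cD at hlt
    rw [abs_lt] at *
    constructor <;> linarith
  -- the quotient
  have key : ((Q ε - c) / (Q ε - Q 0)) / ((Q (-ε) - c) / (Q (-ε) - Q 0)) =
      ((-(r3 / (r1 * r2)) : ℝ) : ℂ) * Complex.exp (((cC Q ε c - cG Q ε : ℝ) : ℂ) * Complex.I) := by
    have h1 : Complex.exp (((cC Q ε c - cG Q ε : ℝ) : ℂ) * Complex.I)
      = Complex.exp ((avar (fun s => Q s - c) (-ε) ε) * Complex.I) /
        (Complex.exp ((avar (fun s => Q (-ε) - Q s) 0 ε) * Complex.I) *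
          Complex.exp ((avar (fun t => Q t - Q ε) (-ε) 0) * Complex.I)) := by
      rw [← Complex.exp_add, ← Complex.exp_sub]
      congr 1
      unfold cC cG
      push_cast
      ring
    have hr1' : (r1 : ℂ) ≠ 0 := by exact_mod_cast hr1.ne'
    have hr2' : (r2 : ℂ) ≠ 0 := by exact_mod_cast hr2.ne'
    have hr3' : (r3 : ℂ) ≠ 0 := by exact_mod_cast hr3.ne'
    have f1 : Complex.exp ((avar (fun s => Q (-ε) - Q s) 0 ε) * Complex.I)
      = (Q (-ε) - Q ε) / (Q (-ε) - Q 0) / r1 := by rw [e1]; field_simp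
    have f2 : Complex.exp ((avar (fun t => Q t - Q ε) (-ε) 0) * Complex.I)
      = (Q 0 - Q ε) / (Q (-ε) - Q ε) / r2 := by rw [e2]; field_simp
    have f3 : Complex.exp ((avar (fun s => Q s - c) (-ε) ε) * Complex.I)
      = (Q ε - c) / (Q (-ε) - c) / r3 := by rw [e3]; field_simp
    rw [h1, f1, f2, f3]
    have hC' : Q ε - Q 0 ≠ 0 := by rw [← neg_sub]; exact neg_ne_zero.2 hC
    push_cast
    have : Q ε - Q 0 = -(Q 0 - Q ε) := by ring
    rw [this]
    field_simp
  have hre : (((Q ε - c) / (Q ε - Q 0)) / ((Q (-ε) - c) / (Q (-ε) - Q 0))).re < 0 := by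
    rw [key, Complex.re_ofReal_mul, Complex.exp_ofReal_mul_I_re]
    have h1 : 0 < Real.cos (cC Q ε c - cG Q ε) :=
      Real.cos_pos_of_mem_Ioo ⟨by linarith [(abs_lt.1 hlt2).1], by linarith [(abs_lt.1 hlt2).2]⟩
    have h2 : 0 < r3 / (r1 * r2) := by positivity
    nlinarith
  have hC' : Q ε - Q 0 ≠ 0 := by rw [← neg_sub]; exact neg_ne_zero.2 hC
  have b1 : ‖(Q ε - c) - (Q ε - Q 0)‖ ≤ 1 / 10 * ‖Q ε - Q 0‖ := by
    have : (Q ε - c) - (Q ε - Q 0) = -(c - Q 0) := by ring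
    rw [this, norm_neg]
    linarith [g.cnear, g.farR]
  have b2 : ‖(Q (-ε) - c) - (Q (-ε) - Q 0)‖ ≤ 1 / 10 * ‖Q (-ε) - Q 0‖ := by
    have : (Q (-ε) - c) - (Q (-ε) - Q 0) = -(c - Q 0) := by ring
    rw [this, norm_neg]
    linarith [g.cnear, g.farL]
  have d1 : ‖(Q ε - c) / (Q ε - Q 0) - 1‖ ≤ 1 / 10 := by
    have : (Q ε - c) / (Q ε - Q 0) - 1 = ((Q ε - c) - (Q ε - Q 0)) / (Q ε - Q 0) := by
      field_simp
    rw [this, norm_div, div_le_iff₀ (norm_pos_iff.2 hC')]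
    exact b1
  have d2 : ‖(Q (-ε) - c) / (Q (-ε) - Q 0) - 1‖ ≤ 1 / 10 := by
    have : (Q (-ε) - c) / (Q (-ε) - Q 0) - 1 = ((Q (-ε) - c) - (Q (-ε) - Q 0)) / (Q (-ε) - Q 0) := by
      field_simp
    rw [this, norm_div, div_le_iff₀ (norm_pos_iff.2 hB)]
    exact b2
  generalize (Q ε - c) / (Q ε - Q 0) = z at *
  generalize (Q (-ε) - c) / (Q (-ε) - Q 0) = w at *
  rw [Complex.div_re] at hre
  have z1 := abs_le.1 ((Complex.abs_re_le_norm (z - 1)).trans d1)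
  have z2 := abs_le.1 ((Complex.abs_im_le_norm (z - 1)).trans d1)
  have w1 := abs_le.1 ((Complex.abs_re_le_norm (w - 1)).trans d2)
  have w2 := abs_le.1 ((Complex.abs_im_le_norm (w - 1)).trans d2)
  simp at z1 z2 w1 w2
  have hw : 0 < Complex.normSq w := by
    rw [Complex.normSq_pos]
    rintro rfl
    simp at w1
    linarith [w1.1]
  rw [← add_div, div_neg_iff] at hre
  rcases hre with h | h
  · linarith [h.2]
  · nlinarith [h.1, z1.1, z1.2, z2.1, z2.2, w1.1, w1.2, w2.1, w2.2]

/-- disjoint arcs have different distances to `c`. -/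
theorem Geo.dd_ne (g : Geo Q ε κ R η c) {x y : ℝ → ℂ} (hx : IsArc Q ε η x)
    (hy : IsArc Q ε η y) (hxy : Disj ε x y) : dd ε c x ≠ dd ε c y := by
  intro h
  have h1 := g.sig_near hx hy hxy h.le
  have h2 := g.sig_far hx hy hxy h.ge
  have h3 := g.cD_large
  have := Real.pi_gt_three
  rw [abs_le] at h1 h2
  rcases abs_cases (cD Q ε c) with h | h <;> linarith

end PBAux

open Set Filter Topology MeasureTheory Bornology

namespace PBAux

theorem arc_no_interior {Q : ℝ → ℂ} {a b : ℝ} (hQ : Continuous Q) (hinj : InjOn Q (Icc a b))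
    (z : ℂ) {r : ℝ} (hr : 0 < r) : ∃ c, ‖c - z‖ < r ∧ ∀ t ∈ Icc a b, Q t ≠ c := by
  by_contra hcon
  push Not at hcon
  let q : Icc a b → ℂ := fun t => Q t
  have hq : Continuous q := hQ.comp continuous_subtype_val
  have hqi : Function.Injective q := fun s t h => Subtype.ext (hinj s.2 t.2 h)
  have hemb := (hq.isClosedEmbedding hqi).isEmbedding
  have hex : ∀ θ : ℝ, ∃ t : Icc a b, q t = z + (r / 2 : ℝ) * Complex.exp (θ * Complex.I) := by
    intro θ
    obtain ⟨t, ht, h⟩ := hcon (z + (r / 2 : ℝ) * Complex.exp (θ * Complex.I)) (by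
      rw [add_sub_cancel_left, norm_mul, Complex.norm_exp_ofReal_mul_I, Complex.norm_real,
        Real.norm_eq_abs, abs_of_pos (by linarith)]
      linarith)
    exact ⟨⟨t, ht⟩, h⟩
  choose g hg using hex
  have hgc : Continuous g := by
    rw [hemb.continuous_iff]
    have : q ∘ g = fun θ : ℝ => z + (r / 2 : ℝ) * Complex.exp (θ * Complex.I) := funext hg
    rw [this]
    fun_prop
  have h2 : g (2 * Real.pi) = g 0 := by
    apply hqi
    rw [hg, hg]
    push_cast
    rw [Complex.exp_two_pi_mul_I]
    simp
  let d : ℝ → ℝ := fun θ => (g θ : ℝ) - g (θ + Real.pi)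
  have hd : Continuous d := by fun_prop
  have hdπ : d Real.pi = - d 0 := by
    simp only [d]
    rw [← two_mul, h2]
    simp
  have h0 : ∃ θ, d θ = 0 := by
    have := Real.pi_pos
    rcases le_total (d 0) 0 with h | h
    · obtain ⟨θ, _, h⟩ := intermediate_value_Icc (a := 0) (b := Real.pi) this.le hd.continuousOn
        (show (0:ℝ) ∈ Icc (d 0) (d Real.pi) from ⟨h, by linarith⟩)
      exact ⟨θ, h⟩
    · obtain ⟨θ, _, h⟩ := intermediate_value_Icc' (a := 0) (b := Real.pi) this.le hd.continuousOn
        (show (0:ℝ) ∈ Icc (d Real.pi) (d 0) from ⟨by linarith, h⟩)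
      exact ⟨θ, h⟩
  obtain ⟨θ, hθ⟩ := h0
  have he : g θ = g (θ + Real.pi) := Subtype.ext (sub_eq_zero.1 hθ)
  have := hg θ
  rw [he, hg] at this
  push_cast at this
  rw [add_mul, Complex.exp_add, Complex.exp_pi_mul_I] at this
  have h3 : ((r / 2 : ℝ) : ℂ) ≠ 0 := by exact_mod_cast (by linarith : r / 2 ≠ 0)
  have h4 := Complex.exp_ne_zero (θ * Complex.I)
  have h5 := mul_ne_zero h3 h4
  push_cast at h5
  apply h5
  linear_combination (-1/2 : ℂ) * this

theorem exists_geo {Q : ℝ → ℂ} {ε R : ℝ} (hQ : Continuous Q) (hε : 0 < ε)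
    (hinj : InjOn Q (Icc (-ε) ε)) (hR : 0 < R) (hR1 : R ≤ ‖Q ε - Q 0‖)
    (hR2 : R ≤ ‖Q (-ε) - Q 0‖) : ∃ κ c η, Geo Q ε κ R η c := by
  have hne : ∀ {s t}, s ∈ Icc (-ε) ε → t ∈ Icc (-ε) ε → s ≠ t → 0 < ‖Q s - Q t‖ :=
    fun hs ht h => norm_pos_iff.2 (sub_ne_zero.2 fun h' => h (hinj hs ht h'))
  have h0 : (0 : ℝ) ∈ Icc (-ε) ε := ⟨by linarith, hε.le⟩
  have h1 : ε ∈ Icc (-ε) ε := ⟨by linarith, le_rfl⟩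
  have h2 : -ε ∈ Icc (-ε) ε := ⟨le_rfl, by linarith⟩
  obtain ⟨κ, hκ, hκε, hnear⟩ : ∃ κ, 0 < κ ∧ κ ≤ ε ∧ ∀ t, |t| ≤ κ → ‖Q t - Q 0‖ ≤ R / 200 := by
    obtain ⟨d, hd, h⟩ := Metric.continuous_iff.1 hQ 0 (R / 200) (by linarith)
    refine ⟨min ε (d / 2), by positivity, min_le_left _ _, fun t ht => ?_⟩
    have := h t (by
      rw [Real.dist_eq, sub_zero]
      have := ht.trans (min_le_right _ _)
      linarith)
    rw [dist_eq_norm] at this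
    exact this.le
  have hcomp : IsCompact (Icc (-ε) ε ∩ {t : ℝ | κ ≤ |t|}) :=
    isCompact_Icc.inter_right (isClosed_le continuous_const continuous_abs)
  obtain ⟨m, hm, hm'⟩ := hcomp.exists_forall_le' (f := fun t => ‖Q t - Q 0‖) (by fun_prop) (a := 0)
    (fun t ht => hne ht.1 h0 (by
      rintro rfl
      have := ht.2
      simp at this
      linarith))
  obtain ⟨c, hc, hcQ⟩ := arc_no_interior hQ hinj (Q 0) (r := min (m / 3) (R / 200)) (by positivity)
  have hc1 := hc.trans_le (min_le_left _ _)
  have hc2 := hc.trans_le (min_le_right _ _)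
  obtain ⟨e1, he1, he1'⟩ := isCompact_Icc.exists_forall_le' (s := Icc (-ε) ε)
    (f := fun t => ‖Q t - c‖) (by fun_prop) (a := 0)
    (fun t ht => norm_pos_iff.2 (sub_ne_zero.2 (hcQ t ht)))
  obtain ⟨e2, he2, he2'⟩ := isCompact_Icc.exists_forall_le' (s := Icc 0 ε)
    (f := fun t => ‖Q (-ε) - Q t‖) (by fun_prop) (a := 0)
    (fun t ht => hne h2 ⟨by linarith [ht.1], ht.2⟩ (by linarith [ht.1]))
  obtain ⟨e3, he3, he3'⟩ := isCompact_Icc.exists_forall_le' (s := Icc (-ε) 0)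
    (f := fun t => ‖Q t - Q ε‖) (by fun_prop) (a := 0)
    (fun t ht => hne ⟨ht.1, by linarith [ht.2]⟩ h1 (by linarith [ht.2]))
  have i1 := min_le_left e1 (min e2 e3)
  have i2 := (min_le_right e1 (min e2 e3)).trans (min_le_left _ _)
  have i3 := (min_le_right e1 (min e2 e3)).trans (min_le_right _ _)
  refine ⟨κ, c, min e1 (min e2 e3) / 200, hQ, hκ, hκε, by positivity, hR1, hR2, hnear, ?_, ?_, hc2.le, ?_, ?_⟩
  · intro t ht ht'
    have := hm' t ⟨abs_le.1 ht', ht⟩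
    linarith
  · intro t ht
    have := he1' t (abs_le.1 ht)
    linarith
  · intro t ht
    have := he2' t ht
    linarith
  · intro t ht
    have := he3' t ht
    linarith

end PBAux

open Set Filter Topology MeasureTheory Bornology

namespace PBAux

variable {Q : ℝ → ℂ} {ε κ R η : ℝ} {c : ℂ}

/-- `2π` times the winding number of the curve `W|[a,b]` closed up by a segment, seen from `z`. -/
noncomputable def wnd (W : ℝ → ℂ) (a b : ℝ) (z : ℂ) : ℝ :=
  avar (fun t => W t - z) a b - ((W b - z) / (W a - z)).arg

structure Cross (Q : ℝ → ℂ) (ε κ R η : ℝ) (c : ℂ) (V W : ℝ → ℂ) (a b ρ S : ℝ) : Prop where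
  g : Geo Q ε κ R η c
  hV : Continuous V
  hW : Continuous W
  hab : a ≤ b
  arcA : IsArc Q ε η (fun t => W (a + t))
  arcB : IsArc Q ε η (fun t => W (b + t))
  ρη : ρ ≤ η
  nearA : ‖W a - Q 0‖ < ρ
  nearB : ‖W b - Q 0‖ < ρ
  pass : ∀ s ≤ S, ‖V s - Q 0‖ ≤ ρ → IsArc Q ε η (fun t => V (s + t))
  disj : ∀ s ≤ S + ε, ∀ t ∈ Icc (a - ε) (b + ε), V s ≠ W t

theorem slit_of_far {A B p z : ℂ} {ρ : ℝ} (hA : ‖A - p‖ < ρ) (hB : ‖B - p‖ < ρ)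
    (hz : ρ ≤ ‖z - p‖) : (B - z) / (A - z) ∈ Complex.slitPlane := by
  have hAz : A - z ≠ 0 := by
    intro h
    rw [← sub_eq_zero.1 h] at hz
    linarith
  by_contra hcon
  rw [Complex.mem_slitPlane_iff] at hcon
  push Not at hcon
  obtain ⟨h1, h2⟩ := hcon
  have h3 : (B - z) / (A - z) = (((B - z) / (A - z)).re : ℂ) := by
    apply Complex.ext <;> simp [h2]
  set l := ((B - z) / (A - z)).re
  rw [div_eq_iff hAz] at h3
  have h4 : ((1 - l : ℝ) : ℂ) * (z - p) = (B - p) + ((-l : ℝ) : ℂ) * (A - p) := by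
    push_cast
    linear_combination -h3
  have h5 := congrArg norm h4
  rw [norm_mul, Complex.norm_real, Real.norm_eq_abs, abs_of_pos (by linarith)] at h5
  have h6 := norm_add_le (B - p) (((-l : ℝ) : ℂ) * (A - p))
  rw [norm_mul, Complex.norm_real, Real.norm_eq_abs, abs_of_nonneg (a := -l) (by linarith)] at h6
  nlinarith

theorem int_zero_of_small {x : ℝ} (h : ∃ n : ℤ, x = n * (2 * Real.pi)) (hx : |x| < 6) : x = 0 := by
  obtain ⟨n, rfl⟩ := h
  have hpi := Real.pi_gt_three
  have : n = 0 := by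
    by_contra hn
    have h1 : (1 : ℝ) ≤ |(n : ℝ)| := by exact_mod_cast Int.one_le_abs hn
    rw [abs_mul, abs_of_pos (by linarith : 0 < 2 * Real.pi)] at hx
    nlinarith
  simp [this]

namespace Cross
variable {V W : ℝ → ℂ} {a b ρ S : ℝ}

theorem ρpos (h : Cross Q ε κ R η c V W a b ρ S) : 0 < ρ := (norm_nonneg _).trans_lt h.nearA

theorem memab (h : Cross Q ε κ R η c V W a b ρ S) {t : ℝ} (ht : t ∈ Icc a b) :
    t ∈ Icc (a - ε) (b + ε) := by
  have := h.g.εpos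
  exact ⟨by linarith [ht.1], by linarith [ht.2]⟩

theorem ne (h : Cross Q ε κ R η c V W a b ρ S) {s t : ℝ} (hs : s ≤ S + ε) (ht : t ∈ Icc a b) :
    W t - V s ≠ 0 := sub_ne_zero.2 (h.disj s hs t (h.memab ht)).symm

theorem wnd_int (h : Cross Q ε κ R η c V W a b ρ S) {z : ℂ} (hz : ∀ t ∈ Icc a b, W t ≠ z) :
    ∃ n : ℤ, wnd W a b z = n * (2 * Real.pi) := by
  have hW := h.hW
  exact avar_mod (f := fun t => W t - z) h.hab ⟨by fun_prop, fun t ht => sub_ne_zero.2 (hz t ht)⟩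

theorem wnd_diff_int (h : Cross Q ε κ R η c V W a b ρ S) {z z' : ℂ} (hz : ∀ t ∈ Icc a b, W t ≠ z)
    (hz' : ∀ t ∈ Icc a b, W t ≠ z') :
    ∃ n : ℤ, wnd W a b z - wnd W a b z' = n * (2 * Real.pi) := by
  obtain ⟨n, hn⟩ := h.wnd_int hz
  obtain ⟨m, hm⟩ := h.wnd_int hz'
  exact ⟨n - m, by rw [hn, hm]; push_cast; ring⟩

theorem F_diff (h : Cross Q ε κ R η c V W a b ρ S) {s s' : ℝ} (hs : s ≤ s') (hs' : s' ≤ S + ε) :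
    avar (fun t => W t - V s') a b - avar (fun t => W t - V s) a b =
      avar (fun τ => W b - V τ) s s' - avar (fun τ => W a - V τ) s s' := by
  have hV := h.hV
  have hW := h.hW
  have := avar_rect (f := fun t τ => W t - V τ) h.hab hs (by fun_prop)
    (fun t ht τ hτ => h.ne (hτ.2.trans hs') ht)
  linarith

theorem const (h : Cross Q ε κ R η c V W a b ρ S) {s s' : ℝ} (hs : s ≤ s') (hs' : s' ≤ S + ε)
    (hfar : ∀ τ ∈ Icc s s', ρ ≤ ‖V τ - Q 0‖) : wnd W a b (V s) = wnd W a b (V s') := by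
  have hV := h.hV
  have h1 := h.F_diff hs hs'
  have na : NZ (fun τ => W a - V τ) s s' := ⟨by fun_prop, fun τ hτ => h.ne (hτ.2.trans hs') (left_mem_Icc.2 h.hab)⟩
  have nb : NZ (fun τ => W b - V τ) s s' := ⟨by fun_prop, fun τ hτ => h.ne (hτ.2.trans hs') (right_mem_Icc.2 h.hab)⟩
  rw [← avar_div hs nb na, avar_slit (f := fun τ => (W b - V τ) / (W a - V τ)) hs (nb.1.div na.1 na.2)
    (fun τ hτ => slit_of_far h.nearA h.nearB (hfar τ hτ))] at h1
  unfold wnd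
  linarith

theorem arg_far (h : Cross Q ε κ R η c V W a b ρ S) {z : ℂ} (hz : R / 2 ≤ ‖z - Q 0‖) :
    |((W b - z) / (W a - z)).arg| ≤ 1 / 100 := by
  have h1 := h.nearA
  have h2 := h.nearB
  have h3 := h.ρη
  have h4 := h.g.η_le
  have h5 := h.g.Rpos
  have h6 : ‖z - Q 0‖ ≤ ‖W a - Q 0‖ + ‖W a - z‖ := by
    have := norm_sub_le (W a - Q 0) (W a - z)
    rwa [sub_sub_sub_cancel_left] at this
  have h7 : ‖(W b - z) - (W a - z)‖ ≤ ‖W b - Q 0‖ + ‖W a - Q 0‖ := by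
    have := norm_sub_le (W b - Q 0) (W a - Q 0)
    rwa [sub_sub_sub_cancel_right, ← sub_sub_sub_cancel_right _ _ z] at this
  have := (abs_arg_le_of_close (z := W b - z) (w := W a - z) (θ := 1 / 200) (by norm_num)
    (norm_pos_iff.1 (by linarith)) (by linarith)).2
  linarith

/-- times in the window of a pass which are at least `κ` away from the pass are not near. -/
theorem window_far (h : Cross Q ε κ R η c V W a b ρ S) {s t : ℝ} (hs : s ≤ S)
    (hn : ‖V s - Q 0‖ ≤ ρ) (h1 : κ ≤ |t - s|) (h2 : |t - s| ≤ ε) : ρ ≤ ‖V t - Q 0‖ := by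
  have h3 := (h.pass s hs hn).2 (t - s) h2
  simp only [add_sub_cancel] at h3
  have h4 := h.g.sep _ h1 h2
  have h5 := h.g.η_le_K
  have h6 := h.ρη
  have h7 := h.g.ηpos
  have h8 : ‖Q (t - s) - Q 0‖ ≤ ‖V t - Q 0‖ + ‖V t - Q (t - s)‖ := by
    have := norm_sub_le (V t - Q 0) (V t - Q (t - s))
    rwa [sub_sub_sub_cancel_left] at this
  linarith

theorem window_near (h : Cross Q ε κ R η c V W a b ρ S) {s t : ℝ} (hs : s ≤ S)
    (hn : ‖V s - Q 0‖ ≤ ρ) (h1 : |t - s| ≤ κ) : ‖V t - Q 0‖ < R / 2 := by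
  have h3 := (h.pass s hs hn).2 (t - s) (h1.trans h.g.κle)
  simp only [add_sub_cancel] at h3
  have h4 := h.g.near _ h1
  have h5 := h.g.η_le
  have h7 := h.g.ηpos
  have := norm_add_le (V t - Q (t - s)) (Q (t - s) - Q 0)
  rw [sub_add_sub_cancel] at this
  linarith

theorem window_end (h : Cross Q ε κ R η c V W a b ρ S) {s : ℝ} (hs : s ≤ S)
    (hn : ‖V s - Q 0‖ ≤ ρ) : R / 2 ≤ ‖V (s - ε) - Q 0‖ ∧ R / 2 ≤ ‖V (s + ε) - Q 0‖ := by
  have hε := h.g.εpos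
  have h0 := h.pass s hs hn
  have h1 := h0.2 ε (abs_of_pos hε).le
  have h2 := h0.2 (-ε) (by rw [abs_neg]; exact (abs_of_pos hε).le)
  simp only [← sub_eq_add_neg] at h1 h2
  have h5 := h.g.η_le
  have h7 := h.g.ηpos
  have h8 := h.g.farL
  have h9 := h.g.farR
  have e1 := norm_sub_le (V (s - ε) - Q 0) (V (s - ε) - Q (-ε))
  have e2 := norm_sub_le (V (s + ε) - Q 0) (V (s + ε) - Q ε)
  rw [sub_sub_sub_cancel_left] at e1 e2
  constructor <;> linarith

theorem disjArc (h : Cross Q ε κ R η c V W a b ρ S) {s : ℝ} (hs : s ≤ S) {d : ℝ} (hd : d ∈ Icc a b) :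
    Disj ε (fun t => W (d + t)) (fun t => V (s + t)) := by
  intro t τ ht hτ
  have ht := abs_le.1 ht
  have hτ := abs_le.1 hτ
  exact (h.disj _ (by linarith [hτ.2]) _ ⟨by linarith [ht.1, hd.1], by linarith [ht.2, hd.2]⟩).symm

theorem jump_approx (h : Cross Q ε κ R η c V W a b ρ S) {s : ℝ} (hs : s ≤ S)
    (hn : ‖V s - Q 0‖ ≤ ρ) :
    |(wnd W a b (V (s + ε)) - wnd W a b (V (s - ε))) -
      (sig ε (fun t => W (b + t)) (fun t => V (s + t)) -
        sig ε (fun t => W (a + t)) (fun t => V (s + t)))| ≤ 1 / 50 := by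
  have hV := h.hV
  have hε := h.g.εpos
  have h1 := h.F_diff (s := s - ε) (s' := s + ε) (by linarith) (by linarith)
  obtain ⟨e1, e2⟩ := h.window_end hs hn
  have a1 := h.arg_far e1
  have a2 := h.arg_far e2
  have key : ∀ d ∈ Icc a b, avar (fun τ => W d - V τ) (s - ε) (s + ε) =
      sig ε (fun t => W (d + t)) (fun t => V (s + t)) := by
    intro d hd
    have n1 : NZ (fun τ => W d - V τ) (s + -ε) (s + ε) :=
      ⟨by fun_prop, fun τ hτ => h.ne (hτ.2.trans (by linarith)) hd⟩
    rw [sub_eq_add_neg s ε, ← avar_shift (by linarith) s n1, ← avar_neg (by linarith)]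
    · simp [sig]
    · refine ⟨by fun_prop, fun τ hτ => h.ne (s := s + τ) (by linarith [hτ.2]) hd⟩
  rw [key b (right_mem_Icc.2 h.hab), key a (left_mem_Icc.2 h.hab)] at h1
  unfold wnd
  rw [abs_le] at *
  constructor <;> linarith

theorem jump_int (h : Cross Q ε κ R η c V W a b ρ S) {s s' : ℝ} (hs : s ≤ S + ε) (hs' : s' ≤ S + ε) :
    ∃ n : ℤ, wnd W a b (V s) - wnd W a b (V s') = n * (2 * Real.pi) :=
  h.wnd_diff_int (fun t ht => (h.disj s hs t (h.memab ht)).symm)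
    (fun t ht => (h.disj s' hs' t (h.memab ht)).symm)

/-- jumps are of one sign -/
theorem jump_sign (h : Cross Q ε κ R η c V W a b ρ S) :
    ∃ ς : ℝ, ς ≠ 0 ∧ ∀ s ≤ S, ‖V s - Q 0‖ ≤ ρ →
      0 ≤ ς * (wnd W a b (V (s + ε)) - wnd W a b (V (s - ε))) ∧
      (dd ε c (fun t => V (s + t)) ∈ uIcc (dd ε c (fun t => W (a + t))) (dd ε c (fun t => W (b + t))) →
        0 < ς * (wnd W a b (V (s + ε)) - wnd W a b (V (s - ε)))) := by
  have hε := h.g.εpos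
  have hD := h.g.cD_large
  have hpi := Real.pi_gt_three
  have hsgn : ∀ x, |x - cD Q ε c| ≤ 3 / 2 → 0 < cD Q ε c * x := by
    intro x hx
    rw [abs_le] at hx
    rcases abs_cases (cD Q ε c) with h | h
    · have : 0 < x := by linarith
      exact mul_pos (by linarith) this
    · have : x < 0 := by linarith
      exact mul_pos_of_neg_of_neg (by linarith) this
  have hD0 : cD Q ε c ≠ 0 := by
    intro h0
    rw [h0, abs_zero] at hD
    linarith
  rcases le_total (dd ε c (fun t => W (a + t))) (dd ε c (fun t => W (b + t))) with hle | hle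
  · refine ⟨cD Q ε c, hD0, fun s hs hn => ?_⟩
    have j := h.jump_approx hs hn
    have ji := h.jump_int (s := s + ε) (s' := s - ε) (by linarith) (by linarith)
    have dA := h.disjArc hs (left_mem_Icc.2 h.hab)
    have dB := h.disjArc hs (right_mem_Icc.2 h.hab)
    have hp := h.pass s hs hn
    set y : ℝ → ℂ := fun t => V (s + t)
    set xa : ℝ → ℂ := fun t => W (a + t)
    set xb : ℝ → ℂ := fun t => W (b + t)
    set J := wnd W a b (V (s + ε)) - wnd W a b (V (s - ε))
    rw [uIcc_of_le hle]
    have mid : dd ε c xa ≤ dd ε c y → dd ε c y ≤ dd ε c xb → 0 < cD Q ε c * J := by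
      intro h1 h2
      have b1 := h.g.sig_near h.arcA hp dA h1
      have b2 := h.g.sig_far h.arcB hp dB h2
      apply hsgn
      rw [abs_le] at *
      constructor <;> linarith
    refine ⟨?_, fun hm => mid hm.1 hm.2⟩
    by_cases h1 : dd ε c xa ≤ dd ε c y
    · by_cases h2 : dd ε c y ≤ dd ε c xb
      · exact (mid h1 h2).le
      · push Not at h2
        have b1 := h.g.sig_near h.arcA hp dA h1
        have b2 := h.g.sig_near h.arcB hp dB h2.le
        rw [int_zero_of_small ji (by rw [abs_lt]; rw [abs_le] at *; constructor <;> linarith), mul_zero]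
    · push Not at h1
      have b1 := h.g.sig_far h.arcA hp dA h1.le
      have b2 := h.g.sig_far h.arcB hp dB (h1.le.trans hle)
      rw [int_zero_of_small ji (by rw [abs_lt]; rw [abs_le] at *; constructor <;> linarith), mul_zero]
  · refine ⟨-cD Q ε c, neg_ne_zero.2 hD0, fun s hs hn => ?_⟩
    have j := h.jump_approx hs hn
    have ji := h.jump_int (s := s + ε) (s' := s - ε) (by linarith) (by linarith)
    have dA := h.disjArc hs (left_mem_Icc.2 h.hab)
    have dB := h.disjArc hs (right_mem_Icc.2 h.hab)
    have hp := h.pass s hs hn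
    set y : ℝ → ℂ := fun t => V (s + t)
    set xa : ℝ → ℂ := fun t => W (a + t)
    set xb : ℝ → ℂ := fun t => W (b + t)
    set J := wnd W a b (V (s + ε)) - wnd W a b (V (s - ε))
    rw [uIcc_of_ge hle]
    have mid : dd ε c xb ≤ dd ε c y → dd ε c y ≤ dd ε c xa → 0 < - cD Q ε c * J := by
      intro h1 h2
      have b1 := h.g.sig_near h.arcB hp dB h1
      have b2 := h.g.sig_far h.arcA hp dA h2
      have := hsgn (-J) (by
        rw [abs_le] at *
        constructor <;> linarith)
      linarith
    refine ⟨?_, fun hm => mid hm.1 hm.2⟩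
    by_cases h1 : dd ε c xb ≤ dd ε c y
    · by_cases h2 : dd ε c y ≤ dd ε c xa
      · exact (mid h1 h2).le
      · push Not at h2
        have b1 := h.g.sig_near h.arcB hp dB h1
        have b2 := h.g.sig_near h.arcA hp dA h2.le
        rw [int_zero_of_small ji (by rw [abs_lt]; rw [abs_le] at *; constructor <;> linarith), mul_zero]
    · push Not at h1
      have b1 := h.g.sig_far h.arcB hp dB h1.le
      have b2 := h.g.sig_far h.arcA hp dA (h1.le.trans hle)
      rw [int_zero_of_small ji (by rw [abs_lt]; rw [abs_le] at *; constructor <;> linarith), mul_zero]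

theorem mono (h : Cross Q ε κ R η c V W a b ρ S) {ς : ℝ}
    (hς : ∀ s ≤ S, ‖V s - Q 0‖ ≤ ρ →
      0 ≤ ς * (wnd W a b (V (s + ε)) - wnd W a b (V (s - ε)))) (n : ℕ) :
    ∀ s s', s ≤ s' → s' ≤ S → s' - s ≤ n * ε → R / 2 ≤ ‖V s - Q 0‖ → R / 2 ≤ ‖V s' - Q 0‖ →
      0 ≤ ς * (wnd W a b (V s') - wnd W a b (V s)) := by
  have hε := h.g.εpos
  have hV := h.hV
  induction n with
  | zero =>
    intro s s' h1 _ h2 _ _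
    have : s = s' := by
      simp at h2
      linarith
    simp [this]
  | succ n ih =>
    intro s s' h1 h2 h3 f1 f2
    push_cast at h3
    by_cases hex : ∃ τ ∈ Icc s s', ‖V τ - Q 0‖ ≤ ρ
    · have hcomp : IsCompact (Icc s s' ∩ {τ | ‖V τ - Q 0‖ ≤ ρ}) :=
        isCompact_Icc.inter_right (isClosed_le (by fun_prop) continuous_const)
      obtain ⟨s1, ⟨hs1, hn⟩, hleast⟩ := hcomp.exists_isLeast (by
        obtain ⟨τ, h, h'⟩ := hex
        exact ⟨τ, h, h'⟩)
      simp only [mem_ofPred_eq] at hn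
      have hs1S := hs1.2.trans h2
      have hfirst : ∀ τ, s ≤ τ → τ < s1 → ρ ≤ ‖V τ - Q 0‖ := by
        intro τ h1 h2
        by_contra hcon
        push Not at hcon
        have := hleast ⟨⟨h1, h2.le.trans hs1.2⟩, hcon.le⟩
        linarith
      have k1 : κ < s1 - s := by
        by_contra hcon
        push Not at hcon
        have := h.window_near hs1S hn (t := s) (by rw [abs_sub_comm, abs_of_nonneg (by linarith [hs1.1])]; exact hcon)
        linarith
      have k2 : κ < s' - s1 := by
        by_contra hcon
        push Not at hcon
        have := h.window_near hs1S hn (t := s') (by rw [abs_of_nonneg (by linarith [hs1.2])]; exact hcon)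
        linarith
      obtain ⟨w1, w2⟩ := h.window_end hs1S hn
      have hκ := h.g.κpos
      have e1 : wnd W a b (V s) = wnd W a b (V (s1 - ε)) := by
        rcases le_total s (s1 - ε) with hc | hc
        · exact h.const hc (by linarith) (fun τ hτ => hfirst τ hτ.1 (by linarith [hτ.2]))
        · refine (h.const hc (by linarith) (fun τ hτ => ?_)).symm
          have : |τ - s1| = s1 - τ := by rw [abs_sub_comm, abs_of_nonneg (by linarith [hτ.2])]
          exact h.window_far hs1S hn (by rw [this]; linarith [hτ.2]) (by rw [this]; linarith [hτ.1])
      have j := hς s1 hs1S hn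
      rcases le_total (s1 + ε) s' with hc | hc
      · have := ih (s1 + ε) s' hc h2 (by linarith) w2 f2
        rw [e1]
        nlinarith
      · have e2 : wnd W a b (V s') = wnd W a b (V (s1 + ε)) := by
          refine h.const hc (by linarith) (fun τ hτ => ?_)
          have : |τ - s1| = τ - s1 := by rw [abs_of_nonneg (by linarith [hτ.1])]
          exact h.window_far hs1S hn (by rw [this]; linarith [hτ.1]) (by rw [this]; linarith [hτ.2])
        rw [e1, e2]
        exact j
    · push Not at hex
      rw [h.const h1 (by linarith) (fun τ hτ => (hex τ hτ).le)]
      simp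

theorem wnd_cont (h : Cross Q ε κ R η c V W a b ρ S) {y : ℂ} (hy : R / 2 < ‖y - Q 0‖)
    (hyW : ∀ t ∈ Icc a b, W t ≠ y) :
    ∃ e > 0, ∀ s ≤ S + ε, ‖V s - y‖ < e → R / 2 ≤ ‖V s - Q 0‖ ∧ wnd W a b (V s) = wnd W a b y := by
  have hW := h.hW
  obtain ⟨m, hm, hm'⟩ := isCompact_Icc.exists_forall_le' (s := Icc a b)
    (f := fun t => ‖W t - y‖) (by fun_prop) (a := 0)
    (fun t ht => norm_pos_iff.2 (sub_ne_zero.2 (hyW t ht)))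
  refine ⟨min (m / 4) (‖y - Q 0‖ - R / 2), lt_min (by linarith) (by linarith), fun s hs hd => ?_⟩
  have hd1 := hd.trans_le (min_le_left _ _)
  have hd2 := hd.trans_le (min_le_right _ _)
  have far : R / 2 ≤ ‖V s - Q 0‖ := by
    have := norm_sub_le (V s - Q 0) (V s - y)
    rw [sub_sub_sub_cancel_left] at this
    linarith
  refine ⟨far, ?_⟩
  have h1 := h.wnd_diff_int (fun t ht => (h.disj s hs t (h.memab ht)).symm) hyW
  have h2 := h.arg_far far
  have h3 := h.arg_far hy.le
  have h4 := avar_close (f := fun t => W t - V s) (g := fun t => W t - y) (θ := 1 / 4) h.hab (by norm_num)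
    (by fun_prop) ⟨by fun_prop, fun t ht => sub_ne_zero.2 (hyW t ht)⟩ (fun t ht => by
      have := hm' t ht
      rw [sub_sub_sub_cancel_left, norm_sub_rev]
      linarith)
  refine sub_eq_zero.1 (int_zero_of_small h1 ?_)
  unfold wnd
  rw [abs_lt]
  rw [abs_le] at *
  constructor <;> linarith

/-- Eventually constant. -/
theorem M0 (h : Cross Q ε κ R η c V W a b ρ S) {y : ℂ} (hy : R / 2 < ‖y - Q 0‖)
    (hyW : ∀ t ∈ Icc a b, W t ≠ y) (hlim : ∀ s0 : ℝ, ∀ e > 0, ∃ s ≤ s0, ‖V s - y‖ < e) :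
    ∃ S0 ≤ S, ∀ s ≤ S0, R / 2 ≤ ‖V s - Q 0‖ → wnd W a b (V s) = wnd W a b y := by
  have hε := h.g.εpos
  obtain ⟨ς, hς0, hς⟩ := h.jump_sign
  have hm : ∀ s s', s ≤ s' → s' ≤ S → R / 2 ≤ ‖V s - Q 0‖ → R / 2 ≤ ‖V s' - Q 0‖ →
      0 ≤ ς * (wnd W a b (V s') - wnd W a b (V s)) := by
    intro s s' h1 h2 h3 h4
    obtain ⟨n, hn⟩ := exists_nat_ge ((s' - s) / ε)
    exact h.mono (fun s hs hn => (hς s hs hn).1) n s s' h1 h2 ((div_le_iff₀ hε).1 hn) h3 h4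
  obtain ⟨e, he, hc⟩ := h.wnd_cont hy hyW
  obtain ⟨S0, hS0, hd0⟩ := hlim S e he
  refine ⟨S0, hS0, fun s hs hf => ?_⟩
  obtain ⟨s1, hs1, hd1⟩ := hlim s e he
  obtain ⟨f0, e0⟩ := hc S0 (by linarith) hd0
  obtain ⟨f1, e1⟩ := hc s1 (by linarith) hd1
  have m1 := hm s1 s hs1 (hs.trans hS0) f1 hf
  have m2 := hm s S0 hs hS0 hf f0
  rw [e1] at m1
  rw [e0] at m2
  have : ς * (wnd W a b (V s) - wnd W a b y) = 0 := by nlinarith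
  rcases mul_eq_zero.1 this with h | h
  · exact absurd h hς0
  · linarith

theorem M1 (h : Cross Q ε κ R η c V W a b ρ S) {y y' : ℂ} (hy : R / 2 < ‖y - Q 0‖)
    (hyW : ∀ t ∈ Icc a b, W t ≠ y) (hlim : ∀ s0 : ℝ, ∀ e > 0, ∃ s ≤ s0, ‖V s - y‖ < e)
    (hy' : R / 2 < ‖y' - Q 0‖)
    (hyW' : ∀ t ∈ Icc a b, W t ≠ y') (hlim' : ∀ s0 : ℝ, ∀ e > 0, ∃ s ≤ s0, ‖V s - y'‖ < e) :
    wnd W a b y = wnd W a b y' := by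
  have hε := h.g.εpos
  obtain ⟨S0, hS0, h0⟩ := h.M0 hy hyW hlim
  obtain ⟨e, he, hc⟩ := h.wnd_cont hy' hyW'
  obtain ⟨s, hs, hd⟩ := hlim' S0 e he
  obtain ⟨f, e1⟩ := hc s (by linarith) hd
  rw [← e1, h0 s hs f]

theorem M2 (h : Cross Q ε κ R η c V W a b ρ S) {y : ℂ} (hy : R / 2 < ‖y - Q 0‖)
    (hyW : ∀ t ∈ Icc a b, W t ≠ y) (hlim : ∀ s0 : ℝ, ∀ e > 0, ∃ s ≤ s0, ‖V s - y‖ < e) :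
    ∃ S0 ≤ S, ∀ s ≤ S0, ‖V s - Q 0‖ ≤ ρ →
      dd ε c (fun t => V (s + t)) ∉ uIcc (dd ε c (fun t => W (a + t))) (dd ε c (fun t => W (b + t))) := by
  have hε := h.g.εpos
  obtain ⟨S0, hS0, h0⟩ := h.M0 hy hyW hlim
  obtain ⟨ς, hς0, hς⟩ := h.jump_sign
  refine ⟨S0 - ε, by linarith, fun s hs hn hd => ?_⟩
  have j := (hς s (by linarith) hn).2 hd
  obtain ⟨w1, w2⟩ := h.window_end (s := s) (by linarith) hn
  rw [h0 _ (by linarith) w1, h0 _ (by linarith) w2] at j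
  simp at j

end Cross
end PBAux

open Set Filter Topology MeasureTheory Bornology

namespace PBAux

theorem planar_step1 {Q U V : ℝ → ℂ} {ε κ R η ρ0 S0 : ℝ} {c : ℂ} (g : Geo Q ε κ R η c)
    (hU : Continuous U) (hV : Continuous V) (hUinj : Function.Injective U) (hρ0 : 0 < ρ0)
    (hUp : ∀ t, ‖U t - Q 0‖ ≤ ρ0 → ∀ τ, |τ| ≤ ε → ‖U (t + τ) - Q τ‖ ≤ η)
    (hVp : ∀ s ≤ S0, ‖V s - Q 0‖ ≤ ρ0 → ∀ τ, |τ| ≤ ε → ‖V (s + τ) - Q τ‖ ≤ η)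
    (hrec : ∀ T : ℝ, ∀ e > 0, ∃ t, T ≤ |t| ∧ ‖U t - Q 0‖ < e)
    (hVrec : ∀ T : ℝ, ∀ e > 0, ∀ t s0 : ℝ, ∃ s ≤ s0, ∀ τ, |τ| ≤ T → ‖V (s + τ) - U (t + τ)‖ < e)
    (hVU : ∀ s t, V s = U t → ∀ h, V (s + h) = U (t + h)) : False := by
  have hε := g.εpos
  have hη := g.ηpos
  have hηR := g.η_le
  have hdis : ∀ T1 T2 : ℝ, ∃ s0 : ℝ, ∀ s ≤ s0, ∀ t ∈ Icc T1 T2, V s ≠ U t := by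
    intro T1 T2
    by_contra hcon
    push Not at hcon
    obtain ⟨s, _, t, ht, h1⟩ := hcon 0
    obtain ⟨s', hs', t', ht', h2⟩ := hcon (s - (T2 - T1) - 1)
    have e1 := hVU s t h1 (-s)
    have e2 := hVU s' t' h2 (-s')
    rw [add_neg_cancel] at e1 e2
    have := hUinj (e1.symm.trans e2)
    linarith [ht.1, ht.2, ht'.1, ht'.2]
  set ρ := min ρ0 η with hρ
  have hρpos : 0 < ρ := lt_min hρ0 hη
  have arcU : ∀ t, ‖U t - Q 0‖ < ρ → IsArc Q ε η (fun τ => U (t + τ)) := fun t ht =>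
    ⟨by fun_prop, hUp t (ht.le.trans (min_le_left _ _))⟩
  obtain ⟨t1, -, n1⟩ := hrec 0 ρ hρpos
  obtain ⟨t2, g2, n2⟩ := hrec (|t1| + 2 * ε + 1) ρ hρpos
  obtain ⟨t3, g3, n3⟩ := hrec (|t2| + 2 * ε + 1) ρ hρpos
  obtain ⟨t4, g4, n4⟩ := hrec (|t3| + 2 * ε + 1) ρ hρpos
  have hDisj : ∀ a b, |a| + 2 * ε + 1 ≤ |b| → Disj ε (fun τ => U (a + τ)) (fun τ => U (b + τ)) := by
    intro a b hab t s ht hs h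
    have h1 := hUinj h
    have h2 : b = a + t - s := by linarith
    have h3 : |b| ≤ |a| + |t| + |s| := by
      rw [h2]
      exact (abs_sub _ _).trans (by linarith [abs_add_le a t])
    linarith
  set d : ℝ → ℝ := fun a => dd ε c (fun τ => U (a + τ)) with hd
  have d12 : d t1 ≠ d t2 := g.dd_ne (arcU _ n1) (arcU _ n2) (hDisj _ _ g2)
  have d23 : d t2 ≠ d t3 := g.dd_ne (arcU _ n2) (arcU _ n3) (hDisj _ _ g3)
  have d13 : d t1 ≠ d t3 := g.dd_ne (arcU _ n1) (arcU _ n3) (hDisj _ _ (by linarith))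
  set y := U (t4 + ε) with hy
  have yfar : R / 2 < ‖y - Q 0‖ := by
    have h1 := (arcU _ n4).2 ε (abs_of_pos hε).le
    have h2 := g.farR
    have := norm_sub_le (y - Q 0) (y - Q ε)
    rw [sub_sub_sub_cancel_left] at this
    linarith
  have ylim : ∀ s0 : ℝ, ∀ e > 0, ∃ s ≤ s0, ‖V s - y‖ < e := by
    intro s0 e he
    obtain ⟨s, hs, h⟩ := hVrec 0 e he (t4 + ε) s0
    exact ⟨s, hs, by simpa using h 0 (by simp)⟩
  have pair0 : ∀ a b, a ≤ b → |a| ≤ |t3| → |b| ≤ |t3| → ‖U a - Q 0‖ < ρ → ‖U b - Q 0‖ < ρ →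
      ∃ S1 : ℝ, ∀ s ≤ S1, ‖V s - Q 0‖ ≤ ρ → dd ε c (fun t => V (s + t)) ∉ uIcc (d a) (d b) := by
    intro a b hab ha hb na nb
    obtain ⟨s0, hs0⟩ := hdis (a - ε) (b + ε)
    have cr : Cross Q ε κ R η c V U a b ρ (min S0 (s0 - ε)) :=
      { g := g, hV := hV, hW := hU, hab := hab, arcA := arcU a na, arcB := arcU b nb,
        ρη := min_le_right _ _, nearA := na, nearB := nb,
        pass := fun s hs hn => ⟨by fun_prop, hVp s (hs.trans (min_le_left _ _)) (hn.trans (min_le_left _ _))⟩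
        disj := fun s hs t ht => hs0 s (by linarith [min_le_right S0 (s0 - ε)]) t ht }
    obtain ⟨S1, _, h⟩ := cr.M2 yfar (fun t ht h => by
      have := hUinj h
      have h2 : |t| ≤ |t3| := by
        rw [abs_le] at *
        exact ⟨by linarith [ht.1], by linarith [ht.2]⟩
      have h3 : |t4| ≤ |t| + ε := by
        have e : t4 = t - ε := by linarith
        rw [e]
        have := abs_sub t ε
        rwa [abs_of_pos hε] at this
      linarith) ylim
    exact ⟨S1, h⟩
  have pair : ∀ a b, |a| ≤ |t3| → |b| ≤ |t3| → ‖U a - Q 0‖ < ρ → ‖U b - Q 0‖ < ρ →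
      ∃ S1 : ℝ, ∀ s ≤ S1, ‖V s - Q 0‖ ≤ ρ → dd ε c (fun t => V (s + t)) ∉ uIcc (d a) (d b) := by
    intro a b ha hb na nb
    rcases le_total a b with h | h
    · exact pair0 a b h ha hb na nb
    · rw [uIcc_comm]
      exact pair0 b a h hb ha nb na
  have core : ∀ a b e, |a| ≤ |t3| → |b| ≤ |t3| → |e| ≤ |t3| → ‖U a - Q 0‖ < ρ → ‖U b - Q 0‖ < ρ →
      ‖U e - Q 0‖ < ρ → d a < d b → d b < d e → False := by
    intro a b e ha hb he na nb ne h1 h2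
    obtain ⟨S1, k1⟩ := pair a b ha hb na nb
    obtain ⟨S2, k2⟩ := pair b e hb he nb ne
    obtain ⟨s, hs, hclose⟩ := hVrec ε (min (ρ - ‖U b - Q 0‖) (min (d b - d a) (d e - d b)))
      (lt_min (by linarith) (lt_min (by linarith) (by linarith))) b (min S1 S2)
    have hn : ‖V s - Q 0‖ ≤ ρ := by
      have h3 := (hclose 0 (by simpa using hε.le)).trans_le (min_le_left _ _)
      simp only [add_zero] at h3
      have := norm_add_le (V s - U b) (U b - Q 0)
      rw [sub_add_sub_cancel] at this
      linarith
    have k1 := k1 s (hs.trans (min_le_left _ _)) hn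
    have k2 := k2 s (hs.trans (min_le_right _ _)) hn
    have h3 := dd_close (c := c) (x := fun t => V (s + t)) (y := fun t => U (b + t)) hε.le
      (by fun_prop) (by fun_prop) (fun t ht => (hclose t ht).le)
    have m1 := (min_le_right (ρ - ‖U b - Q 0‖) (min (d b - d a) (d e - d b))).trans (min_le_left _ _)
    have m2 := (min_le_right (ρ - ‖U b - Q 0‖) (min (d b - d a) (d e - d b))).trans (min_le_right _ _)
    rw [uIcc_of_le h1.le] at k1
    rw [uIcc_of_le h2.le] at k2
    rw [abs_le] at h3
    change _ ≤ _ - d b ∧ _ - d b ≤ _ at h3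
    rcases le_total (dd ε c (fun t => V (s + t))) (d b) with h | h
    · exact k1 ⟨by linarith, h⟩
    · exact k2 ⟨h, by linarith⟩
  have a1 : |t1| ≤ |t3| := by linarith
  have a2 : |t2| ≤ |t3| := by linarith
  have a3 : |t3| ≤ |t3| := le_rfl
  rcases lt_or_gt_of_ne d12 with h | h <;> rcases lt_or_gt_of_ne d23 with h' | h' <;>
    rcases lt_or_gt_of_ne d13 with h'' | h''
  · exact core _ _ _ a1 a2 a3 n1 n2 n3 h h'
  · exact core _ _ _ a1 a2 a3 n1 n2 n3 h h'
  · exact core _ _ _ a1 a3 a2 n1 n3 n2 h'' h'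
  · exact core _ _ _ a3 a1 a2 n3 n1 n2 h'' h
  · exact core _ _ _ a2 a1 a3 n2 n1 n3 h h''
  · exact core _ _ _ a2 a3 a1 n2 n3 n1 h' h''
  · exact core _ _ _ a3 a2 a1 n3 n2 n1 h' h
  · exact core _ _ _ a3 a2 a1 n3 n2 n1 h' h

theorem planar_step2 {Q V : ℝ → ℂ} {T : ℝ} {y : ℂ} (hT : 0 < T) (hQ : Continuous Q) (hV : Continuous V)
    (hper : ∀ t, Q (t + T) = Q t) (hmin : ∀ s t, Q s = Q t → ∃ n : ℤ, s - t = n * T)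
    (hVinj : Function.Injective V) (hVQ : ∀ s t, V s ≠ Q t)
    (hrec : ∀ T0 : ℝ, ∀ e > 0, ∀ t s0 : ℝ, ∃ s ≤ s0, ∀ τ, |τ| ≤ T0 → ‖V (s + τ) - Q (t + τ)‖ < e)
    (hpass : ∀ t0 T0 : ℝ, ∀ η > 0, ∃ ρ > 0, ∃ S : ℝ, ∀ s ≤ S, ‖V s - Q t0‖ ≤ ρ →
      ∀ τ, |τ| ≤ T0 → ‖V (s + τ) - Q (t0 + τ)‖ ≤ η)
    (hy : ∀ t, y ≠ Q t) (hylim : ∀ s0 : ℝ, ∀ e > 0, ∃ s ≤ s0, ‖V s - y‖ < e) : False := by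
  -- injectivity on short intervals
  have hinj : ∀ s t, |s - t| < T → Q s = Q t → s = t := by
    intro s t hst h
    obtain ⟨n, hn⟩ := hmin s t h
    have : n = 0 := by
      by_contra h0
      have h1 : (1 : ℝ) ≤ |(n : ℝ)| := by exact_mod_cast Int.one_le_abs h0
      rw [hn, abs_mul, abs_of_pos hT] at hst
      nlinarith
    simp [this] at hn
    linarith
  have hper' : ∀ t, Q (t - T) = Q t := fun t => by
    rw [← hper (t - T), sub_add_cancel]
  -- R
  obtain ⟨R1, hR1, hR1'⟩ := isCompact_Icc.exists_forall_le' (s := Icc (T / 4) (3 * T / 4))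
    (f := fun t => ‖Q t - Q 0‖) (by fun_prop) (a := 0)
    (fun t ht => norm_pos_iff.2 (sub_ne_zero.2 fun h => by
      have := hinj t 0 (by rw [abs_of_nonneg (by linarith [ht.1])]; linarith [ht.2]) h
      linarith [ht.1]))
  obtain ⟨R2, hR2, hR2'⟩ := isCompact_Icc.exists_forall_le' (s := Icc (T / 4) (3 * T / 4))
    (f := fun t => ‖Q (T / 2 + t) - Q (T / 2)‖) (by fun_prop) (a := 0)
    (fun t ht => norm_pos_iff.2 (sub_ne_zero.2 fun h => by
      have := hinj (T / 2 + t) (T / 2) (by rw [abs_of_nonneg (by linarith [ht.1])]; linarith [ht.2]) h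
      linarith [ht.1]))
  obtain ⟨m, hm, hm'⟩ := isCompact_Icc.exists_forall_le' (s := Icc (-T) T)
    (f := fun t => ‖Q t - y‖) (by fun_prop) (a := 0)
    (fun t ht => norm_pos_iff.2 (sub_ne_zero.2 (hy t).symm))
  obtain ⟨R, hR, hRR1, hRR2, hRm⟩ : ∃ R, 0 < R ∧ R ≤ R1 ∧ R ≤ R2 ∧ R ≤ m :=
    ⟨min R1 (min R2 m), by positivity, min_le_left _ _, (min_le_right _ _).trans (min_le_left _ _),
      (min_le_right _ _).trans (min_le_right _ _)⟩
  have out : ∀ t, T / 4 ≤ |t| → |t| ≤ 3 * T / 4 → R ≤ ‖Q t - Q 0‖ := by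
    intro t h1 h2
    rcases le_total 0 t with h | h
    · rw [abs_of_nonneg h] at h1 h2
      exact hRR1.trans (hR1' t ⟨h1, h2⟩)
    · rw [abs_of_nonpos h] at h1 h2
      rw [← hper t]
      exact hRR1.trans (hR1' (t + T) ⟨by linarith, by linarith⟩)
  have h4 : (0 : ℝ) < T / 4 := by linarith
  have abs4 : |T / 4| = T / 4 := abs_of_pos h4
  obtain ⟨κ, c, η, g⟩ := exists_geo (Q := Q) (ε := T / 4) (R := R) hQ h4
    (fun s hs t ht h => hinj s t (by
      rw [abs_lt]
      constructor <;> linarith [hs.1, hs.2, ht.1, ht.2]) h) hR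
    (out _ (by rw [abs4]) (by rw [abs4]; linarith))
    (out _ (by rw [abs_neg, abs4]) (by rw [abs_neg, abs4]; linarith))
  obtain ⟨κ', c', η', g'⟩ := exists_geo (Q := fun t => Q (T / 2 + t)) (ε := T / 4) (R := R) (by fun_prop) h4
    (fun s hs t ht h => by
      have := hinj (T / 2 + s) (T / 2 + t) (by
        rw [abs_lt]
        constructor <;> linarith [hs.1, hs.2, ht.1, ht.2]) h
      linarith) hR
    (by
      simp only [add_zero]
      exact hRR2.trans (hR2' (T / 4) ⟨le_rfl, by linarith⟩))
    (by
      simp only [add_zero]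
      have := hR2' (3 * T / 4) ⟨by linarith, le_rfl⟩
      rw [← hper' (T / 2 + 3 * T / 4), show T / 2 + 3 * T / 4 - T = T / 2 + -(T / 4) by ring] at this
      exact hRR2.trans this)
  have hη := g.ηpos
  have hη' := g'.ηpos
  obtain ⟨ρ0, hρ0, S0, hp⟩ := hpass (T / 2) (T / 4) η' hη'
  -- y is hit at most once
  obtain ⟨S1, hS1⟩ : ∃ S1 : ℝ, ∀ s ≤ S1, V s ≠ y := by
    by_cases h : ∃ s, V s = y
    · obtain ⟨s, hs⟩ := h
      exact ⟨s - 1, fun s' hs' h' => by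
        have := hVinj (h'.trans hs.symm)
        linarith⟩
    · push Not at h
      exact ⟨0, fun s _ => h s⟩
  obtain ⟨e, he, he1, he2, he3, he4⟩ : ∃ e, 0 < e ∧ e ≤ η ∧ e ≤ η' ∧ e ≤ ρ0 ∧ e ≤ R / 200 :=
    ⟨min η (min η' (min ρ0 (R / 200))), by positivity, min_le_left _ _,
      (min_le_right _ _).trans (min_le_left _ _),
      (min_le_right _ _).trans ((min_le_right _ _).trans (min_le_left _ _)),
      (min_le_right _ _).trans ((min_le_right _ _).trans (min_le_right _ _))⟩
  obtain ⟨s, hs, hclose⟩ := hrec (3 * T / 4) e he 0 (S1 - T)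
  simp only [zero_add] at hclose
  set x : ℝ → ℂ := fun t => V (s + t) with hx
  have hxc : Continuous x := by fun_prop
  have arcx : IsArc Q (T / 4) η x := ⟨hxc, fun t ht => (hclose t (by linarith)).le.trans he1⟩
  -- crossing data at the antipodal point
  have cr : Cross (fun t => Q (T / 2 + t)) (T / 4) κ' R η' c' V V (s - T / 2) (s + T / 2) (min ρ0 η')
      (min S0 (s - 2 * T)) :=
    { g := g', hV := hV, hW := hV, hab := by linarith
      arcA := ⟨by fun_prop, fun t ht => by
        have ht' := abs_le.1 ht
        have := hclose (-(T / 2) + t) (abs_le.2 ⟨by linarith, by linarith⟩)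
        rw [← hper (-(T / 2) + t), show -(T / 2) + t + T = T / 2 + t by ring,
          show s + (-(T / 2) + t) = s - T / 2 + t by ring] at this
        exact this.le.trans he2⟩
      arcB := ⟨by fun_prop, fun t ht => by
        have ht' := abs_le.1 ht
        have := hclose ((T / 2) + t) (abs_le.2 ⟨by linarith, by linarith⟩)
        rw [← add_assoc] at this
        exact this.le.trans he2⟩
      ρη := min_le_right _ _
      nearA := by
        have := hclose (-(T / 2)) (abs_le.2 ⟨by linarith, by linarith⟩)
        rw [← hper (-(T / 2)), show -(T / 2) + T = T / 2 by ring, ← sub_eq_add_neg] at this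
        simp only [add_zero]
        exact this.trans_le (le_min he3 he2)
      nearB := by
        have := hclose (T / 2) (abs_le.2 ⟨by linarith, by linarith⟩)
        simp only [add_zero]
        exact this.trans_le (le_min he3 he2)
      pass := fun s' hs' hn => ⟨by fun_prop, hp s' (hs'.trans (min_le_left _ _)) (by
        simp only [add_zero] at hn
        exact hn.trans (min_le_left _ _))⟩
      disj := fun s' hs' t ht h => by
        have := hVinj h
        have := min_le_right S0 (s - 2 * T)
        linarith [ht.1] }
  have far1 : R / 2 < ‖Q 0 - (fun t => Q (T / 2 + t)) 0‖ := by
    simp only [add_zero]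
    rw [norm_sub_rev]
    have := out (T / 2) (by rw [abs_of_pos (by linarith)]; linarith) (by rw [abs_of_pos (by linarith)]; linarith)
    linarith
  have far2 : R / 2 < ‖y - (fun t => Q (T / 2 + t)) 0‖ := by
    simp only [add_zero]
    rw [norm_sub_rev]
    have := hm' (T / 2) ⟨by linarith, by linarith⟩
    linarith
  have hVy : ∀ t ∈ Icc (s - T / 2) (s + T / 2), V t ≠ y := fun t ht => hS1 t (by linarith [ht.2])
  have key := cr.M1 far1 (fun t ht => hVQ t 0)
    (fun s0 e he => by
      obtain ⟨s, hs, h⟩ := hrec 0 e he 0 s0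
      exact ⟨s, hs, by simpa using h 0 (by simp)⟩) far2 hVy hylim
  have A1 := cr.arg_far far1.le
  have A2 := cr.arg_far far2.le
  unfold wnd at key
  have nxy : NZ (fun t => V t - y) (s + -(T / 2)) (s + T / 2) :=
    ⟨by fun_prop, fun t ht => sub_ne_zero.2 (hVy t ⟨by linarith [ht.1], by linarith [ht.2]⟩)⟩
  have nxp : NZ (fun t => V t - Q 0) (s + -(T / 2)) (s + T / 2) :=
    ⟨by fun_prop, fun t ht => sub_ne_zero.2 (hVQ t 0)⟩
  have nx : NZ (fun t => x t - Q 0) (-(T / 2)) (T / 2) :=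
    ⟨by fun_prop, fun t ht => sub_ne_zero.2 (hVQ _ 0)⟩
  have nQ : NZ (fun t => Q t - x 0) (-(T / 2)) (T / 2) :=
    ⟨by fun_prop, fun t ht => sub_ne_zero.2 (hVQ _ _).symm⟩
  have E1 : avar (fun t => V t - Q 0) (s - T / 2) (s + T / 2) = avar (fun t => x t - Q 0) (-(T / 2)) (T / 2) := by
    rw [sub_eq_add_neg s, ← avar_shift (by linarith) s nxp]
  have E2 : avar (fun t => V t - y) (s - T / 2) (s + T / 2) = avar (fun t => x t - y) (-(T / 2)) (T / 2) := by
    rw [sub_eq_add_neg s, ← avar_shift (by linarith) s nxy]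
  rw [E1, E2] at key
  -- splitting
  have split : ∀ f : ℝ → ℂ, NZ f (-(T / 2)) (T / 2) → avar f (-(T / 2)) (T / 2) =
      avar f (-(T / 2)) (-(T / 4)) + avar f (-(T / 4)) (T / 4) + avar f (T / 4) (T / 2) := by
    intro f hf
    rw [avar_add (b := T / 4) (by linarith) (by linarith) hf,
      avar_add (b := -(T / 4)) (by linarith) (by linarith) (hf.mono le_rfl (by linarith))]
  have sp1 := split _ nx
  have sp2 := split _ nQ
  -- outer pieces
  have oL : ∀ t ∈ Icc (-(T / 2)) (-(T / 4)), R ≤ ‖Q t - Q 0‖ := fun t ht => by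
    have : |t| = -t := abs_of_nonpos (by linarith [ht.2])
    exact out t (by rw [this]; linarith [ht.2]) (by rw [this]; linarith [ht.1])
  have oR : ∀ t ∈ Icc (T / 4) (T / 2), R ≤ ‖Q t - Q 0‖ := fun t ht => by
    have : |t| = t := abs_of_nonneg (by linarith [ht.1])
    exact out t (by rw [this]; linarith [ht.1]) (by rw [this]; linarith [ht.2])
  have cl : ∀ t ∈ Icc (-(T / 2)) (T / 2), ‖x t - Q t‖ < e := fun t ht =>
    hclose t (abs_le.2 ⟨by linarith [ht.1], by linarith [ht.2]⟩)
  have cl0 : ‖x 0 - Q 0‖ < e := cl 0 ⟨by linarith, by linarith⟩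
  have outer : ∀ a b, -(T / 2) ≤ a → a ≤ b → b ≤ T / 2 → (∀ t ∈ Icc a b, R ≤ ‖Q t - Q 0‖) →
      |avar (fun t => x t - Q 0) a b - avar (fun t => Q t - Q 0) a b| ≤ 1 / 50 ∧
      |avar (fun t => Q t - x 0) a b - avar (fun t => Q t - Q 0) a b| ≤ 1 / 50 := by
    intro a b ha hab hb ho
    have n0 : NZ (fun t => Q t - Q 0) a b := ⟨by fun_prop, fun t ht => norm_pos_iff.1 (hR.trans_le (ho t ht))⟩
    constructor
    · have := avar_close (f := fun t => x t - Q 0) (θ := 1 / 200) hab (by norm_num) (by fun_prop) n0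
        (fun t ht => by
          rw [sub_sub_sub_cancel_right]
          have := cl t ⟨ha.trans ht.1, ht.2.trans hb⟩
          have := ho t ht
          linarith)
      linarith
    · have := avar_close (f := fun t => Q t - x 0) (θ := 1 / 200) hab (by norm_num) (by fun_prop) n0
        (fun t ht => by
          rw [sub_sub_sub_cancel_left, norm_sub_rev]
          have := ho t ht
          linarith)
      linarith
  obtain ⟨u1, u2⟩ := outer (-(T / 2)) (-(T / 4)) le_rfl (by linarith) (by linarith) oL
  obtain ⟨u3, u4⟩ := outer (T / 4) (T / 2) (by linarith) (by linarith) le_rfl oR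
  -- comparison at y
  have nQy : NZ (fun t => Q t - y) (-(T / 2)) (T / 2) :=
    ⟨by fun_prop, fun t ht => sub_ne_zero.2 (hy t).symm⟩
  have my : ∀ t ∈ Icc (-(T / 2)) (T / 2), m ≤ ‖Q t - y‖ := fun t ht =>
    hm' t ⟨by linarith [ht.1], by linarith [ht.2]⟩
  have C1 := avar_close (f := fun t => x t - y) (θ := 1 / 200) (by linarith) (by norm_num) (by fun_prop) nQy
    (fun t ht => by
      rw [sub_sub_sub_cancel_right]
      have := cl t ht
      have := my t ht
      linarith)
  obtain ⟨s', hs', hd'⟩ := hylim s (m / 200) (by linarith)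
  have C2 := avar_close (f := fun t => Q t - V s') (θ := 1 / 200) (by linarith) (by norm_num) (by fun_prop) nQy
    (fun t ht => by
      rw [sub_sub_sub_cancel_left, norm_sub_rev]
      have := my t ht
      linarith)
  have C3 := avar_rect (f := fun t τ => Q t - V τ) (a := -(T / 2)) (b := T / 2) (by linarith) hs'
    (by fun_prop) (fun t _ τ _ => sub_ne_zero.2 (hVQ _ _).symm)
  have hQT : Q (T / 2) = Q (-(T / 2)) := by
    rw [← hper (-(T / 2))]
    congr 1
    ring
  rw [hQT] at C3
  have C4 : avar (fun t => Q t - V s) (-(T / 2)) (T / 2) = avar (fun t => Q t - x 0) (-(T / 2)) (T / 2) := by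
    simp [x]
  have D1 : Disj (T / 4) x Q := fun t s _ _ => hVQ _ _
  have D2 : Disj (T / 4) Q x := fun t s _ _ => (hVQ _ _).symm
  have s1 : avar (fun t => x t - Q 0) (-(T / 4)) (T / 4) = sig (T / 4) Q x := rfl
  have s2 : avar (fun t => Q t - x 0) (-(T / 4)) (T / 4) = sig (T / 4) x Q := rfl
  rw [s1] at sp1
  rw [s2] at sp2
  have hcl : |sig (T / 4) Q x - sig (T / 4) x Q| ≤ 1 / 2 := by
    rw [abs_le] at *
    constructor <;> linarith
  have hD := g.cD_large
  have hpi := Real.pi_gt_three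
  rcases le_total (dd (T / 4) c x) (dd (T / 4) c Q) with h | h
  · have b1 := g.sig_near arcx g.selfArc D1 h
    have b2 := g.sig_far g.selfArc arcx D2 h
    rw [abs_le] at hcl b1 b2
    rcases abs_cases (cD Q (T / 4) c) with h | h <;> linarith
  · have b1 := g.sig_near g.selfArc arcx D2 h
    have b2 := g.sig_far arcx g.selfArc D1 h
    rw [abs_le] at hcl b1 b2
    rcases abs_cases (cD Q (T / 4) c) with h | h <;> linarith

end PBAux

open Set Filter Topology MeasureTheory Bornology

namespace PBAux

variable {E : Type*} [NormedAddCommGroup E] [NormedSpace ℝ E]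
variable {H : Type*} [NormedAddCommGroup H] [InnerProductSpace ℝ H]

/-- The planar projection. -/
theorem exists_proj {P : E →L[ℝ] E →L[ℝ] ℝ} {Eplus Eminus : Submodule ℝ E}
    (hH1 : Semiflow.IsH1 P Eplus Eminus) [FiniteDimensional ℝ ↥Eminus]
    (hH2 : Module.finrank ℝ ↥Eminus = 2) :
    ∃ pr : E →L[ℝ] ℂ, ∀ x, pr x = 0 → 0 ≤ P x x := by
  obtain ⟨hsym, -, -, hcompl, hpos, hneg⟩ := hH1
  let b := Module.finBasisOfFinrankEq ℝ Eminus hH2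
  refine ⟨Complex.ofRealCLM.comp (P (b 0 : E)) + Complex.I • Complex.ofRealCLM.comp (P (b 1 : E)),
    fun x hx => ?_⟩
  have h0 : P (b 0 : E) x = 0 := by
    have := congrArg Complex.re hx
    simpa using this
  have h1 : P (b 1 : E) x = 0 := by
    have := congrArg Complex.im hx
    simpa using this
  have hw : ∀ w ∈ Eminus, P w x = 0 := by
    intro w hw
    have h2 := b.sum_repr ⟨w, hw⟩
    rw [Fin.sum_univ_two] at h2
    have h3 := congrArg (Subtype.val) h2
    simp only [Submodule.coe_add, Submodule.coe_smul] at h3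
    rw [← h3]
    simp [h0, h1]
  obtain ⟨p, hp, m, hm, hpm⟩ := Submodule.mem_sup.1
    (show x ∈ Eplus ⊔ Eminus by rw [hcompl.sup_eq_top]; trivial)
  have e1 := hw m hm
  rw [← hpm] at e1 ⊢
  have hp' : 0 ≤ P p p := by
    by_cases h : p = 0
    · simp [h]
    · exact (hpos p hp h).le
  have hm' : P m m ≤ 0 := by
    by_cases h : m = 0
    · simp [h]
    · exact (hneg m hm h).le
  have := hsym p m
  simp only [map_add, ContinuousLinearMap.add_apply] at *
  linarith

/-- trajectory bounded in the past -/
def BP (φ : Semiflow E) (z : ℝ → E) : Prop :=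
  φ.IsCompleteTrajectory z ∧ ∀ s, IsBounded (z '' Iic s)

theorem shift_traj {φ : Semiflow E} {z : ℝ → E} (hz : φ.IsCompleteTrajectory z) (c : ℝ) :
    φ.IsCompleteTrajectory (fun t => z (c + t)) := by
  have := hz.1
  refine ⟨by fun_prop, fun t ht s => ?_⟩
  show z (c + (t + s)) = φ.toFun t (z (c + s))
  rw [← hz.2 t ht]
  congr 1
  ring

theorem BP.shift {φ : Semiflow E} {z : ℝ → E} (hz : BP φ z) (c : ℝ) :
    BP φ (fun t => z (c + t)) := by
  refine ⟨shift_traj hz.1 c, fun s => (hz.2 (c + s)).subset ?_⟩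
  rintro _ ⟨t, ht, rfl⟩
  exact ⟨c + t, by simpa using ht, rfl⟩

theorem BP.of_bdd {φ : Semiflow E} {z : ℝ → E} (hz : φ.IsCompleteTrajectory z) {c : ℝ}
    (h : IsBounded (z '' Iic c)) : BP φ z := by
  refine ⟨hz, fun s => ?_⟩
  refine (h.union ((isCompact_Icc : IsCompact (Icc c s)).image hz.1).isBounded).subset ?_
  rintro _ ⟨t, ht, rfl⟩
  rcases le_total t c with h | h
  · exact Or.inl ⟨t, h, rfl⟩
  · exact Or.inr ⟨t, ⟨h, ht⟩, rfl⟩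

theorem traj_unique {ι : E →L[ℝ] H} (hι : Function.Injective ι) {φ : Semiflow E}
    {P : E →L[ℝ] E →L[ℝ] ℝ} {δ τV ν : ℝ} (hH3 : φ.IsH3 ι P δ τV ν) {pr : E →L[ℝ] ℂ}
    (hpr : ∀ x, pr x = 0 → 0 ≤ P x x) {z₁ z₂ : ℝ → E} (h1 : BP φ z₁) (h2 : BP φ z₂)
    (h : pr (z₁ 0) = pr (z₂ 0)) : z₁ = z₂ := by
  obtain ⟨hδ, hτ, hν, hH⟩ := hH3
  have c1 := h1.1.1
  have c2 := h2.1.1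
  set f : ℝ → ℝ := fun s => Real.exp (2 * ν * s) * ‖ι (z₁ s) - ι (z₂ s)‖ ^ 2 with hf
  have fc : Continuous f := by fun_prop
  have fn : ∀ s, 0 ≤ f s := fun s => by positivity
  obtain ⟨C1, hC1⟩ := (h1.2 0).exists_norm_le
  obtain ⟨C2, hC2⟩ := (h2.2 0).exists_norm_le
  have hw0 : 0 ≤ P (z₁ 0 - z₂ 0) (z₁ 0 - z₂ 0) := hpr _ (by rw [map_sub, h, sub_self])
  have bound : ∀ m, 0 ≤ m → τV ≤ m →
      δ * ∫ s in (-m)..0, f s ≤ Real.exp (-(2 * ν * m)) * (‖P‖ * (C1 + C2) ^ 2) := by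
    intro m hm hm'
    have h3 := hH (z₁ (-m)) (z₂ (-m)) 0 m le_rfl hm (by linarith)
    have t1 : ∀ s, 0 ≤ s → φ.toFun s (z₁ (-m)) = z₁ (s - m) := fun s hs => (h1.1.2 s hs (-m)).symm
    have t2 : ∀ s, 0 ≤ s → φ.toFun s (z₂ (-m)) = z₂ (s - m) := fun s hs => (h2.1.2 s hs (-m)).symm
    have hIntg : ∫ s in (0 : ℝ)..m, Real.exp (2 * ν * s) *
        ‖ι (φ.toFun s (z₁ (-m))) - ι (φ.toFun s (z₂ (-m)))‖ ^ 2
        = Real.exp (2 * ν * m) * ∫ s in (-m)..0, f s := by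
      rw [← intervalIntegral.integral_const_mul]
      have e := intervalIntegral.integral_comp_sub_right (a := 0) (b := m)
        (fun s => Real.exp (2 * ν * m) * f s) m
      rw [zero_sub, sub_self] at e
      rw [← e]
      refine intervalIntegral.integral_congr fun s hs => ?_
      rw [uIcc_of_le hm] at hs
      simp only [hf]
      rw [t1 s hs.1, t2 s hs.1, ← mul_assoc, ← Real.exp_add]
      congr 3
      ring
    rw [hIntg, t1 m hm, t2 m hm, t1 0 le_rfl, t2 0 le_rfl, sub_self, zero_sub, mul_zero, Real.exp_zero,
      one_mul] at h3
    have b1 : ‖z₁ (-m) - z₂ (-m)‖ ≤ C1 + C2 := (norm_sub_le _ _).trans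
      (add_le_add (hC1 _ ⟨-m, by simpa using hm, rfl⟩) (hC2 _ ⟨-m, by simpa using hm, rfl⟩))
    have b2 : P (z₁ (-m) - z₂ (-m)) (z₁ (-m) - z₂ (-m)) ≤ ‖P‖ * (C1 + C2) ^ 2 := by
      refine (le_abs_self _).trans (((P.le_opNorm₂ _ _)).trans ?_)
      rw [mul_assoc, ← sq]
      gcongr
    have e1 := Real.exp_pos (2 * ν * m)
    have b3 : 0 ≤ Real.exp (2 * ν * m) * P (z₁ 0 - z₂ 0) (z₁ 0 - z₂ 0) := by positivity
    rw [Real.exp_neg, ← div_eq_inv_mul, le_div_iff₀ e1]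
    linarith
  have hlim : Tendsto (fun m : ℝ => Real.exp (-(2 * ν * m)) * (‖P‖ * (C1 + C2) ^ 2)) atTop (𝓝 0) := by
    have : Tendsto (fun m : ℝ => Real.exp (-(2 * ν * m))) atTop (𝓝 0) :=
      Real.tendsto_exp_neg_atTop_nhds_zero.comp (tendsto_id.const_mul_atTop (by linarith))
    simpa using this.mul_const (‖P‖ * (C1 + C2) ^ 2)
  have hneg : ∀ s ≤ 0, z₁ s = z₂ s := by
    intro s0 hs0
    by_contra hne
    have hfs : 0 < f s0 := by
      have : ι (z₁ s0) - ι (z₂ s0) ≠ 0 := sub_ne_zero.2 fun h => hne (hι h)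
      have := norm_pos_iff.2 this
      positivity
    have hI : 0 < ∫ s in (s0 - 1)..0, f s := intervalIntegral.integral_pos (by linarith) fc.continuousOn
      (fun s _ => fn s) ⟨s0, ⟨by linarith, hs0⟩, hfs⟩
    have ev : ∀ᶠ m : ℝ in atTop, δ * ∫ s in (s0 - 1)..0, f s ≤ Real.exp (-(2 * ν * m)) * (‖P‖ * (C1 + C2) ^ 2) := by
      filter_upwards [eventually_ge_atTop 0, eventually_ge_atTop τV, eventually_ge_atTop (1 - s0)] with m m1 m2 m3
      refine le_trans ?_ (bound m m1 m2)
      have := intervalIntegral.integral_add_adjacent_intervals (a := -m) (b := s0 - 1) (c := 0) (μ := volume)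
        (fc.intervalIntegrable _ _) (fc.intervalIntegrable _ _)
      have h5 : 0 ≤ ∫ s in (-m)..(s0 - 1), f s :=
        intervalIntegral.integral_nonneg (by linarith) (fun s _ => fn s)
      rw [← this]
      nlinarith
    have := ge_of_tendsto hlim ev
    nlinarith
  funext t
  rcases le_total t 0 with ht | ht
  · exact hneg t ht
  · have e1 := h1.1.2 t ht 0
    have e2 := h2.1.2 t ht 0
    rw [add_zero] at e1 e2
    rw [e1, e2, hneg 0 le_rfl]

/-- Gluing backward steps to a complete trajectory. -/
theorem glue (φ : Semiflow E) (M : Set E)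
    (hM : ∀ y ∈ M, ∃ y' ∈ M, φ.toFun 1 y' = y ∧ ∀ τ ∈ Icc (0 : ℝ) 1, φ.toFun τ y' ∈ M) {y : E} (hy : y ∈ M) :
    ∃ z, φ.IsCompleteTrajectory z ∧ z 0 = y ∧ ∀ t ≤ 0, z t ∈ M := by
  choose! f hf1 hf2 hf3 using hM
  let Y : ℕ → E := fun n => Nat.rec y (fun _ x => f x) n
  have Y0 : Y 0 = y := rfl
  have YS : ∀ n, Y (n + 1) = f (Y n) := fun n => rfl
  have YM : ∀ n, Y n ∈ M := by
    intro n
    induction n with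
    | zero => exact hy
    | succ n ih => exact hf1 _ ih
  have step : ∀ n k : ℕ, φ.toFun k (Y (n + k)) = Y n := by
    intro n k
    induction k with
    | zero => simpa using φ.map_zero' _
    | succ k ih =>
      push_cast
      rw [φ.map_add' k 1 (by positivity) zero_le_one, ← add_assoc, YS, hf2 _ (YM _), ih]
  let z : ℝ → E := fun t => φ.toFun (t + (⌈-t⌉₊ : ℕ)) (Y ⌈-t⌉₊)
  have zdef : ∀ t : ℝ, ∀ n : ℕ, 0 ≤ t + n → z t = φ.toFun (t + n) (Y n) := by
    intro t n hn
    have h1 : ⌈-t⌉₊ ≤ n := Nat.ceil_le.2 (by linarith)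
    obtain ⟨k, rfl⟩ := Nat.exists_eq_add_of_le h1
    have h2 : 0 ≤ t + (⌈-t⌉₊ : ℕ) := by linarith [Nat.le_ceil (-t)]
    push_cast
    rw [← add_assoc, φ.map_add' _ _ h2 (by positivity), step]
  refine ⟨z, ⟨?_, ?_⟩, ?_, ?_⟩
  · rw [continuous_iff_continuousAt]
    intro t0
    obtain ⟨n, hn⟩ := exists_nat_gt (-t0)
    have hev : ∀ᶠ t in 𝓝 t0, z t = φ.toFun (t + n) (Y n) := by
      filter_upwards [lt_mem_nhds (show -(n:ℝ) < t0 by linarith)] with t ht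
      exact zdef t n (by linarith)
    refine ContinuousAt.congr ?_ (hev.mono fun t ht => ht.symm)
    have h1 : ContinuousAt (fun p : ℝ × E => φ.toFun p.1 p.2) (t0 + n, Y n) :=
      φ.continuousOn'.continuousAt (prod_mem_nhds (Ici_mem_nhds (by linarith)) univ_mem)
    exact ContinuousAt.comp (f := fun t : ℝ => (t + n, Y n)) h1 (by fun_prop)
  · intro t ht s
    obtain ⟨n, hn⟩ := exists_nat_gt (-s)
    rw [zdef s n (by linarith), zdef (t + s) n (by linarith), ← φ.map_add' _ _ ht (by linarith), add_assoc]
  · rw [zdef 0 0 (by simp)]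
    rw [Y0]
    simpa using φ.map_zero' y
  · intro t ht
    have h1 := Nat.le_ceil (-t)
    have h2 := Nat.ceil_lt_add_one (show 0 ≤ -t by linarith)
    show φ.toFun (t + (⌈-t⌉₊ : ℕ)) (Y ⌈-t⌉₊) ∈ M
    rcases hN : ⌈-t⌉₊ with _ | n
    · rw [hN] at h1
      have : t = 0 := by
        simp at h1
        linarith
      rw [this]
      rw [Y0]
      simpa [φ.map_zero'] using hy
    · rw [hN] at h1 h2
      rw [YS]
      exact hf3 _ (YM n) _ ⟨by linarith, by linarith⟩

/-- continuity along sequences -/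
theorem flow_tendsto (φ : Semiflow E) {t : ℕ → ℝ} {x : ℕ → E} {t0 : ℝ} {x0 : E} (ht : ∀ n, 0 ≤ t n)
    (ht' : Tendsto t atTop (𝓝 t0)) (hx : Tendsto x atTop (𝓝 x0)) :
    Tendsto (fun n => φ.toFun (t n) (x n)) atTop (𝓝 (φ.toFun t0 x0)) := by
  have h0 : 0 ≤ t0 := ge_of_tendsto' ht' ht
  have h1 := φ.continuousOn' (t0, x0) ⟨h0, mem_univ _⟩
  refine Tendsto.comp (f := fun n => (t n, x n)) h1 (tendsto_nhdsWithin_iff.2 ⟨?_, ?_⟩)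
  · exact ht'.prodMk_nhds hx
  · exact Eventually.of_forall fun n => ⟨ht n, mem_univ _⟩

theorem mem_alpha {φ : Semiflow E} {z : ℝ → E} {y : E} :
    y ∈ φ.alphaLimitOf z ↔ ∀ s0 : ℝ, ∀ e > 0, ∃ s ≤ s0, ‖z s - y‖ < e := by
  simp only [Semiflow.alphaLimitOf, mem_iInter, Metric.mem_closure_iff]
  constructor
  · intro h s0 e he
    obtain ⟨_, ⟨t, ht, rfl⟩, hd⟩ := h (min s0 0) (mem_Iic.2 (min_le_right _ _)) e he
    exact ⟨t, ht.trans (min_le_left _ _), by rwa [dist_comm, dist_eq_norm] at hd⟩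
  · intro h s0 _ e he
    obtain ⟨s, hs, hd⟩ := h s0 e he
    exact ⟨_, ⟨s, hs, rfl⟩, by rwa [dist_comm, dist_eq_norm]⟩

theorem mem_alpha_seq {φ : Semiflow E} {z : ℝ → E} {y : E} :
    y ∈ φ.alphaLimitOf z ↔ ∃ s : ℕ → ℝ, (∀ n : ℕ, s n ≤ -n) ∧ Tendsto (fun n => z (s n)) atTop (𝓝 y) := by
  rw [mem_alpha]
  constructor
  · intro h
    choose s hs hd using fun n : ℕ => h (-n) (1 / (n + 1)) (by positivity)
    refine ⟨s, hs, tendsto_iff_norm_sub_tendsto_zero.2 ?_⟩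
    exact squeeze_zero (fun _ => norm_nonneg _) (fun n => (hd n).le) tendsto_one_div_add_atTop_nhds_zero_nat
  · rintro ⟨s, hs, ht⟩ s0 e he
    obtain ⟨n0, hn0⟩ := exists_nat_ge (-s0)
    obtain ⟨n, hn, hn'⟩ := ((Metric.tendsto_nhds.1 ht e he).and (eventually_ge_atTop n0)).exists
    have : (n0 : ℝ) ≤ n := by exact_mod_cast hn'
    exact ⟨s n, by linarith [hs n], by rwa [dist_eq_norm] at hn⟩

theorem mem_omega {φ : Semiflow E} {z : ℝ → E} (hz : φ.IsCompleteTrajectory z) {y : E}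
    (hy : y ∈ φ.omegaLimit (z 0)) : ∀ s0 : ℝ, ∀ e > 0, ∃ s ≥ s0, ‖z s - y‖ < e := by
  simp only [Semiflow.omegaLimit, mem_iInter, Metric.mem_closure_iff] at hy
  intro s0 e he
  obtain ⟨_, ⟨t, ht, rfl⟩, hd⟩ := hy (max s0 0) (mem_Ici.2 (le_max_right _ _)) e he
  have h0 : 0 ≤ t := (le_max_right _ _).trans ht
  have := hz.2 t h0 0
  rw [add_zero] at this
  refine ⟨t, (le_max_left _ _).trans ht, ?_⟩
  rwa [dist_comm, dist_eq_norm, ← this] at hd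

theorem alpha_closed {φ : Semiflow E} {z : ℝ → E} : IsClosed (φ.alphaLimitOf z) :=
  isClosed_biInter fun _ _ => isClosed_closure

theorem limit_mem_of_closed {z : ℝ → E} {A : Set E} (hA : IsClosed A) (hz : ∀ t, z t ∈ A) {y : E}
    (h : ∀ e > 0, ∃ s, ‖z s - y‖ < e) : y ∈ A := by
  rw [← hA.closure_eq, Metric.mem_closure_iff]
  intro e he
  obtain ⟨s, hs⟩ := h e he
  exact ⟨z s, hz s, by rwa [dist_comm, dist_eq_norm]⟩

theorem alpha_nonempty {φ : Semiflow E} {z : ℝ → E} {K : Set E} (hK : IsCompact K)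
    (hz : ∀ t ≤ 0, z t ∈ K) : (φ.alphaLimitOf z).Nonempty := by
  obtain ⟨y, -, f, hf, ht⟩ := hK.tendsto_subseq (x := fun n : ℕ => z (-n)) (fun n => hz _ (by simp))
  refine ⟨y, mem_alpha_seq.2 ⟨fun n => -(f n : ℝ), fun n => ?_, ht⟩⟩
  have : (n : ℝ) ≤ f n := by exact_mod_cast hf.id_le n
  linarith

theorem K_compact {φ : Semiflow E} (hCOM : φ.IsCOM) {v : ℝ → E} (hv : BP φ v) :
    IsCompact (closure (v '' Iic 0)) := by
  obtain ⟨τ, hτ, h⟩ := hCOM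
  refine (h (v '' Iic 0) (hv.2 0)).of_isClosed_subset isClosed_closure (closure_mono ?_)
  rintro _ ⟨t, ht, rfl⟩
  refine ⟨v (t - τ), ⟨t - τ, by simp at ht ⊢; linarith, rfl⟩, ?_⟩
  rw [← hv.1.2 τ hτ.le]
  congr 1
  ring

theorem K_traj {φ : Semiflow E} {v : ℝ → E} (hv : φ.IsCompleteTrajectory v)
    (hK : IsCompact (closure (v '' Iic 0))) {y : E} (hy : y ∈ closure (v '' Iic 0)) :
    ∃ z, φ.IsCompleteTrajectory z ∧ z 0 = y ∧ ∀ t ≤ 0, z t ∈ closure (v '' Iic 0) := by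
  refine glue φ _ ?_ hy
  intro y hy
  obtain ⟨x, hx, hxy⟩ := mem_closure_iff_seq_limit.1 hy
  choose s hs hsx using hx
  have hs : ∀ n, s n ≤ 0 := hs
  obtain ⟨y', hy', f, hf, ht⟩ := hK.tendsto_subseq (x := fun n : ℕ => v (s n - 1))
    (fun n => subset_closure ⟨s n - 1, by have := hs n; simp; linarith, rfl⟩)
  have key : ∀ τ, 0 ≤ τ → Tendsto (fun n => v (τ + (s (f n) - 1))) atTop (𝓝 (φ.toFun τ y')) := by
    intro τ hτ
    have := flow_tendsto φ (t := fun _ => τ) (fun _ => hτ) tendsto_const_nhds ht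
    refine this.congr fun n => ?_
    exact (hv.2 τ hτ _).symm
  refine ⟨y', hy', ?_, fun τ hτ => ?_⟩
  · refine tendsto_nhds_unique (key 1 zero_le_one) ((hxy.comp hf.tendsto_atTop).congr fun n => ?_)
    simp [← hsx]
  · refine isClosed_closure.mem_of_tendsto (key τ hτ.1) (Eventually.of_forall fun n => subset_closure ?_)
    exact ⟨_, by have := hs (f n); simp; linarith [hτ.2], rfl⟩

theorem alpha_subset {φ : Semiflow E} {v : ℝ → E} : φ.alphaLimitOf v ⊆ closure (v '' Iic 0) := by
  intro y hy
  rw [mem_alpha] at hy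
  rw [Metric.mem_closure_iff]
  intro e he
  obtain ⟨s, hs, hd⟩ := hy 0 e he
  exact ⟨_, ⟨s, hs, rfl⟩, by rwa [dist_comm, dist_eq_norm]⟩

theorem alpha_forward {φ : Semiflow E} {v : ℝ → E} (hv : φ.IsCompleteTrajectory v) {y : E}
    (hy : y ∈ φ.alphaLimitOf v) {t : ℝ} (ht : 0 ≤ t) : φ.toFun t y ∈ φ.alphaLimitOf v := by
  obtain ⟨s, hs, h⟩ := mem_alpha_seq.1 hy
  have := flow_tendsto φ (t := fun _ => t) (fun _ => ht) tendsto_const_nhds h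
  obtain ⟨N, hN⟩ := exists_nat_ge t
  refine mem_alpha_seq.2 ⟨fun n => t + s (n + N), fun n => ?_, ?_⟩
  · have := hs (n + N)
    push_cast at this
    linarith
  · refine (this.comp (tendsto_add_atTop_nat N)).congr fun n => ?_
    exact (hv.2 t ht _).symm

theorem alpha_traj {φ : Semiflow E} {v : ℝ → E} (hv : φ.IsCompleteTrajectory v)
    (hK : IsCompact (closure (v '' Iic 0))) {y : E} (hy : y ∈ φ.alphaLimitOf v) :
    ∃ z, φ.IsCompleteTrajectory z ∧ z 0 = y ∧ ∀ t, z t ∈ φ.alphaLimitOf v := by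
  obtain ⟨z, hz, hz0, hzm⟩ := glue φ (φ.alphaLimitOf v) (by
    intro y hy
    obtain ⟨s, hs, h⟩ := mem_alpha_seq.1 hy
    obtain ⟨y', hy', f, hf, ht⟩ := hK.tendsto_subseq (x := fun n : ℕ => v (s n - 1))
      (fun n => subset_closure ⟨s n - 1, by
        have := hs n
        have : (0 : ℝ) ≤ n := by positivity
        simp; linarith, rfl⟩)
    have hy'α : y' ∈ φ.alphaLimitOf v := mem_alpha_seq.2 ⟨fun n => s (f n) - 1, fun n => by
      have : (n : ℝ) ≤ f n := by exact_mod_cast hf.id_le n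
      linarith [hs (f n)], ht⟩
    refine ⟨y', hy'α, ?_, fun τ hτ => alpha_forward hv hy'α hτ.1⟩
    have := flow_tendsto φ (t := fun _ => 1) (fun _ => zero_le_one) tendsto_const_nhds ht
    refine tendsto_nhds_unique this ((h.comp hf.tendsto_atTop).congr fun n => ?_)
    simp only [Function.comp]
    rw [← hv.2 1 zero_le_one]
    congr 1
    ring) hy
  refine ⟨z, hz, hz0, fun t => ?_⟩
  rcases le_total t 0 with h | h
  · exact hzm t h
  · have := hz.2 t h 0
    rw [add_zero] at this
    rw [this, hz0]
    exact alpha_forward hv hy h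

end PBAux

open Set Filter Topology MeasureTheory Bornology

namespace PBAux

variable {E : Type*} [NormedAddCommGroup E] [NormedSpace ℝ E]
variable {H : Type*} [NormedAddCommGroup H] [InnerProductSpace ℝ H]

theorem traj_unique_shift {ι : E →L[ℝ] H} (hι : Function.Injective ι) {φ : Semiflow E}
    {P : E →L[ℝ] E →L[ℝ] ℝ} {δ τV ν : ℝ} (hH3 : φ.IsH3 ι P δ τV ν) {pr : E →L[ℝ] ℂ}
    (hpr : ∀ x, pr x = 0 → 0 ≤ P x x) {z₁ z₂ : ℝ → E} (h1 : BP φ z₁) (h2 : BP φ z₂) (s t : ℝ)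
    (h : pr (z₁ s) = pr (z₂ t)) (a : ℝ) : z₁ (s + a) = z₂ (t + a) :=
  congrFun (traj_unique hι hH3 hpr (h1.shift s) (h2.shift t) (by simpa using h)) a

theorem pr_close (pr : E →L[ℝ] ℂ) {ρ : ℝ} (hρ : 0 < ρ) :
    ∃ e > 0, ∀ x y, ‖x - y‖ < e → ‖pr x - pr y‖ < ρ := by
  obtain ⟨e, he, h⟩ := Metric.uniformContinuous_iff.1 pr.uniformContinuous ρ hρ
  exact ⟨e, he, fun x y hxy => by
    rw [← dist_eq_norm] at hxy ⊢
    exact h hxy⟩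

theorem BP.of_K {φ : Semiflow E} {K : Set E} (hK : IsCompact K) {z : ℝ → E}
    (hz : φ.IsCompleteTrajectory z) {s : ℝ} (h : ∀ t ≤ s, z t ∈ K) : BP φ z := by
  refine BP.of_bdd hz (c := s) (hK.isBounded.subset ?_)
  rintro _ ⟨t, ht, rfl⟩
  exact h t ht

/-- Projected closeness at one time forces closeness on compact time intervals. -/
theorem close {ι : E →L[ℝ] H} (hι : Function.Injective ι) {φ : Semiflow E}
    {P : E →L[ℝ] E →L[ℝ] ℝ} {δ τV ν : ℝ} (hH3 : φ.IsH3 ι P δ τV ν) {pr : E →L[ℝ] ℂ}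
    (hpr : ∀ x, pr x = 0 → 0 ≤ P x x) {v : ℝ → E} (hv : φ.IsCompleteTrajectory v)
    (hK : IsCompact (closure (v '' Iic 0))) {Q : ℝ → E} (hQ : φ.IsCompleteTrajectory Q)
    (hQK : ∀ t ≤ 0, Q t ∈ closure (v '' Iic 0)) (T : ℝ) {η : ℝ} (hη : 0 < η) :
    ∃ ρ > 0, ∀ z, φ.IsCompleteTrajectory z → ∀ s, (∀ t ≤ s, z t ∈ closure (v '' Iic 0)) →
      ‖pr (z s) - pr (Q 0)‖ ≤ ρ → ∀ t, |t| ≤ T → ‖pr (z (s + t)) - pr (Q t)‖ ≤ η := by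
  by_contra! hcon
  choose z hz s hzK hd t ht hbad using fun n : ℕ => hcon (1 / (n + 1)) (by positivity)
  have hT : 0 ≤ T := (abs_nonneg _).trans (ht 0)
  obtain ⟨w, hw, f, hf, hfw⟩ := hK.tendsto_subseq (x := fun n => z n (s n - T))
    (fun n => hzK n _ (by linarith))
  obtain ⟨t0, ht0, g, hg, hgt⟩ := (isCompact_Icc : IsCompact (Icc (-T) T)).tendsto_subseq
    (x := fun n => t (f n)) (fun n => abs_le.1 (ht (f n)))
  obtain ⟨ζ, hζ, hζ0, hζK⟩ := K_traj hv hK hw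
  have key : ∀ (τ : ℕ → ℝ) (τ0 : ℝ), (∀ n, -T ≤ τ n) → Tendsto τ atTop (𝓝 τ0) →
      Tendsto (fun n => z (f (g n)) (s (f (g n)) + τ n)) atTop (𝓝 (ζ (T + τ0))) := by
    intro τ τ0 h1 h2
    have h3 : 0 ≤ T + τ0 := by linarith [ge_of_tendsto' h2 h1]
    have h4 := flow_tendsto φ (t := fun n => T + τ n) (fun n => by linarith [h1 n])
      (h2.const_add T) (hfw.comp hg.tendsto_atTop)
    have h5 := hζ.2 _ h3 0
    rw [add_zero, hζ0] at h5
    rw [h5]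
    refine h4.congr fun n => ?_
    simp only [Function.comp]
    rw [← (hz (f (g n))).2 _ (by linarith [h1 n])]
    congr 1
    ring
  have k0 := key (fun _ => 0) 0 (fun _ => by linarith) tendsto_const_nhds
  simp only [add_zero] at k0
  have lim0 : Tendsto (fun n : ℕ => (1 : ℝ) / (((f (g n) : ℕ) : ℝ) + 1)) atTop (𝓝 0) :=
    tendsto_one_div_add_atTop_nhds_zero_nat.comp (hf.tendsto_atTop.comp hg.tendsto_atTop)
  have k1 : Tendsto (fun n => pr (z (f (g n)) (s (f (g n))))) atTop (𝓝 (pr (Q 0))) :=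
    tendsto_iff_norm_sub_tendsto_zero.2
      (squeeze_zero (fun _ => norm_nonneg _) (fun n => hd (f (g n))) lim0)
  have e0 : pr (ζ T) = pr (Q 0) := tendsto_nhds_unique ((pr.continuous.tendsto _).comp k0) k1
  have e1 := traj_unique_shift hι hH3 hpr (BP.of_K hK hζ hζK) (BP.of_K hK hQ hQK) T 0 e0 t0
  have k2 := (pr.continuous.tendsto _).comp (key _ _ (fun n => (abs_le.1 (ht (f (g n)))).1) hgt)
  have k3 := ((pr.continuous.comp hQ.1).tendsto t0).comp hgt
  have k4 := (k2.sub k3).norm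
  rw [e1, zero_add] at k4
  simp only [Function.comp, sub_self, norm_zero] at k4
  have := ge_of_tendsto' k4 (fun n => (hbad (f (g n))).le)
  linarith

theorem dichotomy {q : ℝ → ℂ} (hq : Continuous q) (hnc : ∃ t, q t ≠ q 0)
    (hd : ∀ s t, q s = q t → ∀ h, q (s + h) = q (t + h)) :
    Function.Injective q ∨ ∃ T > 0, (∀ t, q (t + T) = q t) ∧
      ∀ s t, q s = q t → ∃ n : ℤ, s - t = n * T := by
  let G : AddSubgroup ℝ :=
    { carrier := {t | q t = q 0}
      zero_mem' := rfl
      add_mem' := by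
        intro a b ha hb
        have := hd a 0 ha b
        rw [zero_add] at this
        exact this.trans hb
      neg_mem' := by
        intro a ha
        have := hd a 0 ha (-a)
        rw [zero_add, add_neg_cancel] at this
        exact this.symm }
  have hG : ∀ t, t ∈ G ↔ q t = q 0 := fun t => Iff.rfl
  have hdiff : ∀ s t, q s = q t → s - t ∈ G := by
    intro s t h
    have := hd s t h (-t)
    rw [add_neg_cancel] at this
    rw [hG, ← this, sub_eq_add_neg]
  rcases G.dense_or_cyclic with h | ⟨a, ha⟩
  · exfalso
    obtain ⟨t, ht⟩ := hnc
    have hc : IsClosed (G : Set ℝ) := isClosed_eq hq continuous_const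
    have : (G : Set ℝ) = univ := by rw [← hc.closure_eq, h.closure_eq]
    exact ht ((hG t).1 (by rw [← SetLike.mem_coe, this]; trivial))
  · by_cases h0 : a = 0
    · left
      intro s t hst
      have := hdiff s t hst
      rw [ha, h0, AddSubgroup.mem_closure_singleton] at this
      obtain ⟨n, hn⟩ := this
      simp at hn
      linarith
    · right
      have haG : a ∈ G := by
        rw [ha]
        exact AddSubgroup.subset_closure rfl
      have hTG : |a| ∈ G := by
        rcases abs_choice a with h | h <;> rw [h]
        · exact haG
        · exact G.neg_mem haG
      refine ⟨|a|, abs_pos.2 h0, fun t => ?_, fun s t hst => ?_⟩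
      · have := hd _ _ ((hG _).1 hTG) t
        rw [zero_add] at this
        rw [add_comm, this]
      · have := hdiff s t hst
        rw [ha, AddSubgroup.mem_closure_singleton] at this
        obtain ⟨n, hn⟩ := this
        simp only [zsmul_eq_mul] at hn
        rcases abs_choice a with h | h <;> rw [h]
        · exact ⟨n, hn.symm⟩
        · refine ⟨-n, ?_⟩
          rw [← hn]
          push_cast
          ring

theorem local_inj {q : ℝ → ℂ} (hq : Continuous q) (hnc : ∃ t, q t ≠ q 0)
    (hd : ∀ s t, q s = q t → ∀ h, q (s + h) = q (t + h)) : ∃ ε > 0, InjOn q (Icc (-ε) ε) := by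
  rcases dichotomy hq hnc hd with h | ⟨T, hT, -, h⟩
  · exact ⟨1, one_pos, h.injOn⟩
  · refine ⟨T / 4, by positivity, fun s hs t ht hst => ?_⟩
    obtain ⟨n, hn⟩ := h s t hst
    have h1 : (n : ℝ) * T < 1 * T := by linarith [hs.2, ht.1]
    have h2 : (-1 : ℝ) * T < n * T := by linarith [hs.1, ht.2]
    have h3 : (n : ℝ) < 1 := lt_of_mul_lt_mul_right h1 hT.le
    have h4 : (-1 : ℝ) < n := lt_of_mul_lt_mul_right h2 hT.le
    have h5 : n < 1 := by exact_mod_cast h3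
    have h6 : -1 < n := by exact_mod_cast h4
    have : n = 0 := by omega
    rw [this] at hn
    simp at hn
    linarith

/-- a stationary complete trajectory is constant in forward time; converse as needed -/
theorem stationary_of_const {φ : Semiflow E} {z : ℝ → E} (hz : φ.IsCompleteTrajectory z)
    (h : ∀ t, z t = z 0) : φ.IsStationary (z 0) := by
  intro t ht
  rw [← hz.2 t ht 0, h]

theorem main_T2 {ι : E →L[ℝ] H} (hι : Function.Injective ι) {φ : Semiflow E}
    {P : E →L[ℝ] E →L[ℝ] ℝ} {δ τV ν : ℝ} (hH3 : φ.IsH3 ι P δ τV ν) {pr : E →L[ℝ] ℂ}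
    (hpr : ∀ x, pr x = 0 → 0 ≤ P x x) {v : ℝ → E} (hv : φ.IsCompleteTrajectory v)
    (hK : IsCompact (closure (v '' Iic 0))) {u : ℝ → E} (hu : φ.IsCompleteTrajectory u)
    (huα : ∀ t, u t ∈ φ.alphaLimitOf v) {p : E} (hp : ¬ φ.IsStationary p)
    (hrec : ∀ T, ∀ e > 0, ∃ t, T ≤ |t| ∧ ‖u t - p‖ < e) :
    ∃ v₀ : E, φ.IsPeriodicPt v₀ ∧ φ.alphaLimitOf v = φ.orbit v₀ := by
  have hvK : ∀ t ≤ 0, v t ∈ closure (v '' Iic 0) := fun t ht => subset_closure ⟨t, ht, rfl⟩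
  have αK : ∀ y ∈ φ.alphaLimitOf v, y ∈ closure (v '' Iic 0) := fun y hy => alpha_subset hy
  have bpv : BP φ v := BP.of_K hK hv hvK
  have bpα : ∀ z, φ.IsCompleteTrajectory z → (∀ t, z t ∈ φ.alphaLimitOf v) → BP φ z :=
    fun z hz h => BP.of_K hK hz (s := 0) (fun t _ => αK _ (h t))
  have bpu := bpα u hu huα
  have hpα : p ∈ φ.alphaLimitOf v := limit_mem_of_closed alpha_closed huα (fun e he => by
    obtain ⟨t, -, h⟩ := hrec 0 e he
    exact ⟨t, h⟩)
  obtain ⟨Q, hQ, hQ0, hQα⟩ := alpha_traj hv hK hpα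
  have bpQ := bpα Q hQ hQα
  have detz : ∀ z, BP φ z → ∀ s t, pr (z s) = pr (z t) → ∀ h, pr (z (s + h)) = pr (z (t + h)) :=
    fun z hz s t h a => congrArg pr (traj_unique_shift hι hH3 hpr hz hz s t h a)
  have ncz : ∀ z, BP φ z → ¬ φ.IsStationary (z 0) → ∃ t, pr (z t) ≠ pr (z 0) := by
    intro z hz hns
    by_contra! h
    refine hns (stationary_of_const hz.1 fun t => ?_)
    have := traj_unique_shift hι hH3 hpr hz hz t 0 (h t) 0
    simpa using this
  have prc : ∀ z, φ.IsCompleteTrajectory z → Continuous (fun t => pr (z t)) :=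
    fun z hz => pr.continuous.comp hz.1
  -- shadowing of a trajectory in the limit set by `v`
  have shadow : ∀ z, φ.IsCompleteTrajectory z → (∀ t, z t ∈ φ.alphaLimitOf v) →
      ∀ T, ∀ e > 0, ∀ t s0, ∃ s ≤ s0, ∀ τ, |τ| ≤ T → ‖pr (v (s + τ)) - pr (z (t + τ))‖ < e := by
    intro z hz hzα T e he t s0
    obtain ⟨ρ, hρ, h⟩ := close hι hH3 hpr hv hK (shift_traj hz t) (fun a _ => αK _ (hzα _)) T
      (half_pos he)
    obtain ⟨d, hd, h2⟩ := pr_close pr hρ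
    obtain ⟨s, hs, h3⟩ := mem_alpha.1 (hzα t) (min s0 0) d hd
    refine ⟨s, hs.trans (min_le_left _ _), fun τ hτ => ?_⟩
    have h4 := h v hv s (fun a ha => hvK a (ha.trans (hs.trans (min_le_right _ _))))
      (by simpa using (h2 _ _ h3).le) τ hτ
    linarith
  -- `u` is not injective
  have hninj : ¬ Function.Injective (fun t => pr (u t)) := by
    intro hinj
    obtain ⟨ε, hε, hεi⟩ := local_inj (prc Q hQ) (ncz Q bpQ (by rwa [hQ0])) (detz Q bpQ)
    have n1 : 0 < ‖pr (Q ε) - pr (Q 0)‖ := norm_pos_iff.2 (sub_ne_zero.2 fun h => hε.ne'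
      (hεi ⟨by linarith, le_rfl⟩ ⟨by linarith, hε.le⟩ h))
    have n2 : 0 < ‖pr (Q (-ε)) - pr (Q 0)‖ := norm_pos_iff.2 (sub_ne_zero.2 fun h => by
      have := hεi ⟨le_rfl, by linarith⟩ ⟨by linarith, hε.le⟩ h
      linarith)
    obtain ⟨κ, c, η, g⟩ := exists_geo (prc Q hQ) hε hεi (lt_min n1 n2) (min_le_left _ _)
      (min_le_right _ _)
    obtain ⟨ρ, hρ, hcl⟩ := close hι hH3 hpr hv hK hQ (fun a _ => αK _ (hQα _)) ε g.ηpos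
    refine planar_step1 g (U := fun t => pr (u t)) (V := fun t => pr (v t)) (S0 := 0) (prc u hu)
      (prc v hv) hinj hρ ?_ ?_ ?_ (shadow u hu huα) ?_
    · intro t ht τ hτ
      exact hcl u hu t (fun a _ => αK _ (huα a)) ht τ hτ
    · intro s hs h τ hτ
      exact hcl v hv s (fun a ha => hvK a (ha.trans hs)) h τ hτ
    · intro T e he
      obtain ⟨d, hd, h2⟩ := pr_close pr he
      obtain ⟨t, ht, h3⟩ := hrec T d hd
      refine ⟨t, ht, ?_⟩
      rw [hQ0]
      exact h2 _ _ h3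
    · intro s t h a
      exact congrArg pr (traj_unique_shift hι hH3 hpr bpv bpu s t h a)
  have hu0 : ¬ φ.IsStationary (u 0) := by
    intro hst
    have hper : ∀ t, u t = u 0 := by
      have hc : φ.IsCompleteTrajectory (fun _ => u 0) :=
        ⟨continuous_const, fun t ht _ => (hst t ht).symm⟩
      have := traj_unique hι hH3 hpr bpu (bpα _ hc (fun _ => huα 0)) rfl
      exact fun t => congrFun this t
    have : u 0 = p := by
      by_contra hne
      obtain ⟨t, -, h⟩ := hrec 0 ‖u 0 - p‖ (norm_pos_iff.2 (sub_ne_zero.2 hne))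
      rw [hper t] at h
      exact lt_irrefl _ h
    exact hp (this ▸ hst)
  have perU : ∀ z, BP φ z → ∀ T, (∀ t, pr (z (t + T)) = pr (z t)) → Function.Periodic z T := by
    intro z hz T h t
    have := traj_unique_shift hι hH3 hpr hz hz (t + T) t (h t) 0
    simpa using this
  have rangeper : ∀ z, BP φ z → ∀ T > 0, Function.Periodic z T → IsCompact (range z) := by
    intro z hz T hT h
    rw [← h.image_Icc hT 0]
    exact isCompact_Icc.image hz.1.1
  rcases dichotomy (prc u hu) (ncz u bpu hu0) (detz u bpu) with h | ⟨T, hT, hper, hmin⟩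
  · exact absurd h hninj
  have uper := perU u bpu T hper
  have ucomp := rangeper u bpu T hT uper
  have αv : ∀ M : Set E, IsClosed M → range v ⊆ M → φ.alphaLimitOf v ⊆ M := by
    intro M hM h y hy
    refine limit_mem_of_closed hM (fun t => h ⟨t, rfl⟩) (fun e he => ?_)
    obtain ⟨s, -, h⟩ := mem_alpha.1 hy 0 e he
    exact ⟨s, h⟩
  have hα : φ.alphaLimitOf v = range u := by
    refine Subset.antisymm (fun y hy => ?_) (by rintro _ ⟨t, rfl⟩; exact huα t)
    by_contra hyu
    obtain ⟨Y, hY, hY0, hYα⟩ := alpha_traj hv hK hy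
    have hVQ : ∀ s t, pr (v s) ≠ pr (u t) := by
      intro s t h
      refine hyu (αv _ ucomp.isClosed ?_ hy)
      rintro _ ⟨a, rfl⟩
      have := traj_unique_shift hι hH3 hpr bpv bpu s t h (a - s)
      rw [add_sub_cancel] at this
      exact ⟨_, this.symm⟩
    have hVinj : Function.Injective (fun t => pr (v t)) := by
      have hns : ∃ t, pr (v t) ≠ pr (v 0) := by
        by_contra! h
        have hc : ∀ t, v t = v 0 := fun t => by
          simpa using traj_unique_shift hι hH3 hpr bpv bpv t 0 (h t) 0
        have := αv {v 0} isClosed_singleton (by rintro _ ⟨t, rfl⟩; exact hc t) (huα 0)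
        exact hVQ 0 0 (by rw [mem_singleton_iff.1 this])
      rcases dichotomy (prc v hv) hns (detz v bpv) with h | ⟨T', hT', hper', -⟩
      · exact h
      · exfalso
        obtain ⟨s, hs⟩ := αv _ (rangeper v bpv T' hT' (perU v bpv T' hper')).isClosed Subset.rfl
          (huα 0)
        exact hVQ s 0 (by rw [hs])
    refine planar_step2 (Q := fun t => pr (u t)) (V := fun t => pr (v t)) (y := pr y) hT (prc u hu)
      (prc v hv) hper hmin hVinj hVQ (shadow u hu huα) ?_ ?_ ?_
    · intro t0 T0 η hη
      obtain ⟨ρ, hρ, h⟩ := close hι hH3 hpr hv hK (shift_traj hu t0) (fun a _ => αK _ (huα _)) T0 hη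
      refine ⟨ρ, hρ, 0, fun s hs h1 τ hτ => ?_⟩
      exact h v hv s (fun a ha => hvK a (ha.trans hs)) (by simpa using h1) τ hτ
    · intro t h
      have := traj_unique_shift hι hH3 hpr (bpα Y hY hYα) bpu 0 t (by rw [hY0]; exact h) 0
      rw [add_zero, add_zero, hY0] at this
      exact hyu ⟨t, this.symm⟩
    · intro s0 e he
      obtain ⟨d, hd, h2⟩ := pr_close pr he
      obtain ⟨s, hs, h3⟩ := mem_alpha.1 hy s0 d hd
      exact ⟨s, hs, h2 _ _ h3⟩
  have fu : ∀ t, 0 ≤ t → φ.toFun t (u 0) = u t := fun t ht => by rw [← hu.2 t ht 0, add_zero]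
  refine ⟨u 0, ⟨hu0, T, hT, ?_⟩, ?_⟩
  · rw [fu T hT.le]
    simpa using uper 0
  · rw [hα, ← uper.image_Icc hT 0]
    apply Subset.antisymm
    · rintro _ ⟨t, ht, rfl⟩
      exact ⟨t, ht.1, fu t ht.1⟩
    · rintro _ ⟨t, ht, rfl⟩
      rw [fu t ht, uper.image_Icc hT 0]
      exact ⟨t, rfl⟩

end PBAux

/-- Corollary 1: the trichotomy holds for the α-limit set of any complete trajectory
bounded in the past. -/
theorem alphaLimit_trichotomy
    {E : Type*} [NormedAddCommGroup E] [NormedSpace ℝ E]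
    {H : Type*} [NormedAddCommGroup H] [InnerProductSpace ℝ H]
    (ι : E →L[ℝ] H) (hι : Function.Injective ι)
    (φ : Semiflow E)
    (P : E →L[ℝ] E →L[ℝ] ℝ) (Eplus Eminus : Submodule ℝ E)
    (hH1 : Semiflow.IsH1 P Eplus Eminus)
    [FiniteDimensional ℝ ↥Eminus] (hH2 : Module.finrank ℝ ↥Eminus = 2)
    (δ τV ν : ℝ) (hH3 : φ.IsH3 ι P δ τV ν)
    (hCOM : φ.IsCOM) (hS : φ.IsSmoothing ι)
    (v : ℝ → E) (hv : φ.IsCompleteTrajectory v)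
    (hbdd : IsBounded (v '' Set.Iic (0 : ℝ))) :
    (∃ v₀ : E, φ.IsStationary v₀ ∧ φ.alphaLimitOf v = {v₀}) ∨
    (∃ v₀ : E, φ.IsPeriodicPt v₀ ∧ φ.alphaLimitOf v = φ.orbit v₀) ∨
    (∃ N : Set E, N.Nonempty ∧ (∀ p ∈ N, φ.IsStationary p) ∧
      ∃ T : Set (ℝ → E),
        (∀ u ∈ T, φ.IsCompleteTrajectory u ∧ φ.alphaLimitOf u ⊆ N ∧
          φ.omegaLimit (u 0) ⊆ N) ∧
        φ.alphaLimitOf v = N ∪ ⋃ u ∈ T, Set.range u) := by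
  obtain ⟨pr, hpr⟩ := PBAux.exists_proj hH1 hH2
  have hK := PBAux.K_compact hCOM (PBAux.BP.of_bdd hv hbdd)
  right
  by_cases hcase : ∃ u p, φ.IsCompleteTrajectory u ∧ (∀ t, u t ∈ φ.alphaLimitOf v) ∧
      ¬ φ.IsStationary p ∧ (∀ T, ∀ e > 0, ∃ t, T ≤ |t| ∧ ‖u t - p‖ < e)
  · obtain ⟨u, p, hu, huα, hp, hrec⟩ := hcase
    exact Or.inl (PBAux.main_T2 hι hH3 hpr hv hK hu huα hp hrec)
  right
  push Not at hcase
  have hst : ∀ u p, φ.IsCompleteTrajectory u → (∀ t, u t ∈ φ.alphaLimitOf v) →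
      (∀ T, ∀ e > 0, ∃ t, T ≤ |t| ∧ ‖u t - p‖ < e) → p ∈ φ.alphaLimitOf v ∧ φ.IsStationary p := by
    intro u p hu huα hrec
    refine ⟨PBAux.limit_mem_of_closed PBAux.alpha_closed huα (fun e he => ?_), ?_⟩
    · obtain ⟨t, -, h⟩ := hrec 0 e he
      exact ⟨t, h⟩
    · by_contra hns
      obtain ⟨T, e, he, h⟩ := hcase u p hu huα hns
      obtain ⟨t, ht, h'⟩ := hrec T e he
      exact absurd h' (not_lt.2 (h t ht))
  have hαa : ∀ u, φ.IsCompleteTrajectory u → (∀ t, u t ∈ φ.alphaLimitOf v) →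
      ∀ p ∈ φ.alphaLimitOf u, p ∈ φ.alphaLimitOf v ∧ φ.IsStationary p := by
    intro u hu huα p hp
    refine hst u p hu huα fun T e he => ?_
    obtain ⟨s, hs, h⟩ := PBAux.mem_alpha.1 hp (-T) e he
    exact ⟨s, by linarith [neg_le_abs s], h⟩
  have hαo : ∀ u, φ.IsCompleteTrajectory u → (∀ t, u t ∈ φ.alphaLimitOf v) →
      ∀ p ∈ φ.omegaLimit (u 0), p ∈ φ.alphaLimitOf v ∧ φ.IsStationary p := by
    intro u hu huα p hp
    refine hst u p hu huα fun T e he => ?_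
    obtain ⟨s, hs, h⟩ := PBAux.mem_omega hu hp T e he
    exact ⟨s, by linarith [le_abs_self s], h⟩
  refine ⟨{p | p ∈ φ.alphaLimitOf v ∧ φ.IsStationary p}, ?_, fun p hp => hp.2,
    {u | φ.IsCompleteTrajectory u ∧ ∀ t, u t ∈ φ.alphaLimitOf v}, ?_, ?_⟩
  · have hvK : ∀ t ≤ 0, v t ∈ closure (v '' Iic 0) := fun t ht => subset_closure ⟨t, ht, rfl⟩
    obtain ⟨y, hy⟩ := PBAux.alpha_nonempty (φ := φ) hK hvK
    obtain ⟨z, hz, -, hzα⟩ := PBAux.alpha_traj hv hK hy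
    obtain ⟨p, hp⟩ := PBAux.alpha_nonempty (φ := φ) hK
      (fun t _ => PBAux.alpha_subset (hzα t) : ∀ t ≤ 0, z t ∈ _)
    exact ⟨p, hαa z hz hzα p hp⟩
  · rintro u ⟨hu, huα⟩
    exact ⟨hu, hαa u hu huα, hαo u hu huα⟩
  · apply Subset.antisymm
    · intro y hy
      obtain ⟨z, hz, hz0, hzα⟩ := PBAux.alpha_traj hv hK hy
      right
      simp only [mem_iUnion]
      exact ⟨z, ⟨hz, hzα⟩, 0, hz0⟩
    · rintro y (hy | hy)
      · exact hy.1
      · simp only [mem_iUnion] at hy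
        obtain ⟨u, ⟨-, huα⟩, t, rfl⟩ := hy
        exact huα t
end

section
/- Let φ be a semiflow on E satisfying (H1), (H2) with j = 2, (H3), (COM) and (S). Let γ₀ be a periodic orbit that is orbitally stable and isolated, i.e., there exists ε > 0 such that the closure of the ε-neighborhood O_ε(γ₀) contains no stationary points and no periodic points whose orbit differs from γ₀. Then γ₀ is asymptotically orbitally stable: γ₀ is orbitally stable and there is δ > 0 such that dist_E(φ^t(v), γ₀) → 0 as t → +∞ for every v ∈ O_δ(γ₀). -/
open Set Filter Topology MeasureTheory Bornology

theorem exp_lift_const {S : Set ℝ} (hS : IsPreconnected S) {f : ℝ → ℂ} (hf : ContinuousOn f S)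
    {c : ℂ} (h : ∀ x ∈ S, Complex.exp (f x) = c) {x y : ℝ} (hx : x ∈ S) (hy : y ∈ S) :
    f x = f y := by
  have hcount : (f '' S).Countable := by
    apply Set.Countable.mono (s₂ := Set.range fun n : ℤ => f x + n * (2 * Real.pi * Complex.I))
    · rintro _ ⟨z, hz, rfl⟩
      obtain ⟨n, hn⟩ := Complex.exp_eq_exp_iff_exists_int.1 ((h z hz).trans (h x hx).symm)
      exact ⟨n, hn.symm⟩
    · exact Set.countable_range _
  exact hcount.isTotallyDisconnected _ subset_rfl (hS.image f hf)
    (Set.mem_image_of_mem f hx) (Set.mem_image_of_mem f hy)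

theorem exp_lift_sub {S : Set ℝ} (hS : IsPreconnected S) {F f : ℝ → ℂ} (hF : ContinuousOn F S)
    (hf : ContinuousOn f S) {k : ℂ}
    (h : ∀ x ∈ S, Complex.exp (F x) = k * Complex.exp (f x)) {x y : ℝ} (hx : x ∈ S) (hy : y ∈ S) :
    F x - F y = f x - f y := by
  have := exp_lift_const hS (hF.sub hf) (c := k) (fun z hz => by
    rw [Pi.sub_apply, Complex.exp_sub, h z hz, mul_div_cancel_right₀ _ (Complex.exp_ne_zero _)])
    hx hy
  simp only [Pi.sub_apply] at this
  linear_combination this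

theorem exp_inj_of_im {z w : ℂ} (h : Complex.exp z = Complex.exp w)
    (hi : |z.im - w.im| < 2 * Real.pi) : z = w := by
  obtain ⟨n, hn⟩ := Complex.exp_eq_exp_iff_exists_int.1 h
  have h1 : z.im - w.im = n * (2 * Real.pi) := by rw [hn]; simp
  rw [h1, abs_mul, abs_of_pos Real.two_pi_pos] at hi
  have h2 : |(n : ℝ)| < 1 := by
    by_contra hc
    push Not at hc
    nlinarith [Real.two_pi_pos]
  have h3 : n = 0 := by
    rw [← Int.abs_lt_one_iff]
    exact_mod_cast h2
  rw [hn, h3]; simp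

/-- angular variation of a lift of a path in a closed half-plane is at most `π`. -/
theorem half_plane_var {S : Set ℝ} (hS : IsPreconnected S) {F q : ℝ → ℂ} (hF : ContinuousOn F S)
    (hq : ContinuousOn q S) {k : ℂ} (hk : k ≠ 0)
    (h : ∀ x ∈ S, Complex.exp (F x) = q x)
    (hre : ∀ x ∈ S, 0 ≤ (k * q x).re) {x y : ℝ} (hx : x ∈ S) (hy : y ∈ S) :
    |(F x - F y).im| ≤ Real.pi := by
  have hne : ∀ x ∈ S, k * q x ≠ 0 := fun x hx => by
    rw [← h x hx]; exact mul_ne_zero hk (Complex.exp_ne_zero _)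
  have hsl : ∀ x ∈ S, k * q x ∈ Complex.slitPlane := fun x hx => by
    rw [Complex.mem_slitPlane_iff]
    rcases (hre x hx).lt_or_eq with h0 | h0
    · exact Or.inl h0
    · right
      intro him
      exact hne x hx (Complex.ext h0.symm him)
  have := exp_lift_sub hS hF (f := fun x => Complex.log (k * q x)) (k := k⁻¹)
    ((continuousOn_const.mul hq).clog hsl) (fun x hx => by
      rw [Complex.exp_log (hne x hx), h x hx]; field_simp) hx hy
  rw [this]
  simp only [Complex.sub_im, Complex.log_im]
  have h1 := Complex.abs_arg_le_pi_div_two_iff.2 (hre x hx)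
  have h2 := Complex.abs_arg_le_pi_div_two_iff.2 (hre y hy)
  rw [abs_le] at *
  constructor <;> linarith

theorem planar_key {p g : ℝ → ℂ} (hp : Continuous p) (hpinj : Function.Injective p)
    (hg : Continuous g) {a : ℝ} (ha : 0 < a) (hper : ∀ t, g (t + 2 * a) = g t)
    {η : ℝ} (hη : ∀ τ, 2 * η ≤ ‖g τ - g (τ - a)‖)
    (hclose : ∀ t ∈ Set.Icc (-(3 * a)) (3 * a), ‖p t - g t‖ < η)
    (hlow : ∀ t, (p 0).im ≤ (p t).im) : False := by
  have hη0 : 0 < η := (norm_nonneg _).trans_lt (hclose 0 ⟨by linarith, by linarith⟩)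
  -- lift of the chord map
  let U : Set (ℝ × ℝ) := {x | x.2 < x.1}
  have hUo : IsOpen U := isOpen_lt continuous_snd continuous_fst
  have hUconv : Convex ℝ U := by
    have : U = {x : ℝ × ℝ | (LinearMap.snd ℝ ℝ ℝ - LinearMap.fst ℝ ℝ ℝ) x < 0} := by
      ext x; simp [U]
    rw [this]
    exact convex_halfSpace_lt (LinearMap.isLinear _) 0
  have hUne : U.Nonempty := ⟨(1, 0), by simp [U]⟩
  have hUsc : IsSimplyConnected U := by
    have := hUconv.contractibleSpace hUne
    exact inferInstanceAs (SimplyConnectedSpace U)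
  obtain ⟨L, hLc, hL⟩ := Complex.exists_continuousOn_eqOn_exp_comp hUsc hUo
    (g := fun x : ℝ × ℝ => p x.1 - p x.2) (by fun_prop) (by
      rintro ⟨x, hx, h0⟩
      have := hpinj (sub_eq_zero.1 h0)
      simp only [U, Set.mem_ofPred_eq] at hx
      linarith)
  have hLe : ∀ t s, s < t → Complex.exp (L (t, s)) = p t - p s := fun t s h => hL (x := (t, s)) h
  -- lift of the chord of g
  set c : ℝ → ℂ := fun τ => g τ - g (τ - a) with hc
  have hcc : Continuous c := by fun_prop
  have hcne : ∀ τ, c τ ≠ 0 := fun τ h0 => by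
    have := hη τ
    have h1 : g τ - g (τ - a) = 0 := h0
    rw [h1, norm_zero] at this; linarith
  obtain ⟨l, hlc, hl⟩ : ∃ l : ℝ → ℂ, Continuous l ∧ ∀ τ, Complex.exp (l τ) = c τ := by
    obtain ⟨l, h1, h2⟩ := Complex.exists_continuousOn_eqOn_exp_comp (X := ℝ) (U := Set.univ)
      (by
        have := (convex_univ (𝕜 := ℝ) (E := ℝ)).contractibleSpace Set.univ_nonempty
        exact inferInstanceAs (SimplyConnectedSpace (Set.univ : Set ℝ))) isOpen_univ hcc.continuousOn (by
        rintro ⟨x, -, h0⟩; exact hcne x h0)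
    exact ⟨l, continuousOn_univ.1 h1, fun τ => h2 (Set.mem_univ τ)⟩
  have hca : ∀ τ, c (τ + a) = - c τ := fun τ => by
    have h1 : g (τ + a) = g (τ - a) := by rw [← hper (τ - a)]; ring_nf
    simp only [hc, h1, add_sub_cancel_right]; ring
  have hc3 : ∀ τ, c τ = g τ - g (τ - 3 * a) := fun τ => by
    have h1 : g (τ - a) = g (τ - 3 * a) := by rw [← hper (τ - 3 * a)]; ring_nf
    simp only [hc, h1]
  -- the half period increment
  have hd : ∀ τ, Complex.exp (l (τ + a) - l τ) = -1 := fun τ => by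
    rw [Complex.exp_sub, hl, hl, hca, neg_div, div_self (hcne τ)]
  have hdconst := exp_lift_const isPreconnected_univ (f := fun τ => l (τ + a) - l τ)
    (by fun_prop) (fun x _ => hd x) (Set.mem_univ (2 * a)) (Set.mem_univ a)
  -- generic comparison
  have hcmp : ∀ b, 0 < b → b ≤ 3 * a → (∀ τ, c τ = g τ - g (τ - b)) →
      ∃ r0 r1 : ℂ, 0 < r0.re ∧ 0 < r1.re ∧ p 0 - p (-b) = c 0 * r0 ∧ p b - p 0 = c b * r1 ∧
        L (b, 0) - L (0, -b) = l b - l 0 + (Complex.log r1 - Complex.log r0) := by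
    intro b hb hb3 hcb
    set r : ℝ → ℂ := fun τ => (p τ - p (τ - b)) / c τ with hr
    have hrc : Continuous r := by
      apply Continuous.div _ hcc hcne
      fun_prop
    have hrre : ∀ τ ∈ Set.Icc 0 b, 0 < (r τ).re := by
      intro τ hτ
      have h1 : ‖r τ - 1‖ < 1 := by
        have h2 : r τ - 1 = (p τ - p (τ - b) - c τ) / c τ := by
          rw [sub_div, div_self (hcne τ)]
        rw [h2, norm_div, div_lt_one (norm_pos_iff.2 (hcne τ))]
        have h3 := hclose τ ⟨by linarith [hτ.1], by linarith [hτ.2]⟩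
        have h4 := hclose (τ - b) ⟨by linarith [hτ.1], by linarith [hτ.2]⟩
        calc ‖p τ - p (τ - b) - c τ‖ = ‖(p τ - g τ) - (p (τ - b) - g (τ - b))‖ := by
              rw [hcb]; congr 1; ring
          _ ≤ ‖p τ - g τ‖ + ‖p (τ - b) - g (τ - b)‖ := norm_sub_le _ _
          _ < 2 * η := by linarith
          _ ≤ ‖c τ‖ := hη τ
      have h5 := (Complex.abs_re_le_norm (r τ - 1)).trans_lt h1
      rw [Complex.sub_re, Complex.one_re, abs_lt] at h5
      linarith [h5.1]
    have hrmul : ∀ τ, p τ - p (τ - b) = c τ * r τ := fun τ => by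
      rw [hr]; field_simp [hcne τ]
    have h0 : (0 : ℝ) ∈ Set.Icc 0 b := ⟨le_rfl, hb.le⟩
    have h1 : b ∈ Set.Icc 0 b := ⟨hb.le, le_rfl⟩
    refine ⟨r 0, r b, hrre 0 h0, hrre b h1, by simpa using hrmul 0, by simpa using hrmul b, ?_⟩
    have := exp_lift_sub (S := Set.Icc 0 b) isPreconnected_Icc (F := fun τ => L (τ, τ - b))
      (f := fun τ => l τ + Complex.log (r τ)) (k := 1)
      (hLc.comp (by fun_prop) (fun τ _ => by simp [U, hb]))
      (hlc.continuousOn.add (hrc.continuousOn.clog (fun τ hτ => Or.inl (hrre τ hτ))))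
      (fun τ hτ => by
        have hne : r τ ≠ 0 := fun h => by have := hrre τ hτ; rw [h] at this; simp at this
        rw [hLe _ _ (by linarith), Complex.exp_add, hl, Complex.exp_log hne, hrmul, one_mul])
      h1 h0
    simp only [sub_self, zero_sub] at this
    rw [this]; ring
  obtain ⟨s0, s1, hs0, hs1, hs0e, hs1e, hs⟩ := hcmp a ha (by linarith) (fun τ => rfl)
  obtain ⟨r0, r1, hr0, hr1, hr0e, hr1e, hr⟩ := hcmp (3 * a) (by linarith) le_rfl hc3
  have hne : ∀ z : ℂ, 0 < z.re → z ≠ 0 := fun z hz h => by rw [h] at hz; simp at hz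
  have harg : ∀ z : ℂ, 0 < z.re → |(Complex.log z).im| < Real.pi / 2 := fun z hz => by
    rw [Complex.log_im]; exact Complex.abs_arg_lt_pi_div_two_iff.2 (Or.inl hz)
  have hΔ1 : L (3 * a, 0) - L (a, 0) = Complex.log r1 - Complex.log s1 := by
    apply exp_inj_of_im
    · have hc31 : c (3 * a) = c a := by
        rw [show 3 * a = a + a + a by ring, hca, hca, neg_neg]
      rw [Complex.exp_sub, Complex.exp_sub, hLe _ _ (by linarith), hLe _ _ ha,
        Complex.exp_log (hne _ hr1), Complex.exp_log (hne _ hs1), hr1e, hs1e, hc31,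
        mul_div_mul_left _ _ (hcne a)]
    · have h1 := half_plane_var (S := Set.Ioi 0) isPreconnected_Ioi (F := fun t => L (t, 0))
        (q := fun t => p t - p 0) (k := -Complex.I)
        (hLc.comp (by fun_prop) (fun t ht => ht)) (by fun_prop) (by simp)
        (fun t ht => hLe t 0 ht) (fun t _ => by simpa using hlow t)
        (x := 3 * a) (y := a) (by simp [ha]) (by simp [ha])
      have h2 := harg _ hr1
      have h3 := harg _ hs1
      simp only [Complex.sub_im] at h1 ⊢
      rw [abs_lt] at *
      rw [abs_le] at h1
      constructor <;> linarith [h1.1, h1.2, h2.1, h2.2, h3.1, h3.2]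
  have hΔ2 : L (0, -(3 * a)) - L (0, -a) = Complex.log r0 - Complex.log s0 := by
    apply exp_inj_of_im
    · rw [Complex.exp_sub, Complex.exp_sub, hLe _ _ (by linarith), hLe _ _ (by linarith),
        Complex.exp_log (hne _ hr0), Complex.exp_log (hne _ hs0), hr0e, hs0e,
        mul_div_mul_left _ _ (hcne 0)]
    · have h1 := half_plane_var (S := Set.Iio 0) isPreconnected_Iio (F := fun t => L (0, t))
        (q := fun t => p 0 - p t) (k := Complex.I)
        (hLc.comp (by fun_prop) (fun t ht => ht)) (by fun_prop) (by simp)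
        (fun t ht => hLe 0 t ht) (fun t _ => by simpa using hlow t)
        (x := -(3 * a)) (y := -a) (by simp [ha]) (by simp [ha])
      have h2 := harg _ hr0
      have h3 := harg _ hs0
      simp only [Complex.sub_im] at h1 ⊢
      rw [abs_lt] at *
      rw [abs_le] at h1
      constructor <;> linarith [h1.1, h1.2, h2.1, h2.2, h3.1, h3.2]
  have hda : l (a + a) - l a = 0 := by
    have e1 : l (2 * a + a) = l (3 * a) := by congr 1; ring
    have e2 : l (a + a) = l (2 * a) := by congr 1; ring
    simp only [e1, e2] at hdconst ⊢
    linear_combination (1 / 2 : ℂ) * (-hdconst - hr + hs + hΔ1 - hΔ2)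
  have := hd a
  rw [hda, Complex.exp_zero] at this
  norm_num at this

section Dynamics

variable {E : Type*} [NormedAddCommGroup E] [NormedSpace ℝ E]
variable {H : Type*} [NormedAddCommGroup H] [InnerProductSpace ℝ H]

theorem Semiflow.continuous_ext (φ : Semiflow E) :
    Continuous fun q : ℝ × E => φ.toFun (max q.1 0) q.2 := by
  have h : Continuous fun q : ℝ × E => ((max q.1 0, q.2) : ℝ × E) := by fun_prop
  exact φ.continuousOn'.comp_continuous h (fun q => ⟨Set.mem_Ici.2 (le_max_right _ _), Set.mem_univ _⟩)

theorem Semiflow.continuous_map (φ : Semiflow E) {t : ℝ} (ht : 0 ≤ t) :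
    Continuous (φ.toFun t) := by
  have h := φ.continuous_ext.comp (Continuous.prodMk_right t)
  refine h.congr fun x => ?_
  simp [ht]

theorem cone_inj {φ : Semiflow E} {ι : E →L[ℝ] H} (hι : Function.Injective ι)
    {P : E →L[ℝ] E →L[ℝ] ℝ} {δ τV ν : ℝ} (hH3 : φ.IsH3 ι P δ τV ν) {u w : ℝ → E}
    (hu : φ.IsCompleteTrajectory u) (hw : φ.IsCompleteTrajectory w) {B : ℝ}
    (hB : ∀ t, ‖u t - w t‖ ≤ B) (hV : 0 ≤ P (u 0 - w 0) (u 0 - w 0)) : u 0 = w 0 := by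
  obtain ⟨hδ, hτ, hν, hsq⟩ := hH3
  by_contra hne
  have huc := hu.1
  have hwc := hw.1
  set f : ℝ → ℝ := fun s => Real.exp (2 * ν * s) * ‖ι (u s) - ι (w s)‖ ^ 2 with hf
  have hfc : Continuous f := by fun_prop
  have hf0 : 0 < f 0 := by
    have : ι (u 0) - ι (w 0) ≠ 0 := fun h => hne (hι (sub_eq_zero.1 h))
    have := norm_pos_iff.2 this
    simp only [hf]; positivity
  have hfnn : ∀ s, 0 ≤ f s := fun s => by simp only [hf]; positivity
  obtain ⟨a, ha, hfa⟩ : ∃ a > 0, ∀ s ∈ Set.Icc (-a) 0, f 0 / 2 ≤ f s := by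
    have h1 : ∀ᶠ s in 𝓝 0, f 0 / 2 < f s :=
      hfc.continuousAt.eventually_const_lt (by linarith)
    obtain ⟨a, ha, h2⟩ := Metric.eventually_nhds_iff.1 h1
    refine ⟨a / 2, by linarith, fun s hs => (h2 ?_).le⟩
    rw [Real.dist_eq, abs_lt]
    constructor <;> linarith [hs.1, hs.2]
  have key : ∀ T, τV ≤ T → a ≤ T → δ * (a * (f 0 / 2)) * Real.exp (2 * ν * T) ≤ ‖P‖ * B * B := by
    intro T hT haT
    have hT0 : 0 ≤ T := ha.le.trans haT
    have h := hsq (u (-T)) (w (-T)) 0 T le_rfl hT0 (by linarith)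
    have hus : ∀ s, 0 ≤ s → φ.toFun s (u (-T)) = u (s - T) := fun s hs =>
      (hu.2 s hs (-T)).symm
    have hws : ∀ s, 0 ≤ s → φ.toFun s (w (-T)) = w (s - T) := fun s hs =>
      (hw.2 s hs (-T)).symm
    have hint : ∫ s in (0 : ℝ)..T, Real.exp (2 * ν * s) *
        ‖ι (φ.toFun s (u (-T))) - ι (φ.toFun s (w (-T)))‖ ^ 2 =
        Real.exp (2 * ν * T) * ∫ s in (-T)..0, f s := by
      have e1 : ∫ s in (-T)..0, f s = ∫ s in (0 : ℝ)..T, f (s - T) := by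
        rw [intervalIntegral.integral_comp_sub_right f T]; simp
      rw [e1, ← intervalIntegral.integral_const_mul]
      apply intervalIntegral.integral_congr
      intro s hs
      rw [Set.uIcc_of_le hT0] at hs
      simp only [hus s hs.1, hws s hs.1, hf]
      rw [← mul_assoc, ← Real.exp_add]
      congr 2; ring
    have hlow : a * (f 0 / 2) ≤ ∫ s in (-T)..0, f s := by
      have h1 : ∫ s in (-a)..0, f s ≤ ∫ s in (-T)..0, f s :=
        intervalIntegral.integral_mono_interval (by linarith) (by linarith) le_rfl
          (Filter.Eventually.of_forall hfnn) (hfc.intervalIntegrable _ _)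
      have h2 : ∫ _ in (-a)..0, f 0 / 2 ≤ ∫ s in (-a)..0, f s :=
        intervalIntegral.integral_mono_on (by linarith) (by simp) (hfc.intervalIntegrable _ _) hfa
      simp at h2
      linarith
    rw [hint, hus T hT0, hws T hT0, hus 0 le_rfl, hws 0 le_rfl] at h
    simp only [sub_self, zero_sub, mul_zero, Real.exp_zero, one_mul] at h
    have hPB : P (u (-T) - w (-T)) (u (-T) - w (-T)) ≤ ‖P‖ * B * B := by
      calc P (u (-T) - w (-T)) (u (-T) - w (-T)) ≤ ‖P (u (-T) - w (-T)) (u (-T) - w (-T))‖ :=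
            Real.le_norm_self _
        _ ≤ ‖P‖ * ‖u (-T) - w (-T)‖ * ‖u (-T) - w (-T)‖ := P.le_opNorm₂ _ _
        _ ≤ ‖P‖ * B * B := by
            have := hB (-T)
            have hB0 : 0 ≤ B := (norm_nonneg _).trans this
            gcongr
    have he := Real.exp_pos (2 * ν * T)
    have h3 : 0 ≤ Real.exp (2 * ν * T) * P (u 0 - w 0) (u 0 - w 0) := by positivity
    have h4 : δ * (Real.exp (2 * ν * T) * (a * (f 0 / 2))) ≤
        δ * (Real.exp (2 * ν * T) * ∫ s in (-T)..0, f s) := by gcongr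
    linarith
  have htend : Tendsto (fun T => δ * (a * (f 0 / 2)) * Real.exp (2 * ν * T)) atTop atTop := by
    apply Tendsto.const_mul_atTop (by positivity)
    exact Real.tendsto_exp_atTop.comp (Tendsto.const_mul_atTop (by positivity) tendsto_id)
  obtain ⟨T, h1, h2, h3⟩ := ((htend.eventually_gt_atTop (‖P‖ * B * B)).and
    ((eventually_ge_atTop τV).and (eventually_ge_atTop a))).exists
  linarith [key T h2 h3]

theorem exists_plane_proj {P : E →L[ℝ] E →L[ℝ] ℝ} {Eplus Eminus : Submodule ℝ E}
    (hH1 : Semiflow.IsH1 P Eplus Eminus) [FiniteDimensional ℝ ↥Eminus]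
    (hH2 : Module.finrank ℝ ↥Eminus = 2) :
    ∃ Q : E →L[ℝ] ℂ, ∀ x, Q x = 0 → 0 ≤ P x x := by
  obtain ⟨-, hcl, -, hcompl, hpos, -⟩ := hH1
  have : IsClosed (Eplus : Set E) := hcl
  let e := Submodule.quotientEquivOfIsCompl Eplus Eminus hcompl
  have : FiniteDimensional ℝ (E ⧸ Eplus) := e.symm.finiteDimensional
  have hfr : Module.finrank ℝ (E ⧸ Eplus) = Module.finrank ℝ ℂ := by
    rw [e.finrank_eq, hH2, Complex.finrank_real_complex]
  let e2 := LinearEquiv.ofFinrankEq (R := ℝ) _ _ hfr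
  let q : E →L[ℝ] ℂ := (LinearMap.toContinuousLinearMap (e2 : (E ⧸ Eplus) →ₗ[ℝ] ℂ)).comp
    Eplus.mkQL
  refine ⟨q, fun x hx => ?_⟩
  have hx' : e2 (Submodule.Quotient.mk x) = 0 := hx
  have hmem : x ∈ Eplus := by
    rw [← Submodule.Quotient.mk_eq_zero]
    exact e2.map_eq_zero_iff.1 hx'
  by_cases h0 : x = 0
  · simp [h0]
  · exact (hpos x hmem h0).le

theorem continuous_of_trajectory (φ : Semiflow E) {u : ℝ → E}
    (h : ∀ t : ℝ, 0 ≤ t → ∀ s : ℝ, u (t + s) = φ.toFun t (u s)) : Continuous u := by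
  rw [continuous_iff_continuousAt]
  intro t
  have h1 : Continuous fun x : ℝ => φ.toFun (max (x - (t - 1)) 0) (u (t - 1)) :=
    φ.continuous_ext.comp (f := fun x : ℝ => (x - (t - 1), u (t - 1))) (by fun_prop)
  refine h1.continuousAt.congr ?_
  filter_upwards [eventually_gt_nhds (show t - 1 < t by linarith)] with x hx
  rw [max_eq_left (by linarith), ← h _ (by linarith)]
  congr 1; ring

theorem exists_trajectory_of_mapClusterPt (φ : Semiflow E) {v x : E} {K : Set E}
    (hK : IsCompact K) {τ : ℝ} (hτ : ∀ t, τ ≤ t → φ.toFun t v ∈ K)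
    (hx : MapClusterPt x atTop (fun t => φ.toFun t v)) :
    ∃ u : ℝ → E, φ.IsCompleteTrajectory u ∧ u 0 = x ∧
      ∀ s, MapClusterPt (u s) atTop (fun t => φ.toFun t v) := by
  obtain ⟨U, hU, hUx⟩ := mapClusterPt_iff_ultrafilter.1 hx
  have hex : ∀ s : ℝ, ∃ y, Tendsto (fun t => φ.toFun (t + s) v) U (𝓝 y) := by
    intro s
    have h1 : ∀ᶠ t in (U : Filter ℝ), φ.toFun (t + s) v ∈ K := by
      apply hU
      filter_upwards [eventually_ge_atTop (τ - s)] with t ht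
      exact hτ _ (by linarith)
    obtain ⟨y, -, hy⟩ := isCompact_iff_ultrafilter_le_nhds.1 hK
      (U.map (fun t => φ.toFun (t + s) v)) (by rw [Filter.le_principal_iff]; exact h1)
    exact ⟨y, hy⟩
  choose u hu using hex
  have htraj : ∀ t : ℝ, 0 ≤ t → ∀ s : ℝ, u (t + s) = φ.toFun t (u s) := by
    intro t ht s
    refine tendsto_nhds_unique (hu (t + s)) ?_
    refine (((φ.continuous_map ht).tendsto (u s)).comp (hu s)).congr' ?_
    apply hU
    filter_upwards [eventually_ge_atTop (-s)] with r hr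
    simp only [Function.comp]
    rw [← φ.map_add' t (r + s) ht (by linarith)]
    congr 1; ring
  refine ⟨u, ⟨continuous_of_trajectory φ htraj, htraj⟩, ?_, fun s => ?_⟩
  · have := hu 0
    simp only [add_zero] at this
    exact tendsto_nhds_unique this hUx
  · have h1 : MapClusterPt (u s) (U : Filter ℝ) (fun t => φ.toFun (t + s) v) :=
      (hu s).mapClusterPt
    have h2 : MapClusterPt (u s) atTop ((fun t => φ.toFun t v) ∘ (fun t => t + s)) := h1.mono hU
    exact h2.of_comp (tendsto_atTop_add_const_right _ _ tendsto_id)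

/-- A periodic point lies on a complete periodic trajectory with minimal period `2 a`. -/
theorem exists_periodic_trajectory (φ : Semiflow E) {v₀ : E} (hper : φ.IsPeriodicPt v₀) :
    ∃ (G : ℝ → E) (a : ℝ), 0 < a ∧ φ.IsCompleteTrajectory G ∧ G 0 = v₀ ∧
      (∀ t, G (t + 2 * a) = G t) ∧ (∀ t, G t ≠ G (t - a)) ∧ φ.orbit v₀ = Set.range G := by
  obtain ⟨hns, σ, hσ, hσv⟩ := hper
  have hn : ∀ n : ℕ, φ.toFun (n * σ) v₀ = v₀ := by
    intro n
    induction n with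
    | zero => simpa using φ.map_zero' v₀
    | succ n ih =>
      push_cast
      rw [add_mul, one_mul, φ.map_add' _ _ (by positivity) hσ.le, hσv, ih]
  have hn' : ∀ (n : ℕ) (t : ℝ), 0 ≤ t → φ.toFun (t + n * σ) v₀ = φ.toFun t v₀ := fun n t ht => by
    rw [φ.map_add' _ _ ht (by positivity), hn]
  set N : ℝ → ℕ := fun t => ⌈|t| / σ⌉₊ with hN
  have hNt : ∀ t, 0 ≤ t + N t * σ := fun t => by
    have h1 : |t| / σ ≤ N t := Nat.le_ceil _
    rw [div_le_iff₀ hσ] at h1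
    linarith [neg_abs_le t]
  set G : ℝ → E := fun t => φ.toFun (t + N t * σ) v₀ with hG
  have hGn : ∀ (t : ℝ) (n : ℕ), 0 ≤ t + n * σ → G t = φ.toFun (t + n * σ) v₀ := by
    intro t n h
    simp only [hG]
    rw [← hn' n _ (hNt t), ← hn' (N t) _ h]
    congr 1; ring
  have hGtraj : ∀ t : ℝ, 0 ≤ t → ∀ s : ℝ, G (t + s) = φ.toFun t (G s) := by
    intro t ht s
    rw [hGn (t + s) (N s) (by linarith [hNt s]), hGn s (N s) (hNt s),
      ← φ.map_add' _ _ ht (hNt s), add_assoc]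
  have hGpos : ∀ t, 0 ≤ t → G t = φ.toFun t v₀ := fun t ht => by
    simpa using hGn t 0 (by simpa using ht)
  have hGσ : ∀ t, G (t + σ) = G t := fun t => by
    rw [hGn (t + σ) (N t) (by linarith [hNt t]), hGn t (N t + 1) (by push_cast; linarith [hNt t])]
    congr 1; push_cast; ring
  have hGσn : ∀ (n : ℕ) t, G (t + n * σ) = G t := fun n => by
    induction n with
    | zero => simp
    | succ n ih =>
      intro t
      rw [← ih t, ← hGσ (t + n * σ)]
      congr 1; push_cast; ring
  have hGc : Continuous G := continuous_of_trajectory φ hGtraj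
  have hG0 : G 0 = v₀ := by rw [hGpos 0 le_rfl, φ.map_zero']
  -- coincidences are periods
  have hco : ∀ x y, G x = G y → ∀ t, G (t + x) = G (t + y) := by
    intro x y hxy t
    rw [← hGσn (N t) (t + x), ← hGσn (N t) (t + y),
      show t + x + N t * σ = (t + N t * σ) + x by ring,
      show t + y + N t * σ = (t + N t * σ) + y by ring,
      hGtraj _ (hNt t), hGtraj _ (hNt t), hxy]
  let S : AddSubgroup ℝ :=
    { carrier := {r | ∀ t, G (t + r) = G t}
      zero_mem' := by intro t; simp
      add_mem' := by
        intro r s hr hs t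
        rw [← add_assoc, hs, hr]
      neg_mem' := by
        intro r hr t
        rw [← hr (t + -r)]; simp }
  have hSmem : ∀ r, r ∈ S ↔ ∀ t, G (t + r) = G t := fun r => Iff.rfl
  have hScl : IsClosed (S : Set ℝ) := by
    have : (S : Set ℝ) = ⋂ t, {r | G (t + r) = G t} := by
      ext r; simp [hSmem]
    rw [this]
    exact isClosed_iInter fun t => isClosed_eq (by fun_prop) continuous_const
  have hSσ : σ ∈ S := hGσ
  obtain ⟨b, hb⟩ : ∃ b, S = AddSubgroup.closure {b} := by
    refine S.dense_or_cyclic.resolve_left fun hd => hns fun t ht => ?_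
    have h1 : t ∈ S := by
      have := hd.closure_eq
      rw [hScl.closure_eq] at this
      have h2 : t ∈ (S : Set ℝ) := by rw [this]; trivial
      exact h2
    rw [← hGpos t ht, ← hG0]
    simpa using h1 0
  have hSz : ∀ r, r ∈ S ↔ ∃ n : ℤ, n • b = r := fun r => by
    rw [hb, AddSubgroup.mem_closure_singleton]
  have hb0 : b ≠ 0 := by
    rintro rfl
    obtain ⟨n, hn⟩ := (hSz σ).1 hSσ
    simp at hn; linarith
  have hbS : |b| ∈ S := by
    rw [hSz]
    rcases abs_choice b with h | h
    · exact ⟨1, by simp [h]⟩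
    · exact ⟨-1, by simp [h]⟩
  have hbpos := abs_pos.2 hb0
  refine ⟨G, |b| / 2, by positivity, ⟨hGc, hGtraj⟩, hG0, fun t => ?_, fun t h => ?_, ?_⟩
  · rw [mul_div_cancel₀ _ (two_ne_zero)]
    exact hbS t
  · have h1 : |b| / 2 ∈ S := fun s => by
      have := hco _ _ h (s - t + |b| / 2)
      convert this using 2 <;> ring
    obtain ⟨n, hn⟩ := (hSz _).1 h1
    have h2 : |(n : ℝ)| * |b| = |b| / 2 := by
      rw [← abs_mul, ← zsmul_eq_mul, hn, abs_div, abs_abs]; simp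
    have h3 : |(n : ℝ)| = 1 / 2 := by
      field_simp at h2 ⊢
      linarith
    have h4 : (2 : ℝ) * |(n : ℝ)| = 1 := by rw [h3]; norm_num
    have h5 : 2 * |n| = 1 := by exact_mod_cast h4
    omega
  · ext w
    constructor
    · rintro ⟨t, ht, rfl⟩
      exact ⟨t, hGpos t ht⟩
    · rintro ⟨t, rfl⟩
      exact ⟨_, hNt t, rfl⟩

end Dynamics

/-- Corollary 2: an isolated orbitally stable periodic orbit is asymptotically
orbitally stable. -/
theorem isolated_orbitallyStable_is_asymptoticallyStable
    {E : Type*} [NormedAddCommGroup E] [NormedSpace ℝ E]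
    {H : Type*} [NormedAddCommGroup H] [InnerProductSpace ℝ H]
    (ι : E →L[ℝ] H) (hι : Function.Injective ι)
    (φ : Semiflow E)
    (P : E →L[ℝ] E →L[ℝ] ℝ) (Eplus Eminus : Submodule ℝ E)
    (hH1 : Semiflow.IsH1 P Eplus Eminus)
    [FiniteDimensional ℝ ↥Eminus] (hH2 : Module.finrank ℝ ↥Eminus = 2)
    (δ τV ν : ℝ) (hH3 : φ.IsH3 ι P δ τV ν)
    (hCOM : φ.IsCOM) (hS : φ.IsSmoothing ι)
    (v₀ : E) (hper : φ.IsPeriodicPt v₀) (γ₀ : Set E) (hγ₀ : γ₀ = φ.orbit v₀)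
    (hstab : φ.IsOrbitallyStable γ₀)
    (hiso : ∃ ε : ℝ, 0 < ε ∧ ∀ u ∈ closure (setNbhd γ₀ ε),
      ¬ φ.IsStationary u ∧ (φ.IsPeriodicPt u → φ.orbit u = γ₀)) :
    φ.IsOrbitallyStable γ₀ ∧
      ∃ δ : ℝ, 0 < δ ∧ ∀ v ∈ setNbhd γ₀ δ,
        Filter.Tendsto (fun t : ℝ => Metric.infDist (φ.toFun t v) γ₀)
          Filter.atTop (nhds 0) := by
  refine ⟨hstab, ?_⟩
  obtain ⟨ε, hε, hiso⟩ := hiso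
  obtain ⟨Q, hQ⟩ := exists_plane_proj hH1 hH2
  obtain ⟨G, a, ha, hGt, hG0, hGper, hGne, hGorb⟩ := exists_periodic_trajectory φ hper
  have hGc := hGt.1
  have hγ : γ₀ = Set.range G := by rw [hγ₀, hGorb]
  have hGP : Function.Periodic G (2 * a) := hGper
  have hγc : IsCompact γ₀ := by
    rw [hγ]; exact hGP.compact_of_continuous (by positivity) hGc
  -- injectivity of the projection along bounded complete trajectories
  have hQinj : ∀ u w : ℝ → E, φ.IsCompleteTrajectory u → φ.IsCompleteTrajectory w →
      IsBounded (Set.range u) → IsBounded (Set.range w) → ∀ s t, Q (u s) = Q (w t) →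
      u s = w t := by
    intro u w hu hw hub hwb s t hst
    obtain ⟨B1, hB1⟩ := hub.exists_norm_le
    obtain ⟨B2, hB2⟩ := hwb.exists_norm_le
    have hsh : ∀ (z : ℝ → E) (s : ℝ), φ.IsCompleteTrajectory z →
        φ.IsCompleteTrajectory (fun r => z (r + s)) := fun z s hz =>
      ⟨hz.1.comp (by fun_prop), fun t ht r => by simp only [add_assoc, hz.2 t ht]⟩
    have := cone_inj hι hH3 (hsh u s hu) (hsh w t hw) (B := B1 + B2)
      (fun r => (norm_sub_le _ _).trans
        (add_le_add (hB1 _ ⟨_, rfl⟩) (hB2 _ ⟨_, rfl⟩)))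
      (hQ _ (by simp [hst]))
    simpa using this
  have hGb : IsBounded (Set.range G) := hγ ▸ hγc.isBounded
  -- minimal chord
  obtain ⟨η, hη, hηc⟩ : ∃ η > 0, ∀ τ, 2 * η ≤ ‖Q (G τ) - Q (G (τ - a))‖ := by
    set c : ℝ → ℝ := fun τ => ‖Q (G τ) - Q (G (τ - a))‖ with hc
    have hcc : Continuous c := by fun_prop
    have hcP : Function.Periodic c (2 * a) := fun τ => by
      simp only [hc, hGper τ]
      rw [show τ + 2 * a - a = (τ - a) + 2 * a by ring, hGper]
    obtain ⟨_, ⟨τ₀, rfl⟩, hmin⟩ := (hcP.compact_of_continuous (by positivity) hcc).exists_isLeast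
      (Set.range_nonempty c)
    refine ⟨c τ₀ / 2, ?_, fun τ => ?_⟩
    · have : 0 < c τ₀ := norm_pos_iff.2 fun h =>
        hGne τ₀ (hQinj G G hGt hGt hGb hGb _ _ (sub_eq_zero.1 h))
      linarith
    · have := hmin ⟨τ, rfl⟩
      linarith
  -- uniform continuous dependence
  obtain ⟨ε', hε', hdep⟩ : ∃ ε' > 0, ∀ w ∈ γ₀, ∀ x, ‖x - w‖ < ε' → ∀ t ∈ Set.Icc 0 (6 * a),
      ‖φ.toFun t x - φ.toFun t w‖ < η / (‖Q‖ + 1) := by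
    have h1 := ((isCompact_Icc (a := (0 : ℝ)) (b := 6 * a)).prod hγc).uniformContinuousAt_of_continuousAt
      _ (fun q _ => φ.continuous_ext.continuousAt)
      (Metric.dist_mem_uniformity (show 0 < η / (‖Q‖ + 1) by positivity))
    obtain ⟨ε', hε', h2⟩ := Metric.mem_uniformity_dist.1 h1
    refine ⟨ε', hε', fun w hw x hxw t ht => ?_⟩
    have h3 := @h2 (t, w) (t, x) (by
      rw [Prod.dist_eq, dist_self, max_eq_right dist_nonneg, dist_comm, dist_eq_norm]
      exact hxw) ⟨ht, hw⟩
    simp only [max_eq_left ht.1, Set.mem_ofPred_eq] at h3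
    rw [dist_comm, dist_eq_norm] at h3
    exact h3
  obtain ⟨δ₁, hδ₁, hst⟩ := hstab (min ε' ε / 2) (by positivity)
  refine ⟨δ₁, hδ₁, fun v hv => ?_⟩
  have horb := hst v hv
  suffices hmain : ∃ z ∈ γ₀, MapClusterPt z atTop (fun t => φ.toFun t v) by
    obtain ⟨z, hz, hzc⟩ := hmain
    rw [Metric.tendsto_atTop]
    intro e he
    obtain ⟨d, hd, hde⟩ := hstab e he
    obtain ⟨t₀, ht₀, ht₀'⟩ := ((hzc.frequently (Metric.ball_mem_nhds z hd)).and_eventually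
      (eventually_ge_atTop 0)).exists
    refine ⟨t₀, fun t ht => ?_⟩
    obtain ⟨w, hw, hwd⟩ := hde (φ.toFun t₀ v) ⟨z, hz, by rw [← dist_eq_norm]; exact ht₀⟩
      (t - t₀) (by linarith)
    rw [← φ.map_add' _ _ (by linarith) ht₀', sub_add_cancel, ← dist_eq_norm] at hwd
    rw [Real.dist_eq, sub_zero, abs_of_nonneg Metric.infDist_nonneg]
    exact (Metric.infDist_le_dist_of_mem hw).trans_lt hwd
  -- the omega limit set
  obtain ⟨τ, hτ, hcom⟩ := hCOM
  have hBd : IsBounded (setNbhd γ₀ (min ε' ε / 2)) := by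
    obtain ⟨R, hR⟩ := hγc.isBounded.exists_norm_le
    rw [isBounded_iff_forall_norm_le]
    refine ⟨R + min ε' ε / 2, ?_⟩
    rintro x ⟨w, hw, hxw⟩
    have := norm_le_norm_add_norm_sub' x w
    linarith [hR w hw]
  set K := closure (φ.toFun τ '' setNbhd γ₀ (min ε' ε / 2)) with hK
  have hKc : IsCompact K := hcom _ hBd
  have hKt : ∀ t, τ ≤ t → φ.toFun t v ∈ K := fun t ht => by
    apply subset_closure
    refine ⟨φ.toFun (t - τ) v, horb _ (by linarith), ?_⟩
    rw [← φ.map_add' _ _ hτ.le (by linarith)]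
    congr 1; ring
  set Ω : Set E := {x | MapClusterPt x atTop (fun t => φ.toFun t v)} with hΩ
  have hΩK : Ω ⊆ K := fun x hx => by
    by_contra hxK
    obtain ⟨t, ht, ht'⟩ := ((MapClusterPt.frequently hx
      (hKc.isClosed.isOpen_compl.mem_nhds hxK)).and_eventually (eventually_ge_atTop τ)).exists
    exact ht (hKt t ht')
  have hΩc : IsCompact Ω := hKc.of_isClosed_subset isClosed_setOfPred_clusterPt hΩK
  have hΩne : Ω.Nonempty := by
    obtain ⟨x, -, hx⟩ := hKc.exists_mapClusterPt (f := atTop) (u := fun t => φ.toFun t v)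
      (by
        rw [Filter.le_principal_iff, Filter.mem_map]
        filter_upwards [eventually_ge_atTop τ] with t ht using hKt t ht)
    exact ⟨x, hx⟩
  have hΩn : ∀ x ∈ Ω, ∃ w ∈ γ₀, ‖x - w‖ < min ε' ε := by
    intro x hx
    have hm : 0 < min ε' ε / 2 := by positivity
    obtain ⟨t, ht, ht'⟩ := ((MapClusterPt.frequently hx (Metric.ball_mem_nhds x hm)).and_eventually
      (eventually_ge_atTop 0)).exists
    obtain ⟨w, hw, hwd⟩ := horb t ht'
    refine ⟨w, hw, ?_⟩
    rw [← dist_eq_norm] at hwd ⊢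
    have h1 : dist (φ.toFun t v) x < min ε' ε / 2 := ht
    have h2 := dist_triangle_left x w (φ.toFun t v)
    linarith
  obtain ⟨x, hxΩ, hxmin⟩ := hΩc.exists_isMinOn hΩne
    (f := fun x => (Q x).im) (by fun_prop)
  obtain ⟨y, hyt, hy0, hyΩ⟩ := exists_trajectory_of_mapClusterPt φ hKc hKt hxΩ
  have hyb : IsBounded (Set.range y) := by
    apply hΩc.isBounded.subset
    rintro _ ⟨s, rfl⟩
    exact hyΩ s
  by_contra hcon
  push Not at hcon
  have hyinj' : ∀ s t, s < t → y s ≠ y t := by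
    intro s t hlt heq
    have hnb : y s ∈ closure (setNbhd γ₀ ε) := by
      apply subset_closure
      obtain ⟨w, hw, h⟩ := hΩn _ (hyΩ s)
      exact ⟨w, hw, h.trans_le (min_le_right _ _)⟩
    obtain ⟨h1, h2⟩ := hiso _ hnb
    have h3 : φ.toFun (t - s) (y s) = y s := by
      rw [← hyt.2 _ (by linarith), sub_add_cancel, heq]
    have h4 := h2 ⟨h1, t - s, by linarith, h3⟩
    refine hcon (y s) ?_ (hyΩ s)
    rw [← h4]
    exact ⟨0, le_rfl, φ.map_zero' _⟩
  have hyinj : Function.Injective (fun t => Q (y t)) := by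
    intro s t hst
    have h1 : y s = y t := hQinj y y hyt hyt hyb hyb s t hst
    rcases lt_trichotomy s t with h | h | h
    · exact absurd h1 (hyinj' s t h)
    · exact h
    · exact absurd h1.symm (hyinj' t s h)
  obtain ⟨w, hw, hwd⟩ := hΩn _ (hyΩ (-(3 * a)))
  rw [hγ] at hw
  obtain ⟨r, rfl⟩ := hw
  have hyc := hyt.1
  refine planar_key (p := fun t => Q (y t)) (g := fun t => Q (G (t + (r + 3 * a))))
    (by fun_prop) hyinj (by fun_prop) ha (fun t => ?_) (η := η) (fun t => ?_) (fun t ht => ?_)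
    (fun t => ?_)
  · rw [show t + 2 * a + (r + 3 * a) = t + (r + 3 * a) + 2 * a by ring, hGper]
  · have := hηc (t + (r + 3 * a))
    rwa [show t + (r + 3 * a) - a = t - a + (r + 3 * a) by ring] at this
  · have h1 := hdep (G r) (hγ ▸ ⟨r, rfl⟩) _ (hwd.trans_le (min_le_left _ _)) (t + 3 * a)
      ⟨by linarith [ht.1], by linarith [ht.2]⟩
    rw [← hyt.2 _ (by linarith [ht.1]), ← hGt.2 _ (by linarith [ht.1]),
      show t + 3 * a + -(3 * a) = t by ring, show t + 3 * a + r = t + (r + 3 * a) by ring] at h1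
    rw [← map_sub]
    rw [lt_div_iff₀ (by positivity)] at h1
    have h2 := Q.le_opNorm (y t - G (t + (r + 3 * a)))
    nlinarith [norm_nonneg (y t - G (t + (r + 3 * a)))]
  · simp only [hy0]
    exact hxmin (hyΩ t)
end
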